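/- Let H be a finite-dimensional Hopf algebra over a field k with bijective antipode. Assume H is semisimple as a ring, and that H is cosemisimple, i.e. the linear dual H* = Hom_k(H, k), equipped with the convolution product (f * g)(x) = Σ f(x_{(1)}) g(x_{(2)}) and unit ε, is a semisimple ring. Then exp(H) is finite and divides (dim_k H)³. -/

import Mathlib

open TensorProduct

noncomputable section

variable (k H : Type*) [CommSemiring k] [Semiring H] [Bialgebra k H]

/-- Convolution product of two linear endomorphisms of a bialgebra:
`(f ⋆ g)(x) = ∑ f(x⁽¹⁾) g(x⁽²⁾)`, i.e. `m ∘ (f ⊗ g) ∘ Δ`. -/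
def conv (f g : H →ₗ[k] H) : H →ₗ[k] H :=
  LinearMap.mul' k H ∘ₗ TensorProduct.map f g ∘ₗ Coalgebra.comul

/-- `expMap k H Sinv n` is the map `m_n ∘ (id ⊗ Sinv² ⊗ Sinv⁴ ⊗ ⋯ ⊗ Sinv^{2n-2}) ∘ Δ_n`
(defined by the recursion `m_1 = Δ_1 = id`, `m_n = m ∘ (m_{n-1} ⊗ id)`,
`Δ_n = (Δ_{n-1} ⊗ id) ∘ Δ`). -/
def expMap (Sinv : H →ₗ[k] H) : ℕ → (H →ₗ[k] H)
  | 0 => 0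
  | 1 => LinearMap.id
  | (n+2) => conv k H (expMap Sinv (n+1)) ((Sinv ∘ₗ Sinv) ^ (n+1))

/-- The map `x ↦ ε(x)·1`. -/
def counitUnit : H →ₗ[k] H := Algebra.linearMap k H ∘ₗ Coalgebra.counit

/-- The exponent of a Hopf algebra (with `Sinv` the inverse of the antipode):
the least `n > 0` with `m_n ∘ (id ⊗ S⁻² ⊗ ⋯ ⊗ S^{-2n+2}) ∘ Δ_n = ε(·)1`.
By convention `hopfExponent = 0` when no such `n` exists (i.e. `exp(H) = ∞`). -/
def hopfExponent (Sinv : H →ₗ[k] H) : ℕ :=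
  sInf {n : ℕ | 0 < n ∧ expMap k H Sinv n = counitUnit k H}


namespace DualConv

variable {k H : Type*} [CommSemiring k] [AddCommMonoid H] [Module k H] [Coalgebra k H]

/-- The convolution product on the linear dual of a coalgebra:
`(f * g)(x) = ∑ f(x⁽¹⁾) g(x⁽²⁾)`. -/
def convDual (f g : H →ₗ[k] k) : H →ₗ[k] k :=
  LinearMap.mul' k k ∘ₗ TensorProduct.map f g ∘ₗ Coalgebra.comul

lemma convDual_apply (f g : H →ₗ[k] k) (x : H) {ι : Type*} (r : Coalgebra.Repr k x ι) :
    convDual f g x = ∑ i ∈ r.index, f (r.left i) * g (r.right i) := by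
  simp [convDual, ← r.eq, map_sum]

lemma convDual_assoc (f g h : H →ₗ[k] k) :
    convDual (convDual f g) h = convDual f (convDual g h) := by
  apply LinearMap.ext; intro x
  set r := Coalgebra.Repr.arbitrary k x with hr
  set a₁ : (i : H × H) → Coalgebra.Repr k (r.left i) (H × H) := fun i => Coalgebra.Repr.arbitrary k _
  set a₂ : (i : H × H) → Coalgebra.Repr k (r.right i) (H × H) := fun i => Coalgebra.Repr.arbitrary k _
  have key := Coalgebra.sum_map_tmul_tmul_eq (R := k) f g h x (repr := r) (a₁ := a₁) (a₂ := a₂)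
  have := congrArg (LinearMap.mul' k k ∘ₗ (LinearMap.mul' k k).lTensor k) key
  simp only [map_sum, LinearMap.comp_apply, LinearMap.lTensor_tmul, LinearMap.mul'_apply] at this
  calc convDual (convDual f g) h x
      = ∑ i ∈ r.index, convDual f g (r.left i) * h (r.right i) := convDual_apply _ _ _ r
    _ = ∑ i ∈ r.index, (∑ j ∈ (a₁ i).index, f ((a₁ i).left j) * g ((a₁ i).right j)) * h (r.right i) := by
        refine Finset.sum_congr rfl fun i _ => ?_
        rw [convDual_apply _ _ _ (a₁ i)]
    _ = ∑ i ∈ r.index, ∑ j ∈ (a₁ i).index, f ((a₁ i).left j) * (g ((a₁ i).right j) * h (r.right i)) := by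
        refine Finset.sum_congr rfl fun i _ => ?_
        rw [Finset.sum_mul]
        exact Finset.sum_congr rfl fun j _ => mul_assoc _ _ _
    _ = ∑ i ∈ r.index, ∑ j ∈ (a₂ i).index, f (r.left i) * (g ((a₂ i).left j) * h ((a₂ i).right j)) := this.symm
    _ = ∑ i ∈ r.index, f (r.left i) * convDual g h (r.right i) := by
        refine Finset.sum_congr rfl fun i _ => ?_
        rw [convDual_apply _ _ _ (a₂ i), Finset.mul_sum]
    _ = convDual f (convDual g h) x := (convDual_apply _ _ _ r).symm

lemma convDual_one (f : H →ₗ[k] k) : convDual (Coalgebra.counit) f = f := by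
  apply LinearMap.ext; intro x
  have key := Coalgebra.sum_counit_tmul_map_eq (R := k) f x (repr := Coalgebra.Repr.arbitrary k x)
  have := congrArg (LinearMap.mul' k k) key
  simp only [map_sum, LinearMap.mul'_apply, one_mul] at this
  rw [convDual_apply _ _ _ (Coalgebra.Repr.arbitrary k x)]
  exact this

lemma one_convDual (f : H →ₗ[k] k) : convDual f (Coalgebra.counit) = f := by
  apply LinearMap.ext; intro x
  have key := Coalgebra.sum_map_tmul_counit_eq (R := k) f x (repr := Coalgebra.Repr.arbitrary k x)
  have := congrArg (LinearMap.mul' k k) key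
  simp only [map_sum, LinearMap.mul'_apply, mul_one] at this
  rw [convDual_apply _ _ _ (Coalgebra.Repr.arbitrary k x)]
  exact this

lemma convDual_add (f g h : H →ₗ[k] k) : convDual f (g + h) = convDual f g + convDual f h := by
  simp [convDual, TensorProduct.map_add_right, LinearMap.comp_add, LinearMap.add_comp]

lemma add_convDual (f g h : H →ₗ[k] k) : convDual (f + g) h = convDual f h + convDual g h := by
  simp [convDual, TensorProduct.map_add_left, LinearMap.comp_add, LinearMap.add_comp]

lemma convDual_zero (f : H →ₗ[k] k) : convDual f 0 = 0 := by
  simp [convDual]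

lemma zero_convDual (f : H →ₗ[k] k) : convDual 0 f = 0 := by
  simp [convDual]

end DualConv

/-- The convolution (semi)ring structure on the linear dual of a coalgebra, with product
`(f * g)(x) = ∑ f(x⁽¹⁾) g(x⁽²⁾)` and unit the counit `ε`. -/
noncomputable instance dualConvSemiring (k H : Type*) [CommSemiring k] [AddCommMonoid H]
    [Module k H] [Coalgebra k H] : Semiring (H →ₗ[k] k) :=
  { (inferInstance : AddCommMonoid (H →ₗ[k] k)) with
    mul := DualConv.convDual
    one := Coalgebra.counit
    mul_assoc := DualConv.convDual_assoc
    one_mul := DualConv.convDual_one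
    mul_one := DualConv.one_convDual
    left_distrib := DualConv.convDual_add
    right_distrib := fun f g h => DualConv.add_convDual f g h
    mul_zero := DualConv.convDual_zero
    zero_mul := DualConv.zero_convDual }

noncomputable instance dualConvRing (k H : Type*) [CommRing k] [AddCommGroup H]
    [Module k H] [Coalgebra k H] : Ring (H →ₗ[k] k) :=
  { dualConvSemiring k H, (inferInstance : AddCommGroup (H →ₗ[k] k)) with }

end

noncomputable section
open TensorProduct Coalgebra WithConv HopfAlgebra
set_option linter.all false
namespace HE

section basic
variable {K H B : Type*} [CommRing K] [Ring H] [HopfAlgebra K H] [Ring B] [Algebra K B]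

def iot (B : Type*) [Ring B] [Algebra K B] (φ : H →ₗ[K] K) : WithConv (H →ₗ[K] B) :=
  toConv (Algebra.linearMap K B ∘ₗ φ)

@[simp] lemma iot_apply (φ : H →ₗ[K] K) (x : H) : iot B φ x = algebraMap K B (φ x) := rfl

abbrev idc (K H : Type*) [CommRing K] [Ring H] [HopfAlgebra K H] : WithConv (H →ₗ[K] H) :=
  toConv LinearMap.id
abbrev Sc (K H : Type*) [CommRing K] [Ring H] [HopfAlgebra K H] : WithConv (H →ₗ[K] H) :=
  toConv (antipode K)

lemma Sc_idc : Sc K H * idc K H = 1 := LinearMap.antipode_mul_id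
lemma idc_Sc : idc K H * Sc K H = 1 := LinearMap.id_mul_antipode

/-- postcomposition with an algebra map is a ring hom of convolution rings -/
def post {A : Type*} [Ring A] [Algebra K A] (f : A →ₐ[K] B) :
    WithConv (H →ₗ[K] A) →+* WithConv (H →ₗ[K] B) where
  toFun g := toConv (f.toLinearMap ∘ₗ g.ofConv)
  map_one' := by ext x; simp
  map_zero' := by ext x; simp
  map_add' a b := by ext x; simp
  map_mul' a b := by
    ext x
    exact congrArg (fun t => t x) (LinearMap.algHom_comp_convMul_distrib f a b)

@[simp] lemma post_apply {A : Type*} [Ring A] [Algebra K A] (f : A →ₐ[K] B)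
    (g : WithConv (H →ₗ[K] A)) (x : H) : post f g x = f (g x) := rfl

/-- pointwise right multiplication by a constant -/
def rmc (g : WithConv (H →ₗ[K] B)) (b : B) : WithConv (H →ₗ[K] B) :=
  toConv (LinearMap.mulRight K b ∘ₗ g.ofConv)
/-- pointwise left multiplication by a constant -/
def lmc (b : B) (g : WithConv (H →ₗ[K] B)) : WithConv (H →ₗ[K] B) :=
  toConv (LinearMap.mulLeft K b ∘ₗ g.ofConv)
@[simp] lemma rmc_apply (g : WithConv (H →ₗ[K] B)) (b : B) (x : H) : rmc g b x = g x * b := rfl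
@[simp] lemma lmc_apply (g : WithConv (H →ₗ[K] B)) (b : B) (x : H) : lmc b g x = b * g x := rfl
lemma mul_rmc (f g : WithConv (H →ₗ[K] B)) (b : B) : f * rmc g b = rmc (f * g) b := by
  ext x
  rw [(ℛ K x).convMul_apply, rmc_apply, (ℛ K x).convMul_apply, Finset.sum_mul]
  simp [mul_assoc]
lemma lmc_mul (f g : WithConv (H →ₗ[K] B)) (b : B) : lmc b f * g = lmc b (f * g) := by
  ext x
  rw [(ℛ K x).convMul_apply, lmc_apply, (ℛ K x).convMul_apply, Finset.mul_sum]
  simp [mul_assoc]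
lemma mul_lmc (f g : WithConv (H →ₗ[K] B)) (b : B) : f * lmc b g = rmc f b * g := by
  ext x
  rw [(ℛ K x).convMul_apply, (ℛ K x).convMul_apply]
  simp [mul_assoc]

lemma comul_eq_i1_i2 : post (Bialgebra.comulAlgHom K H) (idc K H) =
    post (Algebra.TensorProduct.includeLeft : H →ₐ[K] H ⊗[K] H) (idc K H) *
    post (Algebra.TensorProduct.includeRight : H →ₐ[K] H ⊗[K] H) (idc K H) := by
  ext x
  rw [(ℛ K x).convMul_apply]
  simp [post_apply, (ℛ K x).eq]

/-- double representation of the comultiplication of a product -/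
lemma comul_mul_repr {x y : H} {ι κ : Type*} (rx : Coalgebra.Repr K x ι)
    (ry : Coalgebra.Repr K y κ) : comul (R := K) (x * y) =
      ∑ i ∈ rx.index, ∑ j ∈ ry.index, (rx.left i * ry.left j) ⊗ₜ[K] (rx.right i * ry.right j) := by
  rw [Bialgebra.comul_mul, ← rx.eq, ← ry.eq, Finset.sum_mul_sum]
  simp


lemma antipode_anti (h : H) : comul (R := K) (antipode K h) =
    TensorProduct.map (antipode K) (antipode K) (TensorProduct.comm K H H (comul h)) := by
  have h0 := congrArg (post (Bialgebra.comulAlgHom K H)) (Sc_idc (K := K) (H := H))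
  rw [map_mul, map_one] at h0
  set i1 := post (H := H) (Algebra.TensorProduct.includeLeft : H →ₐ[K] H ⊗[K] H)
  set i2 := post (H := H) (Algebra.TensorProduct.includeRight : H →ₐ[K] H ⊗[K] H)
  have h1 : post (Bialgebra.comulAlgHom K H) (idc K H) = i1 (idc K H) * i2 (idc K H) := by
    ext x
    rw [(ℛ K x).convMul_apply]
    simp [i1, i2, post_apply, (ℛ K x).eq]
  have h2 : post (Bialgebra.comulAlgHom K H) (idc K H) * (i2 (Sc K H) * i1 (Sc K H)) = 1 := by
    rw [h1, mul_assoc, ← mul_assoc (i2 _), ← map_mul i2, idc_Sc, map_one, one_mul, ← map_mul,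
      idc_Sc, map_one]
  have h4 := left_inv_eq_right_inv h0 h2
  have := congrArg (fun f => f.ofConv h) h4
  have h5 : (i2 (Sc K H) * i1 (Sc K H)).ofConv h = TensorProduct.map (antipode K) (antipode K)
      (TensorProduct.comm K H H (comul h)) := by
    rw [(ℛ K h).convMul_apply, ← (ℛ K h).eq]
    simp [i1, i2, post_apply]
  rw [← h5, ← this]; rfl


lemma rc_repr {x : H} {ι : Type*} (r : Coalgebra.Repr K x ι) (φ : H →ₗ[K] K) :
    (idc K H * iot H φ) x = ∑ i ∈ r.index, φ (r.right i) • r.left i := by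
  rw [r.convMul_apply]
  simp [Algebra.smul_def, Algebra.commutes]

lemma lc_repr {x : H} {ι : Type*} (r : Coalgebra.Repr K x ι) (φ : H →ₗ[K] K) :
    (iot H φ * idc K H) x = ∑ i ∈ r.index, φ (r.left i) • r.right i := by
  rw [r.convMul_apply]
  simp [Algebra.smul_def]

lemma idc_iot_comp_S (φ : H →ₗ[K] K) :
    (idc K H * iot H φ).ofConv ∘ₗ antipode K = (iot H (φ ∘ₗ antipode K) * Sc K H).ofConv := by
  ext x
  have : (idc K H * iot H φ) (antipode K x) = LinearMap.mul' K H
     (TensorProduct.map (idc K H).ofConv (iot H φ).ofConv (comul (antipode K x))) := rfl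
  rw [LinearMap.comp_apply, this, antipode_anti, (ℛ K x).convMul_apply, ← (ℛ K x).eq]
  simp [Algebra.commutes]

lemma iot_idc_comp_S (φ : H →ₗ[K] K) :
    (iot H φ * idc K H).ofConv ∘ₗ antipode K = (Sc K H * iot H (φ ∘ₗ antipode K)).ofConv := by
  ext x
  have : (iot H φ * idc K H) (antipode K x) = LinearMap.mul' K H
     (TensorProduct.map (iot H φ).ofConv (idc K H).ofConv (comul (antipode K x))) := rfl
  rw [LinearMap.comp_apply, this, antipode_anti, (ℛ K x).convMul_apply, ← (ℛ K x).eq]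
  simp [Algebra.commutes]

/-- Normalised two sided integrals in `H` and in the dual. -/
structure Ints (K : Type*) {H : Type*} [CommRing K] [Ring H] [HopfAlgebra K H] (L : H)
    (lam : H →ₗ[K] K) : Prop where
  l : ∀ h, h * L = counit (R := K) h • L
  r : ∀ h, L * h = counit (R := K) h • L
  e : counit (R := K) L = 1
  ll : iot H lam * idc K H = iot H lam
  lr : idc K H * iot H lam = iot H lam
  l1 : lam 1 = 1

variable {L : H} {lam : H →ₗ[K] K}

lemma mul_form {M : Type*} [AddCommMonoid M] [Module K M] (T : H ⊗[K] H →ₗ[K] M) {x y : H} {ι κ : Type*} (rx : Coalgebra.Repr K x ι)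
    (ry : Coalgebra.Repr K y κ) : ∑ i ∈ rx.index, ∑ j ∈ ry.index,
      T ((rx.left i * ry.left j) ⊗ₜ (rx.right i * ry.right j)) = T (comul (x * y)) := by
  rw [comul_mul_repr rx ry]; simp

/-- y_1 λ(x y_2) = S(x_1) λ(x_2 y) -/
lemma Ints.L1 (I : Ints K L lam) (x y : H) :
    (idc K H * iot H (lam ∘ₗ LinearMap.mulLeft K x)) y =
      (Sc K H * iot H (lam ∘ₗ LinearMap.mulRight K y)) x := by
  let ry := ℛ K y
  let F : WithConv (H →ₗ[K] H) := toConv (∑ j ∈ ry.index,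
    (lam ∘ₗ LinearMap.mulRight K (ry.right j)).smulRight (ry.left j))
  have h1 : idc K H * F = iot H (lam ∘ₗ LinearMap.mulRight K y) := by
    ext x
    have h2 := congrArg (fun f => f.ofConv (x * y)) I.lr
    have h3 : (idc K H * iot H lam) (x * y) = LinearMap.mul' K H
     (TensorProduct.map (idc K H).ofConv (iot H lam).ofConv (comul (x * y))) := rfl
    rw [h3, comul_mul_repr (ℛ K x) ry] at h2
    rw [(ℛ K x).convMul_apply]
    simp only [map_sum] at h2
    refine Eq.trans ?_ h2
    simp [F, Finset.mul_sum, Algebra.smul_def, Algebra.commutes, mul_assoc]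
  have h3 : F = Sc K H * iot H (lam ∘ₗ LinearMap.mulRight K y) := by
    rw [← h1, ← mul_assoc, Sc_idc, one_mul]
  rw [← h3, rc_repr ry]
  simp [F]

/-- λ(x_1 y) x_2 = λ(x y_1) S(y_2) -/
lemma Ints.L4 (I : Ints K L lam) (x y : H) :
    (iot H (lam ∘ₗ LinearMap.mulRight K y) * idc K H) x =
      (iot H (lam ∘ₗ LinearMap.mulLeft K x) * Sc K H) y := by
  let rx := ℛ K x
  let F : WithConv (H →ₗ[K] H) := toConv (∑ j ∈ rx.index,
    (lam ∘ₗ LinearMap.mulLeft K (rx.left j)).smulRight (rx.right j))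
  have h1 : F * idc K H = iot H (lam ∘ₗ LinearMap.mulLeft K x) := by
    ext y
    have h2 := congrArg (fun f => f.ofConv (x * y)) I.ll
    have h3 : (iot H lam * idc K H) (x * y) = LinearMap.mul' K H
     (TensorProduct.map (iot H lam).ofConv (idc K H).ofConv (comul (x * y))) := rfl
    rw [h3, comul_mul_repr rx (ℛ K y)] at h2
    rw [(ℛ K y).convMul_apply]
    simp only [map_sum] at h2
    refine Eq.trans ?_ h2
    rw [Finset.sum_comm]
    simp [F, Finset.sum_mul, Algebra.smul_def, Algebra.commutes, mul_assoc]
  have h3 : F = iot H (lam ∘ₗ LinearMap.mulLeft K x) * Sc K H := by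
    rw [← h1, mul_assoc, idc_Sc, mul_one]
  rw [← h3, lc_repr rx]
  simp [F]

/-- Λ_1 λ(x Λ_2) = λ(Λ) S(x) -/
lemma Ints.L2 (I : Ints K L lam) (x : H) :
    (idc K H * iot H (lam ∘ₗ LinearMap.mulLeft K x)) L = lam L • antipode K x := by
  rw [I.L1]
  have : iot H (lam ∘ₗ LinearMap.mulRight K L) = lam L • (1 : WithConv (H →ₗ[K] H)) := by
    ext h
    change algebraMap K H (lam (h * L)) = lam L • algebraMap K H (counit h)
    rw [I.l, map_smul, smul_eq_mul, map_mul, Algebra.smul_def, Algebra.commutes]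
  rw [this, mul_smul_comm, mul_one]; rfl

lemma Ints.L3 (I : Ints K L lam) (x : H) :
    (iot H (lam ∘ₗ LinearMap.mulRight K x) * idc K H) L = lam L • antipode K x := by
  rw [I.L4]
  have : iot H (lam ∘ₗ LinearMap.mulLeft K L) = lam L • (1 : WithConv (H →ₗ[K] H)) := by
    ext h
    change algebraMap K H (lam (L * h)) = lam L • algebraMap K H (counit h)
    rw [I.r, map_smul, smul_eq_mul, map_mul, Algebra.smul_def, Algebra.commutes]
  rw [this, smul_mul_assoc, one_mul]; rfl

/-- trace of x ↦ T(Λ_1) λ(Q(x) Λ_2) -/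
lemma Ints.trace_aux [Module.Free K H] [Module.Finite K H] (I : Ints K L lam) (Q : H →ₗ[K] H)
    (f : H →ₗ[K] H) :
    lam L * LinearMap.trace K H (f ∘ₗ antipode K ∘ₗ Q) =
      lam ((toConv (Q ∘ₗ f) * idc K H) L) := by
  have : lam L • (f ∘ₗ antipode K ∘ₗ Q) = ∑ i ∈ (ℛ K L).index,
      ((lam ∘ₗ LinearMap.mulRight K ((ℛ K L).right i)) ∘ₗ Q).smulRight (f ((ℛ K L).left i)) := by
    ext x
    have := congrArg f (I.L2 (Q x))
    rw [rc_repr (ℛ K L)] at this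
    simp at this
    simp [this]
  rw [← smul_eq_mul, ← map_smul, this, map_sum, (ℛ K L).convMul_apply, map_sum]
  simp [LinearMap.trace_smulRight]

lemma Ints.trace_S2 [Module.Free K H] [Module.Finite K H] (I : Ints K L lam) :
    lam L * LinearMap.trace K H (antipode K ∘ₗ antipode K) = 1 := by
  have := I.trace_aux LinearMap.id (antipode K)
  simp only [LinearMap.comp_id, LinearMap.id_comp] at this
  rw [this, Sc_idc]; simp [I.e, I.l1]

end basic
end HE
end
noncomputable section
open TensorProduct Coalgebra WithConv HopfAlgebra
set_option linter.all false
namespace HE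

section fld
variable {K H : Type*} [Field K] [Ring H] [HopfAlgebra K H] [FiniteDimensional K H]
variable {L : H} {lam : H →ₗ[K] K}

lemma cas_left {K H : Type*} [CommRing K] [Ring H] [HopfAlgebra K H] {L : H}
    (hl : ∀ h, h * L = counit (R := K) h • L) (x : H) :
    (1 ⊗ₜ[K] x) * comul (R := K) L = (antipode K x ⊗ₜ[K] 1) * comul (R := K) L := by
  set i1 := post (H := H) (Algebra.TensorProduct.includeLeft : H →ₐ[K] H ⊗[K] H) with hi1
  set i2 := post (H := H) (Algebra.TensorProduct.includeRight : H →ₐ[K] H ⊗[K] H) with hi2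
  have h2 : i1 (Sc K H) * post (Bialgebra.comulAlgHom K H) (idc K H) = i2 (idc K H) := by
    rw [comul_eq_i1_i2, ← mul_assoc, ← map_mul, Sc_idc, map_one, one_mul]
  have h3 : rmc (post (Bialgebra.comulAlgHom K H) (idc K H)) (comul (R := K) L) =
    rmc 1 (comul (R := K) L) := by
    ext x
    rw [rmc_apply, rmc_apply]
    change comul x * comul L = algebraMap K _ (counit x) * comul L
    rw [← Bialgebra.comul_mul, hl, map_smul, Algebra.smul_def]
  have h4 := congrArg (fun f => (rmc f (comul (R := K) L)).ofConv x) h2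
  simp only [← mul_rmc] at h4
  rw [h3, mul_rmc, mul_one] at h4
  exact h4.symm

lemma Ints.lamL_ne (I : Ints K L lam) : lam L ≠ 0 := left_ne_zero_of_mul_eq_one I.trace_S2

lemma Ints.S_inj (I : Ints K L lam) : Function.Injective (antipode K (A := H)) := by
  rw [injective_iff_map_eq_zero]
  intro x hx
  have h := cas_left I.l x
  rw [hx, TensorProduct.zero_tmul, zero_mul] at h
  have h1 := congrArg (fun t => TensorProduct.lid K H (lam.rTensor H t)) h
  have h2 := congrArg (fun f => f.ofConv L) I.ll
  simp only [lc_repr (ℛ K L)] at h2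
  rw [← (ℛ K L).eq] at h1
  simp only [Finset.mul_sum, Algebra.TensorProduct.tmul_mul_tmul, one_mul, map_sum,
    LinearMap.rTensor_tmul, TensorProduct.lid_tmul, ← mul_smul_comm, map_zero] at h1
  rw [← Finset.mul_sum, h2, iot_apply, ← Algebra.commutes, ← Algebra.smul_def] at h1
  exact (smul_eq_zero.mp h1).resolve_left I.lamL_ne

lemma Ints.S_surj (I : Ints K L lam) : Function.Surjective (antipode K (A := H)) :=
  LinearMap.injective_iff_surjective.mp I.S_inj

lemma Ints.nd1 (I : Ints K L lam) {x : H} (h : ∀ z, lam (x * z) = 0) : x = 0 := by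
  have h1 := I.L2 x
  rw [show lam ∘ₗ LinearMap.mulLeft K x = 0 from by ext z; simp [h]] at h1
  rw [show iot H (0 : H →ₗ[K] K) = 0 from by ext; simp, mul_zero] at h1
  have := (smul_eq_zero.mp h1.symm).resolve_left I.lamL_ne
  exact I.S_inj (by rw [this, map_zero])

lemma Ints.nd2 (I : Ints K L lam) {x : H} (h : ∀ z, lam (z * x) = 0) : x = 0 := by
  have h1 := I.L3 x
  rw [show lam ∘ₗ LinearMap.mulRight K x = 0 from by ext z; simp [h]] at h1
  rw [show iot H (0 : H →ₗ[K] K) = 0 from by ext; simp, zero_mul] at h1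
  have := (smul_eq_zero.mp h1.symm).resolve_left I.lamL_ne
  exact I.S_inj (by rw [this, map_zero])

lemma Ints.lam_S_mul (I : Ints K L lam) (x y : H) :
    lam (x * antipode K y) = lam (antipode K x * y) := by
  have h1 := congrArg (fun t => lam (x * t)) (I.L3 y)
  have h2 := congrArg (fun t => lam (t * y)) (I.L2 x)
  simp only [rc_repr (ℛ K L), lc_repr (ℛ K L)] at h1 h2
  simp [Finset.sum_mul, Finset.mul_sum] at h1 h2
  have := h1.symm.trans ((Finset.sum_congr rfl fun i _ => mul_comm _ _).trans h2)
  exact mul_left_cancel₀ I.lamL_ne this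

lemma Ints.lam_S (I : Ints K L lam) (x : H) : lam (antipode K x) = lam x := by
  have h := I.lam_S_mul 1 x
  simpa using h

lemma Ints.lam_mul (I : Ints K L lam) (x y : H) :
    lam (x * y) = lam (antipode K (antipode K y) * x) := by
  obtain ⟨x, rfl⟩ := I.S_surj x
  rw [← I.lam_S_mul, ← I.lam_S, antipode_mul_antidistrib]

lemma Ints.S4 (I : Ints K L lam) (x : H) :
    antipode K (antipode K (antipode K (antipode K x))) = x := by
  rw [← sub_eq_zero]
  apply I.nd1
  intro z
  rw [sub_mul, map_sub, ← I.lam_mul, sub_eq_zero]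
  rw [I.lam_S_mul, ← antipode_mul_antidistrib, I.lam_S]

lemma Ints.S_L (I : Ints K L lam) : antipode K L = L := by
  obtain ⟨y, hy⟩ := I.S_surj L
  have h1 : antipode K L * L = antipode K L := by
    have h2 : ∀ h, antipode K L * antipode K h = counit (R := K) h • antipode K L := fun h => by
      rw [← antipode_mul_antidistrib, I.l, map_smul]
    have h3 := h2 y
    rw [hy, ← counit_antipode (R := K), hy, I.e, one_smul] at h3
    exact h3
  rw [← h1, I.l]; simp [I.e]

end fld

section char0
variable {K H : Type*} [Field K] [CharZero K] [Ring H] [HopfAlgebra K H] [FiniteDimensional K H]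
variable {L : H} {lam : H →ₗ[K] K}

/-- regular character -/
def chi (K H : Type*) [Field K] [Ring H] [Algebra K H] : H →ₗ[K] K :=
  LinearMap.trace K H ∘ₗ LinearMap.mul K H

lemma chi_apply (x : H) : chi K H x = LinearMap.trace K H (LinearMap.mulLeft K x) := rfl

lemma chi_L (I : Ints K L lam) : chi K H L = 1 := by
  rw [chi_apply, show LinearMap.mulLeft K L = (counit (R := K)).smulRight L from by
    ext x; simp [I.r]]
  rw [LinearMap.trace_smulRight, I.e]

/-- `y ⊗ z ↦ y_1 ⊗ y_2 z` as a linear map and its inverse -/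
def galMap (K H : Type*) [Field K] [Ring H] [HopfAlgebra K H] : H ⊗[K] H →ₗ[K] H ⊗[K] H :=
  TensorProduct.lift ((LinearMap.mul K (H ⊗[K] H)).compl₁₂ (comul (R := K) (A := H))
    (Algebra.TensorProduct.includeRight : H →ₐ[K] H ⊗[K] H).toLinearMap)

lemma galMap_tmul (y z : H) : galMap K H (y ⊗ₜ z) = comul (R := K) y * (1 ⊗ₜ z) := rfl

lemma galMap_surj : Function.Surjective (galMap K H) := by
  rw [← LinearMap.range_eq_top, eq_top_iff, ← TensorProduct.span_tmul_eq_top, Submodule.span_le]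
  rintro _ ⟨x, y, rfl⟩
  set i1 := post (H := H) (Algebra.TensorProduct.includeLeft : H →ₐ[K] H ⊗[K] H) with hi1
  set i2 := post (H := H) (Algebra.TensorProduct.includeRight : H →ₐ[K] H ⊗[K] H) with hi2
  have h2 : post (Bialgebra.comulAlgHom K H) (idc K H) * i2 (Sc K H) = i1 (idc K H) := by
    rw [comul_eq_i1_i2, mul_assoc, ← map_mul, idc_Sc, map_one, mul_one]
  have h3 := congrArg (fun f => f.ofConv x * (1 ⊗ₜ[K] y)) h2
  simp only [(ℛ K x).convMul_apply] at h3
  refine ⟨∑ i ∈ (ℛ K x).index, ((ℛ K x).left i ⊗ₜ[K] (antipode K ((ℛ K x).right i) * y)), ?_⟩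
  rw [map_sum]
  simp only [galMap_tmul]
  refine Eq.trans ?_ (h3.trans ?_)
  · rw [Finset.sum_mul]
    refine Finset.sum_congr rfl fun i _ => ?_
    rw [mul_assoc]
    congr 1
    simp [hi2]
  · simp [hi1]

lemma chi_chi : iot H (chi K H) * iot H (chi K H) = (Module.finrank K H : K) • iot H (chi K H) := by
  ext x
  have h1 : LinearMap.mulLeft K (comul (R := K) x) ∘ₗ galMap K H =
    galMap K H ∘ₗ (TensorProduct.map (LinearMap.mulLeft K x) LinearMap.id) := by
    ext y z
    simp [galMap_tmul, mul_assoc]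
  let e : H ⊗[K] H ≃ₗ[K] H ⊗[K] H := LinearEquiv.ofBijective (galMap K H)
    ⟨LinearMap.injective_iff_surjective.mpr galMap_surj, galMap_surj⟩
  have h2 : LinearMap.mulLeft K (comul (R := K) x) =
      e.conj (TensorProduct.map (LinearMap.mulLeft K x) LinearMap.id) := by
    refine LinearMap.ext fun t => ?_
    obtain ⟨t, rfl⟩ := e.surjective t
    rw [LinearEquiv.conj_apply_apply, LinearEquiv.symm_apply_apply]
    exact LinearMap.congr_fun h1 t
  have h3 := congrArg (LinearMap.trace K _) h2
  rw [LinearMap.trace_conj', LinearMap.trace_tensorProduct', LinearMap.trace_id, ← chi_apply (x := x)] at h3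
  have h4 : LinearMap.trace K _ (LinearMap.mulLeft K (comul (R := K) x)) =
    ∑ i ∈ (ℛ K x).index, chi K H ((ℛ K x).left i) * chi K H ((ℛ K x).right i) := by
    conv_lhs => rw [← (ℛ K x).eq]
    have : ∀ a b : H, LinearMap.mulLeft K (a ⊗ₜ[K] b) =
      TensorProduct.map (LinearMap.mulLeft K a) (LinearMap.mulLeft K b) := by
        intro a b; ext; simp
    have h5 : ∀ t : H ⊗[K] H, LinearMap.mulLeft K t = LinearMap.mul K _ t := fun t => rfl
    rw [h5, map_sum, map_sum]
    simp only [← h5, this, LinearMap.trace_tensorProduct', chi_apply]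
  rw [(ℛ K x).convMul_apply]
  simp only [iot_apply, ← map_mul, ← map_sum, ← h4, h3]
  change _ = (Module.finrank K H : K) • algebraMap K H (chi K H x)
  rw [Algebra.smul_def, ← map_mul, mul_comm]

lemma comp_rc {K H B : Type*} [CommRing K] [Ring H] [HopfAlgebra K H] [Ring B] [Algebra K B]
    (f : WithConv (H →ₗ[K] B)) (φ : H →ₗ[K] K) :
    f.ofConv ∘ₗ (idc K H * iot H φ).ofConv = (f * iot B φ).ofConv := by
  ext x
  rw [LinearMap.comp_apply, rc_repr (ℛ K x), (ℛ K x).convMul_apply]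
  simp [← Algebra.commutes, ← Algebra.smul_def]

lemma comp_lc {K H B : Type*} [CommRing K] [Ring H] [HopfAlgebra K H] [Ring B] [Algebra K B]
    (f : WithConv (H →ₗ[K] B)) (φ : H →ₗ[K] K) :
    f.ofConv ∘ₗ (iot H φ * idc K H).ofConv = (iot B φ * f).ofConv := by
  ext x
  rw [LinearMap.comp_apply, lc_repr (ℛ K x), (ℛ K x).convMul_apply]
  simp [← Algebra.smul_def]

lemma trace_idem {K V : Type*} [Field K] [AddCommGroup V] [Module K V] [FiniteDimensional K V]
    (P : V →ₗ[K] V) (h : P ∘ₗ P = P) :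
    LinearMap.trace K V P = (Module.finrank K (LinearMap.range P) : K) := by
  have : LinearMap.IsProj (LinearMap.range P) P :=
    ⟨fun x => ⟨x, rfl⟩, by rintro _ ⟨x, rfl⟩; exact LinearMap.congr_fun h x⟩
  exact this.trace

lemma chi_S2 (I : Ints K L lam) (x : H) :
    chi K H (antipode K (antipode K x)) = chi K H x := by
  set s : H →ₗ[K] H := antipode K ∘ₗ antipode K
  have h1 : LinearMap.mulLeft K (s x) = s ∘ₗ LinearMap.mulLeft K x ∘ₗ s := by
    ext y
    simp [s, antipode_mul_antidistrib, I.S4]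
  rw [chi_apply, chi_apply]
  change LinearMap.trace K H (LinearMap.mulLeft K (s x)) = _
  rw [h1, LinearMap.trace_comp_comm']
  congr 1
  ext y
  simp [s, I.S4]

theorem Ints.S2 (I : Ints K L lam) (x : H) : antipode K (antipode K x) = x := by
  have hnt : Nontrivial H := ⟨1, 0, fun h => by simpa [h] using I.l1⟩
  set d := Module.finrank K H with hd
  have hd0 : 0 < d := Module.finrank_pos
  have hdK : (d : K) ≠ 0 := by exact_mod_cast hd0.ne'
  set s : H →ₗ[K] H := antipode K ∘ₗ antipode K with hs
  have hss : s ∘ₗ s = LinearMap.id := by ext y; simp [s, I.S4]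
  set P : H →ₗ[K] H := (d : K)⁻¹ • (idc K H * iot H (chi K H)).ofConv with hP
  have hPP : P ∘ₗ P = P := by
    simp only [hP, LinearMap.smul_comp, LinearMap.comp_smul]
    rw [comp_rc, mul_assoc, chi_chi, mul_smul_comm]
    change _ • _ • (d : K) • _ = _
    rw [smul_smul (d : K)⁻¹ (d : K), inv_mul_cancel₀ hdK, one_smul]
    rfl
  have hPs : P ∘ₗ s = s ∘ₗ P := by
    have h1 := idc_iot_comp_S (chi K H)
    have h2 := iot_idc_comp_S (chi K H ∘ₗ antipode K)
    have h3 : (chi K H ∘ₗ antipode K) ∘ₗ antipode K = chi K H := by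
      ext x; exact chi_S2 I x
    simp only [hP, LinearMap.smul_comp, LinearMap.comp_smul]
    congr 1
    rw [hs, ← LinearMap.comp_assoc, h1, ← comp_lc, LinearMap.comp_assoc, h2, h3, ← comp_rc]
    rfl
  have hTP : lam L * LinearMap.trace K H (s ∘ₗ P) = (d : K)⁻¹ := by
    have h1 := I.trace_aux P (antipode K)
    rw [← LinearMap.comp_assoc] at h1
    rw [h1, hP, LinearMap.smul_comp, idc_iot_comp_S]
    change lam (((d : K)⁻¹ • (iot H (chi K H ∘ₗ antipode K) * Sc K H) * idc K H) L) = _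
    rw [smul_mul_assoc, mul_assoc, Sc_idc, mul_one]
    change lam ((d : K)⁻¹ • algebraMap K H (chi K H (antipode K L))) = _
    rw [I.S_L, chi_L I, map_one, map_smul, I.l1, smul_eq_mul, mul_one]
  have hT := I.trace_S2
  have key : LinearMap.trace K H s = d * LinearMap.trace K H (s ∘ₗ P) := by
    apply mul_left_cancel₀ I.lamL_ne
    rw [hT, mul_left_comm, hTP, mul_inv_cancel₀ hdK]
  -- integrality
  have h2 : (2 : K) ≠ 0 := two_ne_zero
  set A : H →ₗ[K] H := (2 : K)⁻¹ • (LinearMap.id + s)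
  set A' : H →ₗ[K] H := (2 : K)⁻¹ • (LinearMap.id - s)
  have q : ∀ x : H, (2 : K)⁻¹ • ((2 : K)⁻¹ • (x + x)) = (2 : K)⁻¹ • x := by
    intro x; rw [← two_smul K x, smul_smul (2 : K)⁻¹ 2, inv_mul_cancel₀ h2, one_smul]
  have hss' : ∀ y, s (s y) = y := fun y => LinearMap.congr_fun hss y
  have hA : A ∘ₗ A = A := by
    ext y; simp only [A, LinearMap.comp_apply, LinearMap.smul_apply, LinearMap.add_apply,
      LinearMap.id_apply, map_smul, map_add, hss']
    module
  have hA' : A' ∘ₗ A' = A' := by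
    ext y; simp only [A', LinearMap.comp_apply, LinearMap.smul_apply, LinearMap.sub_apply,
      LinearMap.id_apply, map_smul, map_sub, hss']
    module
  have hPs' : ∀ y, P (s y) = s (P y) := fun y => LinearMap.congr_fun hPs y
  have hPP' : ∀ y, P (P y) = P y := fun y => LinearMap.congr_fun hPP y
  have hB : (A ∘ₗ P) ∘ₗ (A ∘ₗ P) = A ∘ₗ P := by
    have : P ∘ₗ A = A ∘ₗ P := by ext y; simp [A, hPs']
    rw [LinearMap.comp_assoc, ← LinearMap.comp_assoc _ _ P, this, LinearMap.comp_assoc, hPP,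
      ← LinearMap.comp_assoc, hA]
  have hB' : (A' ∘ₗ P) ∘ₗ (A' ∘ₗ P) = A' ∘ₗ P := by
    have : P ∘ₗ A' = A' ∘ₗ P := by ext y; simp [A', hPs']
    rw [LinearMap.comp_assoc, ← LinearMap.comp_assoc _ _ P, this, LinearMap.comp_assoc, hPP,
      ← LinearMap.comp_assoc, hA']
  have e1 : s = A - A' := by
    ext y; simp only [A, A', LinearMap.sub_apply, LinearMap.smul_apply, LinearMap.add_apply, LinearMap.id_apply]
    rw [← smul_sub, show y + s y - (y - s y) = s y + s y by abel, ← two_smul K, smul_smul, inv_mul_cancel₀ h2, one_smul]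
  have e2 : LinearMap.id = A + A' := by
    ext y; simp only [A, A', LinearMap.sub_apply, LinearMap.smul_apply, LinearMap.add_apply, LinearMap.id_apply]
    rw [← smul_add, show y + s y + (y - s y) = y + y by abel, ← two_smul K, smul_smul, inv_mul_cancel₀ h2, one_smul]
  have t1 := trace_idem A hA
  have t2 := trace_idem A' hA'
  have t3 := trace_idem _ hB
  have t4 := trace_idem _ hB'
  set a := Module.finrank K (LinearMap.range A)
  set a' := Module.finrank K (LinearMap.range A')
  set b := Module.finrank K (LinearMap.range (A ∘ₗ P))
  set b' := Module.finrank K (LinearMap.range (A' ∘ₗ P))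
  have k1 : ((a : ℤ) - a') = d * (b - b') := by
    have : ((((a : ℤ) - a' : ℤ)) : K) = ((d * (b - b') : ℤ) : K) := by
      push_cast
      rw [← t1, ← t2, ← t3, ← t4, ← map_sub, ← map_sub, ← LinearMap.sub_comp, ← e1, key]
    exact_mod_cast this
  have k2 : a + a' = d := by
    have : ((a + a' : ℕ) : K) = d := by
      push_cast
      rw [← t1, ← t2, ← map_add, ← e2, LinearMap.trace_id]
    exact_mod_cast this
  have k3 : (a : ℤ) - a' ≠ 0 := by
    intro h
    have : LinearMap.trace K H s = 0 := by
      rw [e1, map_sub, t1, t2]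
      have : (((a : ℤ) - a' : ℤ) : K) = 0 := by rw [h]; simp
      push_cast at this; exact this
    rw [← hs, this] at hT; simp at hT
  have k4 : a = 0 ∨ a' = 0 := by
    have h5 : (b : ℤ) - b' ≠ 0 := by rintro h; rw [h] at k1; simp at k1; exact k3 k1
    rcases lt_or_gt_of_ne h5 with h | h
    · left; nlinarith
    · right; nlinarith
  have hs1 : s 1 = 1 := by simp [s]
  rcases k4 with h | h
  · exfalso
    have : A = 0 := by
      rw [← LinearMap.range_eq_bot]; exact Submodule.finrank_eq_zero.mp h
    have h6 := LinearMap.congr_fun this 1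
    simp [A, hs1] at h6
    have h7 : (1 : H) = (2 : K)⁻¹ • 1 + (2 : K)⁻¹ • 1 := by module
    rw [h6] at h7; exact one_ne_zero h7
  · have : A' = 0 := by
      rw [← LinearMap.range_eq_bot]; exact Submodule.finrank_eq_zero.mp h
    have h6 := LinearMap.congr_fun this x
    simp [A', sub_eq_zero] at h6
    exact h6.symm

end char0
end HE
end
noncomputable section
open TensorProduct Coalgebra WithConv HopfAlgebra
set_option linter.all false
namespace HE

section char0
variable {K H : Type*} [Field K] [CharZero K] [Ring H] [HopfAlgebra K H] [FiniteDimensional K H]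
variable {L : H} {lam : H →ₗ[K] K}

lemma Ints.lamL (I : Ints K L lam) : lam L * (Module.finrank K H : K) = 1 := by
  have := I.trace_S2
  rwa [show antipode K ∘ₗ antipode K = (LinearMap.id : H →ₗ[K] H) from by ext x; exact I.S2 x,
    LinearMap.trace_id] at this

lemma Ints.d_ne (I : Ints K L lam) : (Module.finrank K H : K) ≠ 0 := right_ne_zero_of_mul_eq_one I.lamL

lemma Ints.tracial (I : Ints K L lam) (x y : H) : lam (x * y) = lam (y * x) := by
  rw [I.lam_mul, I.S2]

lemma Ints.trace_eq (I : Ints K L lam) (f : H →ₗ[K] H) :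
    LinearMap.trace K H f = (Module.finrank K H : K) *
      lam ((toConv (f ∘ₗ antipode K) * idc K H) L) := by
  have h := I.trace_aux f (antipode K)
  rw [show antipode K ∘ₗ antipode K ∘ₗ f = f from by ext x; exact I.S2 _] at h
  rw [← h, ← mul_assoc, mul_comm _ (lam L), I.lamL, one_mul]

lemma Ints.trace_rc (I : Ints K L lam) (φ : H →ₗ[K] K) :
    LinearMap.trace K H (idc K H * iot H φ).ofConv = (Module.finrank K H : K) * φ L := by
  rw [I.trace_eq, idc_iot_comp_S]
  change _ * lam (((iot H (φ ∘ₗ antipode K) * Sc K H) * idc K H) L) = _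
  rw [mul_assoc, Sc_idc, mul_one]
  simp [I.S_L, Algebra.algebraMap_eq_smul_one, I.l1]

lemma Ints.trace_mulLeft (I : Ints K L lam) (a : H) :
    LinearMap.trace K H (LinearMap.mulLeft K a) = (Module.finrank K H : K) * lam a := by
  rw [I.trace_eq]
  have : toConv (LinearMap.mulLeft K a ∘ₗ antipode K) = lmc a (Sc K H) := rfl
  rw [this, lmc_mul, Sc_idc]
  simp [I.e]

/-- d · S(Λ_1) λ(xΛ_2) = x -/
lemma Ints.L5 (I : Ints K L lam) (x : H) {ι : Type*} (r : Coalgebra.Repr K L ι) :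
    ∑ i ∈ r.index, lam (x * r.right i) • r.left i = lam L • antipode K x := by
  rw [← I.L2, rc_repr r]; simp

lemma Ints.L6 (I : Ints K L lam) (x : H) {ι : Type*} (r : Coalgebra.Repr K L ι) :
    ∑ i ∈ r.index, lam (r.left i * x) • r.right i = lam L • antipode K x := by
  rw [← I.L3, lc_repr r]; simp
end char0


section skew
variable {K H : Type*} [CommRing K] [Ring H] [HopfAlgebra K H]

lemma skew1 (S2 : ∀ x : H, antipode K (antipode K x) = x) {x : H} {ι : Type*} (r : Coalgebra.Repr K x ι) :
    ∑ i ∈ r.index, antipode K (r.right i) * r.left i = algebraMap K H (counit (R := K) x) := by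
  have h := congrArg (antipode K) (sum_antipode_mul_eq_algebraMap_counit (R := K) r)
  rw [map_sum, Algebra.algebraMap_eq_smul_one, map_smul, antipode_one] at h
  rw [Algebra.algebraMap_eq_smul_one, ← h]
  simp [antipode_mul_antidistrib, S2]

lemma skew2 (S2 : ∀ x : H, antipode K (antipode K x) = x) {x : H} {ι : Type*} (r : Coalgebra.Repr K x ι) :
    ∑ i ∈ r.index, r.right i * antipode K (r.left i) = algebraMap K H (counit (R := K) x) := by
  have h := congrArg (antipode K) (sum_mul_antipode_eq_algebraMap_counit (R := K) r)
  rw [map_sum, Algebra.algebraMap_eq_smul_one, map_smul, antipode_one] at h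
  rw [Algebra.algebraMap_eq_smul_one, ← h]
  simp [antipode_mul_antidistrib, S2]
end skew
end HE
end
noncomputable section
open TensorProduct Coalgebra WithConv HopfAlgebra
set_option linter.all false
namespace HE

section yd
variable {K H B C ι : Type*} [CommRing K] [Ring H] [HopfAlgebra K H] [Ring B] [Algebra K B]
  [Ring C] [Algebra K C] [Fintype ι] (b : Module.Basis ι K H)

def pr (y : ι → B) (f : WithConv (H →ₗ[K] B)) : B := ∑ k, f (b k) * y k

def yf (y : ι → B) (φ : H →ₗ[K] K) : B := ∑ k, φ (b k) • y k

/-- linear map as convolution element -/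
abbrev cv (f : H →ₐ[K] B) : WithConv (H →ₗ[K] B) := toConv f.toLinearMap
/-- composed with antipode -/
abbrev cvS (f : H →ₐ[K] B) : WithConv (H →ₗ[K] B) := toConv (f.toLinearMap ∘ₗ antipode K)

lemma cv_cvS (f : H →ₐ[K] B) : cv f * cvS f = 1 := by
  have := congrArg (post f) (idc_Sc (K := K) (H := H))
  rwa [map_mul, map_one] at this
lemma cvS_cv (f : H →ₐ[K] B) : cvS f * cv f = 1 := by
  have := congrArg (post f) (Sc_idc (K := K) (H := H))
  rwa [map_mul, map_one] at this

/-- left inclusion -/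
abbrev iL (K H B : Type*) [CommRing K] [Ring H] [HopfAlgebra K H] [Ring B] [Algebra K B] :
    WithConv (H →ₗ[K] H ⊗[K] B) := cv (B := H ⊗[K] B) Algebra.TensorProduct.includeLeft
/-- right inclusion -/
abbrev iR (ρ : H →ₐ[K] B) : WithConv (H →ₗ[K] H ⊗[K] B) :=
  cv (B := H ⊗[K] B) (Algebra.TensorProduct.includeRight.comp ρ)

structure YD (ρ : H →ₐ[K] B) (y : ι → B) : Prop where
  y1 : ∀ φ ψ : H →ₗ[K] K, yf b y φ * yf b y ψ = yf b y (toConv φ * toConv ψ).ofConv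
  y2 : yf b y (counit (R := K)) = 1
  y3 : ∀ h : H,
    pr b (fun k => (1 : H) ⊗ₜ[K] y k) (iL K H B) * (iL K H B * iR ρ) h =
    (iR ρ * iL K H B) h * pr b (fun k => (1 : H) ⊗ₜ[K] y k) (iL K H B)

variable {b}

lemma yf_coord (y : ι → B) (k : ι) : yf b y (b.coord k) = y k := by
  classical
  simp [yf, Finsupp.single_apply]

/-- the weak structure : only the algebra map part -/
structure YA (b : Module.Basis ι K H) (y : ι → B) : Prop where
  y1 : ∀ φ ψ : H →ₗ[K] K, yf b y φ * yf b y ψ = yf b y (toConv φ * toConv ψ).ofConv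
  y2 : yf b y (counit (R := K)) = 1

lemma YD.ya {ρ : H →ₐ[K] B} {y : ι → B} (h : YD b ρ y) : YA b y := ⟨h.y1, h.y2⟩

lemma map_yf (β : B →ₐ[K] C) (y : ι → B) (φ : H →ₗ[K] K) :
    β (yf b y φ) = yf b (fun k => β (y k)) φ := by simp [yf]

lemma YA.map {y : ι → B} (h : YA b y) (β : B →ₐ[K] C) : YA b (fun k => β (y k)) :=
  ⟨fun φ ψ => by rw [← map_yf, ← map_yf, ← map_yf, ← map_mul, h.y1],
   by rw [← map_yf, h.y2, map_one]⟩

lemma YA.split {y : ι → B} (h : YA b y) {M : Type*} [AddCommGroup M] [Module K M]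
    (T : H ⊗[K] H →ₗ[K] B →ₗ[K] M) :
    ∑ k, T (comul (b k)) (y k) = ∑ p, ∑ q, T (b p ⊗ₜ b q) (y p * y q) := by
  have h1 : ∀ p q, y p * y q =
      ∑ k, (b.tensorProduct b).repr (comul (b k)) (p, q) • y k := by
    intro p q
    have := h.y1 (b.coord p) (b.coord q)
    rw [yf_coord, yf_coord] at this
    rw [this, yf]
    refine Finset.sum_congr rfl fun k _ => ?_
    congr 1
    change (toConv (b.coord p) * toConv (b.coord q)) (b k) = _
    rw [(ℛ K (b k)).convMul_apply, ← (ℛ K (b k)).eq]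
    simp [Module.Basis.tensorProduct_repr_tmul_apply, mul_comm, Finsupp.finset_sum_apply]
  simp_rw [h1, map_sum, map_smul]
  have h2 : ∀ k, T (comul (b k)) (y k) = ∑ p, ∑ q,
      ((b.tensorProduct b).repr (comul (b k)) (p, q)) • T (b p ⊗ₜ b q) (y k) := by
    intro k
    conv_lhs => rw [← (b.tensorProduct b).sum_repr (comul (b k))]
    rw [Fintype.sum_prod_type]
    simp
  simp_rw [h2]
  rw [Finset.sum_comm]
  refine Finset.sum_congr rfl fun p _ => ?_
  rw [Finset.sum_comm]

lemma YA.pr_one {y : ι → B} (h : YA b y) : pr b y 1 = 1 := by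
  rw [← h.y2]; simp [pr, yf, Algebra.smul_def]

/-- `∑ (f*g)(b_k) z y_k = ∑ f(b_p) g(b_q) z y_p y_q` -/
lemma YA.pr_conv {y : ι → B} (h : YA b y) (f g : WithConv (H →ₗ[K] B)) (z : B) :
    ∑ k, (f * g) (b k) * z * y k = ∑ p, ∑ q, f (b p) * g (b q) * z * (y p * y q) := by
  have := h.split (M := B) (LinearMap.mul K B ∘ₗ LinearMap.mulRight K z ∘ₗ
    LinearMap.mul' K B ∘ₗ TensorProduct.map f.ofConv g.ofConv)
  simpa using this

lemma YA.pr_mul {y : ι → B} (h : YA b y) (f g : WithConv (H →ₗ[K] B))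
    (hg : ∀ k x, y k * g x = g x * y k) : pr b y f * pr b y g = pr b y (f * g) := by
  have := h.pr_conv f g 1
  simp only [mul_one] at this
  rw [pr, pr, pr, this, Finset.sum_mul_sum]
  refine Finset.sum_congr rfl fun p _ => Finset.sum_congr rfl fun q _ => ?_
  rw [mul_assoc, ← mul_assoc (y p), hg, mul_assoc, mul_assoc]

/-- `∑ S(b_p) b_i ⊗ y_i y_p = 1` in a commuting ambient algebra -/
lemma YA.skew1 (S2 : ∀ x : H, antipode K (antipode K x) = x) {y : ι → B} (h : YA b y)
    (i : H →ₐ[K] B) : ∑ p, ∑ q, i (antipode K (b q) * b p) * (y p * y q) = 1 := by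
  have := h.split (M := B) (LinearMap.mul K B ∘ₗ i.toLinearMap ∘ₗ LinearMap.mul' K H ∘ₗ
    TensorProduct.map (antipode K) LinearMap.id ∘ₗ (TensorProduct.comm K H H).toLinearMap)
  simp only [LinearMap.comp_apply, LinearEquiv.coe_coe, TensorProduct.comm_tmul,
    TensorProduct.map_tmul, LinearMap.mul'_apply, LinearMap.id_apply] at this
  refine Eq.trans this.symm (Eq.trans ?_ h.pr_one)
  refine Finset.sum_congr rfl fun k _ => ?_
  have h2 := HE.skew1 S2 (ℛ K (b k))
  conv_lhs => rw [← (ℛ K (b k)).eq]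
  simp only [map_sum, TensorProduct.comm_tmul, TensorProduct.map_tmul, LinearMap.mul'_apply,
    LinearMap.id_apply]
  simp only [← map_sum, h2]
  simp

lemma YA.skew2 (S2 : ∀ x : H, antipode K (antipode K x) = x) {y : ι → B} (h : YA b y)
    (i : H →ₐ[K] B) : ∑ p, ∑ q, i (b q * antipode K (b p)) * (y p * y q) = 1 := by
  have := h.split (M := B) (LinearMap.mul K B ∘ₗ i.toLinearMap ∘ₗ LinearMap.mul' K H ∘ₗ
    TensorProduct.map LinearMap.id (antipode K) ∘ₗ (TensorProduct.comm K H H).toLinearMap)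
  simp only [LinearMap.comp_apply, LinearEquiv.coe_coe, TensorProduct.comm_tmul,
    TensorProduct.map_tmul, LinearMap.mul'_apply, LinearMap.id_apply] at this
  refine Eq.trans this.symm (Eq.trans ?_ h.pr_one)
  refine Finset.sum_congr rfl fun k _ => ?_
  have h2 := HE.skew2 S2 (ℛ K (b k))
  conv_lhs => rw [← (ℛ K (b k)).eq]
  simp only [map_sum, TensorProduct.comm_tmul, TensorProduct.map_tmul, LinearMap.mul'_apply,
    LinearMap.id_apply]
  simp only [← map_sum, h2]
  simp

lemma post_cv (β : B →ₐ[K] C) (f : H →ₐ[K] B) : post β (cv f) = cv (β.comp f) := rfl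

lemma map_pr (β : B →ₐ[K] C) (y : ι → B) (f : WithConv (H →ₗ[K] B)) :
    β (pr b y f) = pr b (fun k => β (y k)) (post β f) := by simp [pr]

/-- ambient version of the third axiom -/
lemma YD.amb {ρ : H →ₐ[K] B} {y : ι → B} (h : YD b ρ y) (i : H →ₐ[K] C) (β : B →ₐ[K] C)
    (hc : ∀ x z, Commute (i x) (β z)) :
    lmc (pr b (fun k => β (y k)) (cv i)) (cv i * cv (β.comp ρ)) =
      rmc (cv (β.comp ρ) * cv i) (pr b (fun k => β (y k)) (cv i)) := by
  ext x
  have h1 := congrArg (Algebra.TensorProduct.lift i β hc) (h.y3 x)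
  rw [map_mul, map_mul, ← post_apply, ← post_apply, map_mul, map_mul, map_pr] at h1
  simp only [post_cv] at h1
  have e1 : (Algebra.TensorProduct.lift i β hc).comp Algebra.TensorProduct.includeLeft = i := by
    ext; simp
  have e2 : (Algebra.TensorProduct.lift i β hc).comp
     (Algebra.TensorProduct.includeRight.comp ρ) = β.comp ρ := by
    ext; simp
  rw [e1, e2] at h1
  simpa using h1

lemma YD.map {ρ : H →ₐ[K] B} {y : ι → B} (h : YD b ρ y) (β : B →ₐ[K] C) :
    YD b (β.comp ρ) (fun k => β (y k)) := by
  refine ⟨(h.ya.map β).y1, (h.ya.map β).y2, fun x => ?_⟩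
  have := h.amb (Algebra.TensorProduct.includeLeft : H →ₐ[K] H ⊗[K] C)
    (Algebra.TensorProduct.includeRight.comp β) (fun x z => by simp [Commute, SemiconjBy])
  have := congrArg (fun f => f.ofConv x) this
  exact this

end yd
end HE
end
noncomputable section
open TensorProduct Coalgebra WithConv HopfAlgebra
set_option linter.all false
namespace HE

section amb
variable {K H B C ι : Type*} [CommRing K] [Ring H] [HopfAlgebra K H] [Ring B] [Algebra K B]
  [Ring C] [Algebra K C] [Fintype ι] {b : Module.Basis ι K H}

lemma lmc_one_mul (z : C) (g : WithConv (H →ₗ[K] C)) : rmc 1 z * g = lmc z g := by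
  rw [← mul_lmc, one_mul]

lemma mul_lmc_one (z : C) (g : WithConv (H →ₗ[K] C)) : g * lmc z 1 = rmc g z := by
  rw [mul_lmc, mul_one]

lemma conj_inv {F F' G G' : WithConv (H →ₗ[K] C)} {Y : C} (h1 : F * F' = 1) (h2 : G' * G = 1)
    (h : lmc Y F = rmc G Y) : lmc Y F' = rmc G' Y := by
  have e1 : G' * lmc Y F * F' = rmc G' Y := by rw [mul_lmc, mul_assoc, h1, mul_one]
  rw [h, mul_rmc, h2, lmc_one_mul] at e1
  exact e1

/-- ambient YD data -/
structure Amb (b : Module.Basis ι K H) (i r : H →ₐ[K] C) (y : ι → C) : Prop where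
  ya : YA b y
  ir : ∀ x z, Commute (i x) (r z)
  iy : ∀ x k, Commute (i x) (y k)
  y3 : lmc (pr b y (cv i)) (cv i * cv r) = rmc (cv r * cv i) (pr b y (cv i))

lemma YD.toAmb {ρ : H →ₐ[K] B} {y : ι → B} (h : YD b ρ y) (i : H →ₐ[K] C) (β : B →ₐ[K] C)
    (hc : ∀ x z, Commute (i x) (β z)) : Amb b i (β.comp ρ) (fun k => β (y k)) :=
  ⟨h.ya.map β, fun x z => hc _ _, fun x k => hc _ _, h.amb i β hc⟩

variable {i r : H →ₐ[K] C} {y : ι → C}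

lemma Amb.Y_Yinv (A : Amb b i r y) : pr b y (cv i) * pr b y (cvS i) = 1 := by
  rw [A.ya.pr_mul, cv_cvS, A.ya.pr_one]
  exact fun k x => (A.iy _ k).symm.eq
lemma Amb.Yinv_Y (A : Amb b i r y) : pr b y (cvS i) * pr b y (cv i) = 1 := by
  rw [A.ya.pr_mul, cvS_cv, A.ya.pr_one]
  exact fun k x => (A.iy _ k).symm.eq

lemma Amb.y3S (A : Amb b i r y) :
    lmc (pr b y (cv i)) (cvS r * cvS i) = rmc (cvS i * cvS r) (pr b y (cv i)) := by
  refine conj_inv ?_ ?_ A.y3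
  · rw [mul_assoc, ← mul_assoc (cv r), cv_cvS, one_mul, cv_cvS]
  · rw [mul_assoc, ← mul_assoc (cvS r), cvS_cv, one_mul, cvS_cv]

lemma Amb.Y_rS (A : Amb b i r y) :
    lmc (pr b y (cv i)) (cvS r) = (cvS i * cvS r) * lmc (pr b y (cv i)) (cv i) := by
  rw [mul_lmc, ← A.y3S, lmc_mul, mul_assoc, cvS_cv, mul_one]

lemma Amb.comm_u (S2 : ∀ x : H, antipode K (antipode K x) = x) (A : Amb b i r y) :
    pr b y (cv i) * pr b y (cvS r) = pr b y (cvS r) * pr b y (cv i) := by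
  set Y := pr b y (cv i) with hY
  have e1 : Y * pr b y (cvS r) = ∑ k, (cvS i * cvS r * lmc Y (cv i)) (b k) * 1 * y k := by
    rw [← A.Y_rS, pr, Finset.mul_sum]
    simp [mul_assoc, hY]
  have e2 : (∑ p, (cvS i * cvS r) (b p) * Y * y p) = pr b y (cvS r) := by
    rw [A.ya.pr_conv, Finset.sum_comm, pr]
    refine Finset.sum_congr rfl fun q _ => ?_
    have h1 := A.ya.skew1 S2 i
    rw [Finset.sum_comm] at h1
    conv_rhs => rw [← mul_one ((cvS r) (b q)), ← h1]
    simp only [Finset.mul_sum, Finset.sum_mul, hY, pr]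
    refine Finset.sum_congr rfl fun p _ => ?_
    refine Finset.sum_congr rfl fun k _ => ?_
    have c1 : (cvS i) (b p) * (cvS r) (b q) = (cvS r) (b q) * (cvS i) (b p) := (A.ir _ _).eq
    have c2 : (cvS i) (b p) * (cv i) (b k) = i (antipode K (b p) * b k) := by
      rw [map_mul]; rfl
    rw [c1, ← c2]
    simp only [mul_assoc]
  rw [e1, A.ya.pr_conv, ← e2, Finset.sum_mul]
  refine Finset.sum_congr rfl fun p _ => ?_
  have hYe : ∀ X : C, X * Y = ∑ q, X * ((cv i) (b q) * y q) := fun X => by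
    rw [← Finset.mul_sum]; rfl
  rw [hYe]
  refine Finset.sum_congr rfl fun q _ => ?_
  have c1 : (cv i) (b q) * y p = y p * (cv i) (b q) := (A.iy _ _).eq
  simp only [mul_assoc, one_mul, lmc_apply]
  rw [← mul_assoc (y p), ← c1]
  simp only [mul_assoc]

end amb

section G
variable {K H B C ι : Type*} [CommRing K] [Ring H] [HopfAlgebra K H] [Ring B] [Algebra K B]
  [Ring C] [Algebra K C] [Fintype ι] {b : Module.Basis ι K H}

def GG (b : Module.Basis ι K H) (ρ : H →ₐ[K] B) (y : ι → B) (f : WithConv (H →ₗ[K] H)) : B :=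
  ∑ k, ρ (antipode K (f (b k))) * y k

lemma GG_id (ρ : H →ₐ[K] B) (y : ι → B) : GG b ρ y (idc K H) = pr b y (cvS ρ) := rfl

lemma contract (φ : ι) (y : ι → B) (z w : B) :
    TensorProduct.lift (LinearMap.lsmul K B ∘ₗ b.coord φ) ((1 : H) ⊗ₜ[K] z *
      (pr b (fun k => (1 : H) ⊗ₜ[K] y k) (iL K H B) * (1 : H) ⊗ₜ[K] w)) = z * y φ * w := by
  classical
  simp only [pr, Finset.sum_mul, Finset.mul_sum, map_sum]
  simp [Finsupp.single_apply, mul_assoc]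

variable {ρ : H →ₐ[K] B} {y : ι → B}

lemma YD.amb0 (h : YD b ρ y) :
    Amb b (Algebra.TensorProduct.includeLeft : H →ₐ[K] H ⊗[K] B)
      (Algebra.TensorProduct.includeRight.comp ρ) (fun k => (1:H) ⊗ₜ[K] y k) :=
  h.toAmb (Algebra.TensorProduct.includeLeft : H →ₐ[K] H ⊗[K] B)
    (Algebra.TensorProduct.includeRight : B →ₐ[K] H ⊗[K] B)
    (fun x z => by simp [Commute, SemiconjBy])

lemma YD.u_y (S2 : ∀ x : H, antipode K (antipode K x) = x) (h : YD b ρ y) (k : ι) :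
    Commute (pr b y (cvS ρ)) (y k) := by
  have h1 := h.amb0.comm_u S2
  have h2 : pr b (fun k => (1:H) ⊗ₜ[K] y k)
      (cvS (B := H ⊗[K] B) (Algebra.TensorProduct.includeRight.comp ρ)) =
      (1:H) ⊗ₜ[K] pr b y (cvS ρ) := by
    simp [pr, tmul_sum]
  rw [h2] at h1
  have e1 := contract (b := b) k y 1 (pr b y (cvS ρ))
  have e2 := contract (b := b) k y (pr b y (cvS ρ)) 1
  rw [← Algebra.TensorProduct.one_def, one_mul] at e1
  rw [← Algebra.TensorProduct.one_def, mul_one] at e2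
  rw [Commute, SemiconjBy]
  erw [h1, e2] at e1
  simpa using e1

lemma YD.u_ρ (S2 : ∀ x : H, antipode K (antipode K x) = x) (h : YD b ρ y) :
    lmc (pr b y (cvS ρ)) (cv ρ) = rmc (cv ρ) (pr b y (cvS ρ)) := by
  set u := pr b y (cvS ρ) with hu
  have key : cvS ρ * lmc u (cv ρ) = rmc 1 u := by
    ext x
    set κ : H ⊗[K] B →ₗ[K] B := TensorProduct.lift (LinearMap.mul K B ∘ₗ ρ.toLinearMap ∘ₗ antipode K)
    have h3 := congrArg κ (h.y3 x)
    have l : κ (pr b (fun k => (1 : H) ⊗ₜ[K] y k) (iL K H B) * (iL K H B * iR ρ) x) =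
        (cvS ρ * lmc u (cv ρ)) x := by
      rw [(ℛ K x).convMul_apply, (ℛ K x).convMul_apply]
      simp [pr, κ, hu, Finset.sum_mul, Finset.mul_sum, antipode_mul_antidistrib, mul_assoc]
    have r : κ ((iR ρ * iL K H B) x * pr b (fun k => (1 : H) ⊗ₜ[K] y k) (iL K H B)) =
        rmc (1 : WithConv (H →ₗ[K] B)) u x := by
      rw [(ℛ K x).convMul_apply]
      have h2 := congrArg ρ (HE.skew1 S2 (ℛ K x))
      rw [map_sum, AlgHom.commutes] at h2
      simp only [map_mul] at h2
      have e : rmc (1 : WithConv (H →ₗ[K] B)) u x =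
          ∑ q, ρ (antipode K (b q)) * algebraMap K B (counit (R := K) x) * y q := by
        have e0 : rmc (1 : WithConv (H →ₗ[K] B)) u x = algebraMap K B (counit (R := K) x) * u := rfl
        rw [e0, hu, pr, Finset.mul_sum]
        refine Finset.sum_congr rfl fun q _ => ?_
        rw [← mul_assoc, Algebra.commutes]; rfl
      rw [e, ← h2]
      simp only [pr, κ, Finset.sum_mul, Finset.mul_sum, map_sum]
      refine Finset.sum_congr rfl fun p _ => ?_
      refine Finset.sum_congr rfl fun q _ => ?_
      simp [antipode_mul_antidistrib, mul_assoc]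
    change _ = (rmc (1 : WithConv (H →ₗ[K] B)) u) x
    change (cvS ρ * lmc u (cv ρ)) x = _
    rw [← l, h3, r]
  have := congrArg (fun f => cv ρ * f) key
  rw [← mul_assoc, cv_cvS, one_mul, mul_rmc, mul_one] at this
  exact this

lemma YD.u_ρ' (S2 : ∀ x : H, antipode K (antipode K x) = x) (h : YD b ρ y) (x : H) :
    Commute (pr b y (cvS ρ)) (ρ x) :=
  congrArg (fun f : WithConv (H →ₗ[K] B) => f.ofConv x) (h.u_ρ S2)

lemma YA.GG_one (h : YA b y) : GG b ρ y 1 = 1 := by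
  rw [← h.pr_one, GG, pr]
  refine Finset.sum_congr rfl fun k _ => ?_
  simp [Algebra.algebraMap_eq_smul_one]

lemma YA.GG_mul (h : YA b y) (f g : WithConv (H →ₗ[K] H)) (hf : ∀ x, Commute (GG b ρ y f) (ρ x)) :
    GG b ρ y (f * g) = GG b ρ y f * GG b ρ y g := by
  have := h.split (M := B) (LinearMap.mul K B ∘ₗ ρ.toLinearMap ∘ₗ antipode K ∘ₗ
    LinearMap.mul' K H ∘ₗ TensorProduct.map f.ofConv g.ofConv)
  refine Eq.trans this ?_
  rw [Finset.sum_comm]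
  conv_rhs => rw [GG, GG, Finset.mul_sum]
  refine Finset.sum_congr rfl fun q _ => ?_
  rw [← mul_assoc]
  have := (hf (antipode K (g (b q)))).eq
  rw [GG] at this
  rw [this, Finset.mul_sum, Finset.sum_mul]
  refine Finset.sum_congr rfl fun p _ => ?_
  simp [antipode_mul_antidistrib, mul_assoc]

lemma YD.u_pow (S2 : ∀ x : H, antipode K (antipode K x) = x) (h : YD b ρ y) (n : ℕ) :
    GG b ρ y (idc K H ^ n) = (pr b y (cvS ρ)) ^ n := by
  induction n with
  | zero => simp [h.ya.GG_one]
  | succ n ih =>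
    rw [pow_succ', pow_succ', h.ya.GG_mul, ih, GG_id]
    exact h.u_ρ' S2
end G
end HE
end
noncomputable section
open TensorProduct Coalgebra WithConv HopfAlgebra
set_option linter.all false
namespace HE

section closure
variable {K H B C ι : Type*} [CommRing K] [Ring H] [HopfAlgebra K H] [Ring B] [Algebra K B]
  [Ring C] [Algebra K C] [Fintype ι] {b : Module.Basis ι K H}

/-- contraction of the left leg -/
def ctr (b : Module.Basis ι K H) (B : Type*) [Ring B] [Algebra K B] (k : ι) : H ⊗[K] B →ₗ[K] B :=
  TensorProduct.lift (LinearMap.lsmul K B ∘ₗ b.coord k)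

@[simp] lemma ctr_tmul (k : ι) (a : H) (z : B) : ctr b B k (a ⊗ₜ z) = b.coord k a • z := rfl

lemma ctr_mul (k : ι) (X : H ⊗[K] B) (z : B) :
    ctr b B k (X * (1 : H) ⊗ₜ z) = ctr b B k X * z := by
  induction X with
  | zero => simp
  | tmul a w => simp
  | add x y hx hy => rw [add_mul, map_add, hx, hy, map_add, add_mul]

lemma ctr_map (k : ι) (ρ : B →ₐ[K] C) (X : H ⊗[K] B) :
    ctr b C k (Algebra.TensorProduct.map (AlgHom.id K H) ρ X) = ρ (ctr b B k X) := by
  induction X with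
  | zero => simp
  | tmul a w => simp
  | add x y hx hy => simp only [map_add, hx, hy]

def wc (ρ : H →ₐ[K] B) (a : H) : WithConv (H →ₗ[K] H ⊗[K] B) :=
  cvS (B := H ⊗[K] B) Algebra.TensorProduct.includeLeft *
    cvS (B := H ⊗[K] B) (Algebra.TensorProduct.includeRight.comp ρ) *
     lmc (a ⊗ₜ 1) (iL K H B)

def ww (b : Module.Basis ι K H) (k j : ι) (h : H) : H :=
  ctr b H k (wc (AlgHom.id K H) (b j) (antipode K h))

lemma YD.y_ρ (S2 : ∀ x : H, antipode K (antipode K x) = x) {ρ : H →ₐ[K] B} {y : ι → B}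
    (h : YD b ρ y) (k : ι) (x : H) : y k * ρ x = ∑ j, ρ (ww b k j x) * y j := by
  have h1 := congrArg (fun f : WithConv (H →ₗ[K] H ⊗[K] B) => f.ofConv (antipode K x)) h.amb0.Y_rS
  have h2 : cvS (B := H ⊗[K] B) Algebra.TensorProduct.includeLeft *
      cvS (B := H ⊗[K] B) (Algebra.TensorProduct.includeRight.comp ρ) *
      lmc (pr b (fun k => (1:H) ⊗ₜ[K] y k) (iL K H B)) (iL K H B) =
      ∑ j, rmc (wc ρ (b j)) ((1 : H) ⊗ₜ y j) := by
    have : lmc (pr b (fun k => (1:H) ⊗ₜ[K] y k) (iL K H B)) (iL K H B) =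
       ∑ j, rmc (lmc (b j ⊗ₜ 1) (iL K H B)) ((1 : H) ⊗ₜ y j) := by
      ext x
      simp [pr, Finset.sum_mul]
    rw [this, Finset.mul_sum]
    refine Finset.sum_congr rfl fun j _ => ?_
    rw [mul_rmc, wc]
  have h3 : ∀ j, wc ρ (b j) = post (Algebra.TensorProduct.map (AlgHom.id K H) ρ)
      (wc (AlgHom.id K H) (b j)) := by
    intro j
    rw [wc, wc, map_mul, map_mul]
    congr 1
    · congr 1
      ext x; simp
    · ext x; simp
  have h4 := congrArg (ctr b B k) (h1.trans (congrArg (fun f : WithConv (H →ₗ[K] H ⊗[K] B) =>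
     f.ofConv (antipode K x)) h2))
  have h5 : (∑ j, rmc (wc ρ (b j)) ((1 : H) ⊗ₜ y j)).ofConv (antipode K x) =
    ∑ j, (wc ρ (b j)) (antipode K x) * (1 : H) ⊗ₜ y j := by simp
  simp only [h5, map_sum, ctr_mul] at h4
  have h6 : ∀ j, ctr b B k ((wc ρ (b j)) (antipode K x)) = ρ (ww b k j x) := by
    intro j
    rw [h3, post_apply, ctr_map, ww]
  simp only [h6] at h4
  rw [← h4]
  have h7 := contract (b := b) k y 1 (ρ x)
  rw [← Algebra.TensorProduct.one_def, one_mul, one_mul] at h7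
  rw [← h7]
  simp [S2, ctr]

def gg (ρ : H →ₐ[K] B) (y : ι → B) : (ι → H) →ₗ[K] B where
  toFun v := ∑ k, ρ (v k) * y k
  map_add' v w := by simp [add_mul, Finset.sum_add_distrib]
  map_smul' c v := by simp [Finset.smul_sum]

lemma gg_apply (ρ : H →ₐ[K] B) (y : ι → B) (v : ι → H) : gg ρ y v = ∑ k, ρ (v k) * y k := rfl

/-- universal multiplication -/
def star (b : Module.Basis ι K H) (v v' : ι → H) (m : ι) : H :=
  ∑ k, ∑ l, ∑ j, (b.tensorProduct b).repr (comul (b m)) (j, l) • (v k * ww b k j (v' l))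

lemma YA.y_y {y : ι → B} (h : YA b y) (p q : ι) : y p * y q =
      ∑ k, (b.tensorProduct b).repr (comul (b k)) (p, q) • y k := by
    have := h.y1 (b.coord p) (b.coord q)
    rw [yf_coord, yf_coord] at this
    rw [this, yf]
    refine Finset.sum_congr rfl fun k _ => ?_
    congr 1
    change (toConv (b.coord p) * toConv (b.coord q)) (b k) = _
    rw [(ℛ K (b k)).convMul_apply, ← (ℛ K (b k)).eq]
    simp [Module.Basis.tensorProduct_repr_tmul_apply, mul_comm, Finsupp.finset_sum_apply]

lemma YD.gg_mul (S2 : ∀ x : H, antipode K (antipode K x) = x) {ρ : H →ₐ[K] B} {y : ι → B}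
    (h : YD b ρ y) (v v' : ι → H) : gg ρ y v * gg ρ y v' = gg ρ y (star b v v') := by
  simp only [gg_apply, star, map_sum, Finset.sum_mul, Finset.mul_sum]
  rw [Finset.sum_comm]
  conv_rhs => rw [Finset.sum_comm]
  refine Finset.sum_congr rfl fun k _ => ?_
  conv_rhs => rw [Finset.sum_comm]
  refine Finset.sum_congr rfl fun l _ => ?_
  conv_rhs => rw [Finset.sum_comm]
  rw [mul_assoc, ← mul_assoc (y k), h.y_ρ S2, Finset.sum_mul, Finset.mul_sum]
  refine Finset.sum_congr rfl fun j _ => ?_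
  rw [mul_assoc, h.ya.y_y, ← mul_assoc, Finset.mul_sum]
  refine Finset.sum_congr rfl fun m _ => ?_
  simp

lemma YA.gg_one {ρ : H →ₐ[K] B} {y : ι → B} (h : YA b y) :
    gg ρ y (fun k => algebraMap K H (counit (R := K) (b k))) = 1 := by
  rw [← h.y2, gg_apply, yf]
  refine Finset.sum_congr rfl fun k _ => ?_
  rw [AlgHom.commutes, Algebra.smul_def]

lemma gg_ρ_mul (ρ : H →ₐ[K] B) (y : ι → B) (a : H) (v : ι → H) :
    ρ a * gg ρ y v = gg ρ y (fun k => a * v k) := by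
  simp [gg_apply, Finset.mul_sum, mul_assoc]

lemma gg_y [DecidableEq ι] (ρ : H →ₐ[K] B) (y : ι → B) (k : ι) : gg ρ y (Pi.single k 1) = y k := by
  rw [gg_apply, Finset.sum_eq_single k] <;> simp +contextual [Pi.single_apply]

/-- universality -/
lemma YD.exists_hom (S2 : ∀ x : H, antipode K (antipode K x) = x) {ρ : H →ₐ[K] B} {y : ι → B}
    (h : YD b ρ y) (hb : Function.Bijective (gg ρ y)) {ρ' : H →ₐ[K] C} {y' : ι → C}
    (h' : YD b ρ' y') : ∃ θ : B →ₐ[K] C, θ.comp ρ = ρ' ∧ ∀ k, θ (y k) = y' k := by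
  classical
  let e := LinearEquiv.ofBijective (gg ρ y) hb
  have hθ : ∀ v, (gg ρ' y' ∘ₗ e.symm.toLinearMap) (gg ρ y v) = gg ρ' y' v := by
    intro v
    rw [LinearMap.comp_apply]
    congr 1
    exact e.symm_apply_apply v
  let θ : B →ₐ[K] C := AlgHom.ofLinearMap (gg ρ' y' ∘ₗ e.symm.toLinearMap) (by
    rw [← h.ya.gg_one (ρ := ρ), hθ, h'.ya.gg_one]) (by
    intro z w
    obtain ⟨v, rfl⟩ := hb.2 z
    obtain ⟨v', rfl⟩ := hb.2 w
    rw [h.gg_mul S2, hθ, hθ, hθ, h'.gg_mul S2])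
  have hθ' : ∀ v, θ (gg ρ y v) = gg ρ' y' v := hθ
  refine ⟨θ, ?_, fun k => ?_⟩
  · ext x
    have e1 := gg_ρ_mul ρ y x (fun k => algebraMap K H (counit (R := K) (b k)))
    have e2 := gg_ρ_mul ρ' y' x (fun k => algebraMap K H (counit (R := K) (b k)))
    rw [h.ya.gg_one, mul_one] at e1
    rw [h'.ya.gg_one, mul_one] at e2
    rw [AlgHom.comp_apply, e1, hθ', e2]
  · rw [← gg_y ρ y, hθ', gg_y]

/-- the image of `gg` as a subalgebra, with YD structure -/
lemma YD.exists_sub [Module.Free K H] (S2 : ∀ x : H, antipode K (antipode K x) = x)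
    {ρ : H →ₐ[K] B} {y : ι → B} (h : YD b ρ y) (hinj : Function.Injective (gg ρ y)) :
    ∃ (D : Subalgebra K B) (ρD : H →ₐ[K] D) (yD : ι → D), YD b ρD yD ∧
      Function.Bijective (gg ρD yD) ∧ D.val.comp ρD = ρ ∧ ∀ k, (yD k : B) = y k := by
  classical
  let D : Subalgebra K B :=
    { carrier := Set.range (gg ρ y)
      mul_mem' := by
        rintro _ _ ⟨v, rfl⟩ ⟨v', rfl⟩
        exact ⟨_, (h.gg_mul S2 v v').symm⟩
      add_mem' := by
        rintro _ _ ⟨v, rfl⟩ ⟨v', rfl⟩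
        exact ⟨_, map_add _ _ _⟩
      algebraMap_mem' := fun c => ⟨c • fun k => algebraMap K H (counit (R := K) (b k)), by
        rw [map_smul, h.ya.gg_one, Algebra.algebraMap_eq_smul_one]⟩ }
  have hρ : ∀ x, ρ x ∈ D := fun x =>
    ⟨fun k => x * algebraMap K H (counit (R := K) (b k)), by
      rw [← gg_ρ_mul, h.ya.gg_one, mul_one]⟩
  have hy : ∀ k, y k ∈ D := fun k => ⟨Pi.single k 1, gg_y _ _ _⟩
  let ρD := ρ.codRestrict D hρ
  let yD : ι → D := fun k => ⟨y k, hy k⟩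
  have hyf : ∀ φ, ((yf b yD φ : D) : B) = yf b y φ := fun φ => map_yf D.val yD φ
  have hg : ∀ v, ((gg ρD yD v : D) : B) = gg ρ y v := fun v => by
    rw [gg_apply, gg_apply]
    exact map_sum D.val _ _
  refine ⟨D, ρD, yD, ⟨?_, ?_, ?_⟩, ⟨?_, ?_⟩, rfl, fun _ => rfl⟩
  · intro φ ψ
    apply Subtype.ext
    rw [hyf, ← h.y1, ← hyf, ← hyf]; rfl
  · apply Subtype.ext
    rw [hyf, h.y2]; rfl
  · intro x
    have hi : Function.Injective (Algebra.TensorProduct.map (AlgHom.id K H) D.val) :=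
      Module.Flat.lTensor_preserves_injective_linearMap (M := H) D.val.toLinearMap
        Subtype.val_injective
    apply hi
    have := h.y3 x
    have e1 : post (Algebra.TensorProduct.map (AlgHom.id K H) D.val) (iL K H D) = iL K H B := by
      ext; simp
    have e2 : post (Algebra.TensorProduct.map (AlgHom.id K H) D.val) (iR ρD) = iR ρ := by
      ext; simp [ρD]
    rw [map_mul, map_mul, map_pr, ← post_apply, ← post_apply, map_mul, map_mul, e1, e2]
    simpa using this
  · intro v w hvw
    exact hinj (by rw [← hg, ← hg, hvw])
  · rintro ⟨_, v, rfl⟩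
    exact ⟨v, Subtype.ext (hg v)⟩

end closure
end HE
end
noncomputable section
open TensorProduct Coalgebra WithConv HopfAlgebra
set_option linter.all false
namespace HE

section mulHom
variable {K H B C ι : Type*} [CommRing K] [Ring H] [HopfAlgebra K H] [Ring B] [Algebra K B]
  [Ring C] [Algebra K C] [Fintype ι] {b : Module.Basis ι K H}

/-- convolution product of commuting algebra maps -/
def mulHom (f g : H →ₐ[K] C) (hc : ∀ x z, Commute (f x) (g z)) : H →ₐ[K] C :=
  (Algebra.TensorProduct.lift f g hc).comp (Bialgebra.comulAlgHom K H)

lemma cv_mulHom (f g : H →ₐ[K] C) (hc : ∀ x z, Commute (f x) (g z)) :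
    cv (mulHom f g hc) = cv f * cv g := by
  ext x
  rw [(ℛ K x).convMul_apply]
  change (Algebra.TensorProduct.lift f g hc) (comul x) = _
  rw [← (ℛ K x).eq]
  simp

lemma mulHom_repr (f g : H →ₐ[K] C) (hc : ∀ x z, Commute (f x) (g z)) {x : H} {ι : Type*}
    (r : Coalgebra.Repr K x ι) : mulHom f g hc x = ∑ i ∈ r.index, f (r.left i) * g (r.right i) := by
  change (Algebra.TensorProduct.lift f g hc) (comul x) = _
  rw [← r.eq]
  simp

/-- `h ↦ R_{S h}` -/
def rS (K H : Type*) [CommRing K] [Ring H] [HopfAlgebra K H] : H →ₐ[K] Module.End K H :=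
  AlgHom.ofLinearMap ((LinearMap.mul K H).flip ∘ₗ antipode K)
    (by ext x; simp) (by intro x z; ext w; simp [antipode_mul_antidistrib, mul_assoc])

@[simp] lemma rS_apply (h x : H) : rS K H h x = x * antipode K h := rfl

lemma lS_comm (x z : H) : Commute (rS K H x) (Algebra.lmul K H z) := by
  rw [Commute, SemiconjBy]
  ext w; simp [mul_assoc]

def yN (b : Module.Basis ι K H) (k : ι) : Module.End K H := (idc K H * iot H (b.coord k)).ofConv

lemma yf_yN (φ : H →ₗ[K] K) : yf b (yN b) φ = (idc K H * iot H φ).ofConv := by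
  have h1 : φ = ∑ k, φ (b k) • b.coord k := by
    apply b.ext
    intro j
    classical
    simp [Finsupp.single_apply]
  have h2 : iot H φ = ∑ k, φ (b k) • iot H (b.coord k) := by
    conv_lhs => rw [h1]
    ext x
    change algebraMap K H _ = (∑ k, φ (b k) • iot H (b.coord k)).ofConv x
    have h3 : φ x = ∑ i, φ (b i) * b.repr x i := by
      conv_lhs => rw [← b.sum_repr x]
      rw [map_sum]
      simp only [map_smul, smul_eq_mul, mul_comm]
    simp [Algebra.algebraMap_eq_smul_one, smul_smul]
    rw [← Finset.sum_smul]
    exact congrArg (fun c : K => c • (1:H)) h3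
  rw [h2, yf, Finset.mul_sum]
  ext x
  simp [yN]

lemma yaN : YA b (yN b) := by
  constructor
  · intro φ ψ
    rw [yf_yN, yf_yN, yf_yN]
    rw [Module.End.mul_eq_comp, comp_rc, mul_assoc]
    congr 2
    ext x
    rw [(ℛ K x).convMul_apply]
    change _ = algebraMap K H ((toConv φ * toConv ψ) x)
    rw [(ℛ K x).convMul_apply]
    simp
  · rw [yf_yN]
    have : iot H (counit (R := K)) = (1 : WithConv (H →ₗ[K] H)) := rfl
    rw [this, mul_one]; rfl

variable (K H) in
abbrev Phi : H ⊗[K] (Module.End K H) →ₗ[K] (H →ₗ[K] H ⊗[K] H) :=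
  TensorProduct.lTensorHomToHomLTensor (RingHom.id K) H H H

lemma Phi_Y (x : H) : Phi K H (pr b (fun k => (1:H) ⊗ₜ[K] yN b k) (iL K H (Module.End K H))) x =
    TensorProduct.comm K H H (comul x) := by
  rw [← (ℛ K x).eq]
  have : ∀ k, yN b k x = ∑ i ∈ (ℛ K x).index, b.coord k ((ℛ K x).right i) • (ℛ K x).left i :=
    fun k => rc_repr (ℛ K x) (b.coord k)
  simp only [pr, map_sum, LinearMap.sum_apply]
  simp [this, tmul_sum]
  rw [Finset.sum_comm]
  refine Finset.sum_congr rfl fun i _ => ?_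
  conv_rhs => rw [← b.sum_repr ((ℛ K x).right i)]
  rw [sum_tmul]
  simp [smul_tmul']

lemma Phi_mul_tmul (Z : H ⊗[K] (Module.End K H)) (a : H) (T : Module.End K H) (x : H) :
    Phi K H (Z * a ⊗ₜ T) x = LinearMap.rTensor H (LinearMap.mulRight K a) (Phi K H Z (T x)) := by
  induction Z with
  | zero => simp
  | tmul a w => simp
  | add x y hx hy => rw [add_mul, map_add, LinearMap.add_apply, hx, hy, map_add, LinearMap.add_apply, map_add]

lemma Phi_tmul_mul (Z : H ⊗[K] (Module.End K H)) (a : H) (T : Module.End K H) (x : H) :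
    Phi K H (a ⊗ₜ T * Z) x = TensorProduct.map (LinearMap.mulLeft K a) T (Phi K H Z x) := by
  induction Z with
  | zero => simp
  | tmul a w => simp
  | add x y hx hy => rw [mul_add, map_add, LinearMap.add_apply, hx, hy, map_add, LinearMap.add_apply, map_add]

lemma Phi_inj [Module.Free K H] [Module.Finite K H] : Function.Injective (Phi K H) := by
  have := (lTensorHomEquivHomLTensor K H H H).injective
  rwa [← LinearEquiv.coe_coe, lTensorHomEquivHomLTensor_toLinearMap] at this

variable [Module.Free K H] [Module.Finite K H]

lemma H1 : lmc (pr b (fun k => (1:H) ⊗ₜ[K] yN b k) (iL K H (Module.End K H)))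
      (iR (Algebra.lmul K H)) = rmc (iR (Algebra.lmul K H) * iL K H (Module.End K H))
        (pr b (fun k => (1:H) ⊗ₜ[K] yN b k) (iL K H (Module.End K H))) := by
  ext h
  apply Phi_inj
  ext x
  rw [lmc_apply, rmc_apply, (ℛ K h).convMul_apply, Finset.sum_mul, map_sum, LinearMap.sum_apply]
  have e1 : (iR (Algebra.lmul K H)) h = (1:H) ⊗ₜ[K] (Algebra.lmul K H h) := rfl
  have e2 : ∀ i, (iR (Algebra.lmul K H)) ((ℛ K h).left i) * (iL K H (Module.End K H)) ((ℛ K h).right i)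
    = (ℛ K h).right i ⊗ₜ (Algebra.lmul K H ((ℛ K h).left i)) := fun i => by simp
  simp only [e1, e2, Phi_mul_tmul, Phi_tmul_mul]
  rw [Phi_Y, Phi_Y]
  have : comul (R := K) ((Algebra.lmul K H h) x) = _ := comul_mul_repr (ℛ K h) (ℛ K x)
  rw [this, ← (ℛ K x).eq]
  simp

lemma H2 (S2 : ∀ x : H, antipode K (antipode K x) = x) :
    lmc (pr b (fun k => (1:H) ⊗ₜ[K] yN b k) (iL K H (Module.End K H)))
      (iL K H (Module.End K H) * iR (rS K H)) = rmc (iR (rS K H))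
        (pr b (fun k => (1:H) ⊗ₜ[K] yN b k) (iL K H (Module.End K H))) := by
  ext h
  apply Phi_inj
  ext x
  rw [lmc_apply, rmc_apply, (ℛ K h).convMul_apply, Finset.mul_sum, map_sum, LinearMap.sum_apply]
  have e1 : (iR (rS K H)) h = (1:H) ⊗ₜ[K] (rS K H h) := rfl
  have e2 : ∀ i, (iL K H (Module.End K H)) ((ℛ K h).left i) * (iR (rS K H)) ((ℛ K h).right i)
    = (ℛ K h).left i ⊗ₜ (rS K H ((ℛ K h).right i)) := fun i => by simp
  simp only [e1, e2, Phi_mul_tmul, Phi_tmul_mul]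
  rw [Phi_Y]
  let P : H ⊗[K] H := TensorProduct.comm K H H (comul x)
  let T : H ⊗[K] H →ₗ[K] H ⊗[K] H := LinearMap.mul' K (H ⊗[K] H) ∘ₗ TensorProduct.map
    (LinearMap.mulLeft K P ∘ₗ (TensorProduct.comm K H H).toLinearMap ∘ₗ comul ∘ₗ antipode K)
    (Algebra.TensorProduct.includeLeft : H →ₐ[K] H ⊗[K] H).toLinearMap ∘ₗ
      (TensorProduct.comm K H H).toLinearMap
  have hcm : ∀ z w : H ⊗[K] H, TensorProduct.comm K H H (z * w) =
      TensorProduct.comm K H H z * TensorProduct.comm K H H w :=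
    fun z w => map_mul (Algebra.TensorProduct.comm K H H) z w
  have hrm : ∀ (z : H ⊗[K] H) (a : H), LinearMap.rTensor H (LinearMap.mulRight K a) z =
      z * a ⊗ₜ 1 := by
    intro z a
    induction z with
    | zero => simp
    | tmul a w => simp
    | add x y hx hy => rw [add_mul, map_add, hx, hy]
  have e3 : ∀ i, LinearMap.rTensor H (LinearMap.mulRight K ((ℛ K h).left i))
      (Phi K H (pr b (fun k => (1:H) ⊗ₜ[K] yN b k) (iL K H (Module.End K H)))
        ((rS K H ((ℛ K h).right i)) x)) = T ((ℛ K h).left i ⊗ₜ (ℛ K h).right i) := by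
    intro i
    rw [Phi_Y, rS_apply, Bialgebra.comul_mul, hcm, hrm]
    simp [T, P]
  simp only [e3]
  rw [← map_sum, (ℛ K h).eq]
  have e4 := antipode_anti (K := K) (antipode K h)
  rw [S2] at e4
  have i1 := (Algebra.TensorProduct.includeLeft : H →ₐ[K] H ⊗[K] H)
  have e5 : (cv (B := H ⊗[K] H) Algebra.TensorProduct.includeRight *
    cv (B := H ⊗[K] H) Algebra.TensorProduct.includeLeft) =
      toConv ((TensorProduct.comm K H H).toLinearMap ∘ₗ comul) := by
    ext z
    rw [(ℛ K z).convMul_apply]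
    change _ = TensorProduct.comm K H H (comul z)
    rw [← (ℛ K z).eq]
    simp
  have e6 := congrArg (fun f => lmc P (f * cvS (B := H ⊗[K] H) Algebra.TensorProduct.includeLeft)
    (antipode K h)) e5
  simp only [mul_assoc, cv_cvS, mul_one, ← lmc_mul] at e6
  rw [e4, ← (ℛ K (antipode K h)).eq]
  rw [(ℛ K (antipode K h)).convMul_apply] at e6
  refine Eq.trans ?_ (e6.symm.trans ?_)
  · simp only [map_sum]
    refine Finset.sum_congr rfl fun i _ => ?_
    simp [T, S2]
  · have : ∀ z : H ⊗[K] H, TensorProduct.map (LinearMap.mulLeft K 1) (rS K H h) z =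
      z * 1 ⊗ₜ antipode K h := by
      intro z
      induction z with
      | zero => simp
      | tmul a w => simp
      | add x y hx hy => rw [add_mul, map_add, hx, hy]
    rw [this]; rfl

end mulHom
end HE
end
noncomputable section
open TensorProduct Coalgebra WithConv HopfAlgebra
set_option linter.all false
namespace HE

section gen
variable {K H E ι : Type*} [CommRing K] [Ring H] [HopfAlgebra K H] [Ring E] [Algebra K E]
  [Fintype ι] {b : Module.Basis ι K H}

structure GD (b : Module.Basis ι K H) (a1 a3 : H →ₐ[K] E) (y : ι → E) : Prop where
  ya : YA b y
  c : ∀ x z, Commute (a1 x) (a3 z)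
  h1 : lmc (pr b (fun k => (1:H) ⊗ₜ[K] y k) (iL K H E)) (iR a3) =
    rmc (iR a3 * iL K H E) (pr b (fun k => (1:H) ⊗ₜ[K] y k) (iL K H E))
  h2 : lmc (pr b (fun k => (1:H) ⊗ₜ[K] y k) (iL K H E)) (iL K H E * iR a1) =
    rmc (iR a1) (pr b (fun k => (1:H) ⊗ₜ[K] y k) (iL K H E))

variable {a1 a3 : H →ₐ[K] E} {y : ι → E}

def eL (E H : Type*) [Ring E] [Algebra K E] [Ring H] [HopfAlgebra K H] : E →ₐ[K] E ⊗[K] H :=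
  Algebra.TensorProduct.includeLeft
def eR (E H : Type*) [Ring E] [Algebra K E] [Ring H] [HopfAlgebra K H] : H →ₐ[K] E ⊗[K] H :=
  Algebra.TensorProduct.includeRight

lemma eL_apply (z : E) : eL (K := K) E H z = z ⊗ₜ 1 := rfl
lemma eR_apply (z : H) : eR (K := K) E H z = 1 ⊗ₜ z := rfl
lemma eLR_comm (z : E) (x : H) : Commute (eL (K := K) E H z) (eR E H x) := by
  simp [Commute, SemiconjBy, eL_apply, eR_apply]

def ρ0 (a1 : H →ₐ[K] E) : H →ₐ[K] E ⊗[K] H :=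
  mulHom ((eL E H).comp a1) (eR E H) (fun x z => eLR_comm _ _)

lemma ρ0_repr (a1 : H →ₐ[K] E) {x : H} {κ : Type*} (r : Coalgebra.Repr K x κ) : ρ0 a1 x =
    ∑ i ∈ r.index, (eL E H).comp a1 (r.left i) * eR E H (r.right i) := mulHom_repr _ _ _ r
lemma cv_ρ0 (a1 : H →ₐ[K] E) : cv (ρ0 a1) = cv ((eL E H).comp a1) * cv (eR E H) :=
  cv_mulHom _ _ _

lemma GD.comm (G : GD b a1 a3 y) (x z : H) : Commute (ρ0 a1 x) ((eL E H).comp a3 z) := by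
  rw [ρ0_repr _ (ℛ K x)]
  refine Commute.sum_left _ _ _ fun i _ => ?_
  refine Commute.mul_left ?_ ?_
  · exact (G.c _ _).map (eL E H)
  · exact (eLR_comm _ _).symm

def GD.ρN (G : GD b a1 a3 y) : H →ₐ[K] E ⊗[K] H :=
  mulHom (ρ0 a1) ((eL E H).comp a3) G.comm

lemma GD.cv_ρN (G : GD b a1 a3 y) : cv G.ρN = cv ((eL E H).comp a1) * cv (eR E H) *
    cv ((eL E H).comp a3) := by
  rw [GD.ρN, cv_mulHom, cv_ρ0]

lemma GD.yd (G : GD b a1 a3 y) : YD b G.ρN (fun k => eL E H (y k)) := by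
  have ya := G.ya.map (eL E H)
  refine ⟨ya.y1, ya.y2, ?_⟩
  let α : H ⊗[K] E →ₐ[K] H ⊗[K] (E ⊗[K] H) :=
    Algebra.TensorProduct.map (AlgHom.id K H) (eL E H)
  set Y := pr b (fun k => (1:H) ⊗ₜ[K] eL (K := K) E H (y k)) (iL K H (E ⊗[K] H)) with hY
  have aL : post α (iL K H E) = iL K H (E ⊗[K] H) := by ext; simp [α]
  have aY : α (pr b (fun k => (1:H) ⊗ₜ[K] y k) (iL K H E)) = Y := by
    rw [map_pr, aL, hY]
    simp [α]
  let A1 : WithConv (H →ₗ[K] H ⊗[K] (E ⊗[K] H)) := post α (iR a1)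
  let A3 : WithConv (H →ₗ[K] H ⊗[K] (E ⊗[K] H)) := post α (iR a3)
  let A2 : WithConv (H →ₗ[K] H ⊗[K] (E ⊗[K] H)) := cv (B := H ⊗[K] (E ⊗[K] H))
    (Algebra.TensorProduct.includeRight.comp (eR E H))
  have pl : ∀ (z) (f : WithConv (H →ₗ[K] H ⊗[K] E)), post α (lmc z f) =
    lmc (α z) (post α f) := fun z f => by ext; simp
  have prr : ∀ (z) (f : WithConv (H →ₗ[K] H ⊗[K] E)), post α (rmc f z) =
    rmc (post α f) (α z) := fun z f => by ext; simp
  have h1 := congrArg (post α) G.h1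
  have h2 := congrArg (post α) G.h2
  rw [pl, prr, map_mul, aL, aY] at h1 h2
  have h3 : lmc Y A2 = rmc A2 Y := by
    ext x
    simp [hY, pr, A2, eL_apply, eR_apply, Finset.mul_sum, Finset.sum_mul]
  have h4 : iR G.ρN = A1 * A2 * A3 := by
    have : iR G.ρN = post (Algebra.TensorProduct.includeRight : (E ⊗[K] H) →ₐ[K] H ⊗[K] (E ⊗[K] H))
      (cv G.ρN) := rfl
    rw [this, G.cv_ρN, map_mul, map_mul]
    congr 1
  intro x
  have : lmc Y (iL K H (E ⊗[K] H) * iR G.ρN) = rmc (iR G.ρN * iL K H (E ⊗[K] H)) Y := by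
    rw [h4, ← mul_assoc, ← mul_assoc, ← lmc_mul, ← lmc_mul, h2, ← mul_lmc]
    change A1 * lmc Y A2 * A3 = _
    rw [h3, mul_rmc, ← mul_lmc, h1, mul_rmc]
    simp only [mul_assoc]; rfl
  exact congrArg (fun f : WithConv (H →ₗ[K] H ⊗[K] (E ⊗[K] H)) => f.ofConv x) this

/-- partial application of lam -/
def plam (E : Type*) [Ring E] [Algebra K E] (lam : H →ₗ[K] K) : E ⊗[K] H →ₗ[K] E :=
  TensorProduct.lift ((LinearMap.lsmul K E).flip.compl₂ lam)

variable {L : H} {lam : H →ₗ[K] K}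
lemma plam_tmul (T : E) (x : H) : plam E lam (T ⊗ₜ x) = lam x • T := rfl

lemma plam_mul (T : E) (z : E ⊗[K] H) : plam E lam (eL E H T * z) = T * plam E lam z := by
  rw [eL_apply]
  induction z with
  | zero => simp
  | tmul a w => simp [plam_tmul]
  | add x y hx hy => rw [mul_add, map_add, hx, hy, map_add, mul_add]

lemma mul_plam (T : E) (z : E ⊗[K] H) : plam E lam (z * eL E H T) = plam E lam z * T := by
  rw [eL_apply]
  induction z with
  | zero => simp
  | tmul a w => simp [plam_tmul]
  | add x y hx hy => rw [add_mul, map_add, hx, hy, map_add, add_mul]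

lemma post_iot (f : H →ₐ[K] E) : post f (iot H lam) = iot E lam := by
  ext x
  change f (algebraMap K H (lam x)) = algebraMap K E (lam x)
  exact AlgHom.commutes _ _

lemma GD.plam_ρ (G : GD b a1 a3 y) (I : Ints K L lam) (x : H) :
    plam E lam (G.ρN x) = algebraMap K _ (lam x) := by
  have h1 : toConv (plam E lam ∘ₗ G.ρN.toLinearMap) = cv a1 * iot _ lam * cv a3 := by
    ext x
    change plam E lam ((cv G.ρN) x) = _
    rw [G.cv_ρN, (ℛ K x).convMul_apply, (ℛ K x).convMul_apply, map_sum]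
    refine Finset.sum_congr rfl fun i _ => ?_
    refine (mul_plam _ _).trans ?_
    congr 1
    rw [(ℛ K _).convMul_apply, (ℛ K _).convMul_apply, map_sum]
    refine Finset.sum_congr rfl fun i _ => ?_
    refine (plam_mul _ _).trans ?_
    congr 1
    change plam E lam (1 ⊗ₜ _) = _
    rw [plam_tmul, iot_apply, Algebra.algebraMap_eq_smul_one]
  have h2 : iot E lam * cv a3 = iot _ lam := by
    have := congrArg (post a3) I.ll
    rwa [map_mul, post_iot] at this
  have h3 : cv a1 * iot E lam = iot _ lam := by
    have := congrArg (post a1) I.lr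
    rwa [map_mul, post_iot] at this
  rw [mul_assoc, h2, h3] at h1
  exact congrArg (fun f : WithConv (H →ₗ[K] E) => f.ofConv x) h1

end gen

section tau
variable {K H E ι : Type*} [Field K] [CharZero K] [Ring H] [HopfAlgebra K H] [FiniteDimensional K H]
  [Fintype ι] {b : Module.Basis ι K H} {L : H} {lam : H →ₗ[K] K} [Ring E] [Algebra K E]
  {a1 a3 : H →ₐ[K] E} {y : ι → E} {t : E →ₗ[K] K}

lemma GD.τN_ρy (G : GD b a1 a3 y) (I : Ints K L lam)
    (ht : ∀ φ, t (yf b y φ) = (Module.finrank K H : K) * φ L) (x : H) (φ : H →ₗ[K] K) :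
    t (plam E lam (G.ρN x * yf b (fun k => eL E H (y k)) φ)) =
      (Module.finrank K H : K) * lam x * φ L := by
  rw [← map_yf (eL E H), mul_plam, G.plam_ρ I, ← Algebra.smul_def, map_smul, ht]
  simp only [smul_eq_mul]; ring

lemma τN_comm (I : Ints K L lam) (ht : ∀ z w, t (z * w) = t (w * z)) (z w : E ⊗[K] H) :
    t (plam E lam (z * w)) = t (plam E lam (w * z)) := by
  induction z with
  | zero => simp
  | tmul a x =>
    induction w with
    | zero => simp
    | tmul c y =>
      simp only [Algebra.TensorProduct.tmul_mul_tmul, plam_tmul, map_smul]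
      rw [I.tracial, ht]
    | add x y hx hy => rw [mul_add, map_add, map_add, hx, hy, add_mul, map_add, map_add]
  | add x y hx hy => rw [add_mul, map_add, map_add, hx, hy, mul_add, map_add, map_add]

/-- nondegeneracy of a suitable trace -/
lemma Ints.g_inj (I : Ints K L lam) {B : Type*} [Ring B] [Algebra K B] {ρ : H →ₐ[K] B}
    {y : ι → B} (Y : YD b ρ y) {τ : B →ₗ[K] K} (hτ : ∀ z w, τ (z * w) = τ (w * z))
    (hy : ∀ x φ, τ (ρ x * yf b y φ) = (Module.finrank K H : K) * lam x * φ L) (v : ι → H)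
    (h : ∀ a φ, τ (gg ρ y v * (yf b y φ * ρ a)) = 0) : v = 0 := by
  have S2 := I.S2
  have h1 : ∀ φ : H →ₗ[K] K, ∑ k, (toConv (b.coord k) * toConv φ) L • v k = 0 := by
    intro φ
    apply I.nd2
    intro a
    have h2 := h a φ
    rw [← mul_assoc, hτ, ← mul_assoc, gg_ρ_mul, gg_apply, Finset.sum_mul, map_sum] at h2
    have h3 : ∀ k, τ (ρ (a * v k) * y k * yf b y φ) =
        (Module.finrank K H : K) * (lam (a * v k) * (toConv (b.coord k) * toConv φ) L) := by
      intro k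
      rw [mul_assoc]
      conv_lhs => rw [← yf_coord (b := b) y k, Y.y1, hy]
      ring
    simp only [h3, ← Finset.mul_sum] at h2
    have h4 := (mul_eq_zero.mp h2).resolve_left I.d_ne
    rw [Finset.mul_sum, map_sum, ← h4]
    refine Finset.sum_congr rfl fun k _ => ?_
    rw [mul_smul_comm, map_smul, smul_eq_mul, mul_comm]
  funext j
  have h2 := h1 (lam ∘ₗ LinearMap.mulLeft K (antipode K (b j)))
  have h3 : ∀ k, (toConv (b.coord k) * toConv (lam ∘ₗ LinearMap.mulLeft K (antipode K (b j)))) L =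
      lam L * b.coord k (b j) := by
    intro k
    rw [(ℛ K L).convMul_apply]
    have := congrArg (b.coord k) (I.L5 (antipode K (b j)) (ℛ K L))
    rw [map_sum, map_smul, S2] at this
    rw [← smul_eq_mul, ← this]
    refine Finset.sum_congr rfl fun i _ => ?_
    rw [map_smul, smul_eq_mul, mul_comm]; rfl
  classical
  simp only [h3] at h2
  simp [Finsupp.single_apply, ite_smul] at h2
  exact h2.resolve_left I.lamL_ne

lemma gdN (S2 : ∀ x : H, antipode K (antipode K x) = x) (b : Module.Basis ι K H) :
    GD b (rS K H) (Algebra.lmul K H) (yN b) :=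
  ⟨yaN, lS_comm, H1, H2 S2⟩

end tau
end HE
end
noncomputable section
open TensorProduct Coalgebra WithConv HopfAlgebra
set_option linter.all false
namespace HE

structure DD {K H ι D : Type*} [Field K] [Ring H] [HopfAlgebra K H] [Fintype ι] [Ring D] [Algebra K D]
   (b : Module.Basis ι K H) (L : H) (lam : H →ₗ[K] K) (ρ : H →ₐ[K] D) (y : ι → D)
   (τ : D →ₗ[K] K) : Prop where
  yd : YD b ρ y
  bij : Function.Bijective (gg ρ y)
  tr : ∀ z w, τ (z * w) = τ (w * z)
  hy : ∀ x φ, τ (ρ x * yf b y φ) = (Module.finrank K H : K) * lam x * φ L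

variable {K H ι : Type*} [Field K] [CharZero K] [Ring H] [HopfAlgebra K H] [FiniteDimensional K H]
  [Fintype ι] {b : Module.Basis ι K H} {L : H} {lam : H →ₗ[K] K}

lemma GD.exists_D.{w, v} {K : Type*} {H : Type v} {ι : Type*} [Field K] [CharZero K] [Ring H]
    [HopfAlgebra K H] [FiniteDimensional K H] [Fintype ι] {b : Module.Basis ι K H} {L : H}
    {lam : H →ₗ[K] K} {E : Type w} [Ring E] [Algebra K E] {a1 a3 : H →ₐ[K] E} {y : ι → E}
    {t : E →ₗ[K] K} (G : GD b a1 a3 y) (I : Ints K L lam)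
    (ht : ∀ φ, t (yf b y φ) = (Module.finrank K H : K) * φ L)
    (htr : ∀ z w, t (z * w) = t (w * z)) :
    ∃ (D : Type (max w v)) (_ : Ring D) (_ : Algebra K D) (ρ : H →ₐ[K] D) (y : ι → D) (τ : D →ₗ[K] K),
      DD b L lam ρ y τ := by
  have yd := G.yd
  have hy := G.τN_ρy I ht
  have hinj : Function.Injective (gg G.ρN (fun k => eL E H (y k))) := by
    rw [← LinearMap.ker_eq_bot, LinearMap.ker_eq_bot']
    intro v hv
    refine I.g_inj yd (τ := t ∘ₗ plam E lam) (τN_comm I htr) hy v fun a φ => ?_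
    rw [hv, zero_mul, map_zero]
  obtain ⟨D, ρ, yD, h, hb, h1, h2⟩ := yd.exists_sub I.S2 hinj
  refine ⟨D, inferInstance, inferInstance, ρ, yD, (t ∘ₗ plam E lam) ∘ₗ D.val.toLinearMap, h, hb, fun z w => ?_, fun x φ => ?_⟩
  · exact τN_comm I htr _ _
  · have := hy x φ
    rw [← h1] at this
    rw [← this]
    change t (plam E lam (D.val (ρ x * yf b yD φ))) = _
    rw [map_mul, map_yf]
    congr 3
    exact congrArg (fun y => yf b y φ) (funext h2)

lemma Ints.exists_D.{v} {K : Type*} {H : Type v} {ι : Type*} [Field K] [CharZero K] [Ring H]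
    [HopfAlgebra K H] [FiniteDimensional K H] [Fintype ι] {L : H}
    {lam : H →ₗ[K] K} (I : Ints K L lam) (b : Module.Basis ι K H) :
    ∃ (D : Type v) (_ : Ring D) (_ : Algebra K D) (ρ : H →ₐ[K] D) (y : ι → D) (τ : D →ₗ[K] K),
      DD b L lam ρ y τ := by
  refine (gdN I.S2 b).exists_D I (t := LinearMap.trace K H) (fun φ => ?_) (fun z w => ?_)
  · rw [yf_yN, I.trace_rc]
  · exact LinearMap.trace_mul_comm K z w

section
variable {D : Type*} [Ring D] [Algebra K D] {ρ : H →ₐ[K] D} {y : ι → D} {τ : D →ₗ[K] K}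

lemma DD.fin (h : DD b L lam ρ y τ) : Module.Finite K D :=
  Module.Finite.of_surjective (gg ρ y) h.bij.2

lemma DD.finrank (h : DD b L lam ρ y τ) : Module.finrank K D = Module.finrank K H ^ 2 := by
  rw [← (LinearEquiv.ofBijective _ h.bij).finrank_eq, Module.finrank_pi_fintype,
    Module.finrank_eq_card_basis b]
  simp [sq]

lemma DD.ext (h : DD b L lam ρ y τ) {M : Type*} [AddCommGroup M] [Module K M] {f g : D →ₗ[K] M}
    (hf : ∀ x φ, f (ρ x * yf b y φ) = g (ρ x * yf b y φ)) : f = g := by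
  ext z
  obtain ⟨v, rfl⟩ := h.bij.2 z
  rw [gg_apply, map_sum, map_sum]
  refine Finset.sum_congr rfl fun k _ => ?_
  rw [← yf_coord (b := b) y k]
  exact hf _ _

lemma DD.nondeg (h : DD b L lam ρ y τ) (I : Ints K L lam) {z : D} (hz : ∀ w, τ (z * w) = 0) :
    z = 0 := by
  obtain ⟨v, rfl⟩ := h.bij.2 z
  rw [I.g_inj h.yd h.tr h.hy v (fun a φ => hz _), map_zero]

/-- `φ * λ(S h ·)` at `L` -/
lemma Ints.Lconv (I : Ints K L lam) (φ : H →ₗ[K] K) (h : H) :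
    (toConv φ * toConv (lam ∘ₗ LinearMap.mulLeft K (antipode K h))) L = lam L * φ h := by
  rw [(ℛ K L).convMul_apply]
  have := congrArg φ (I.L5 (antipode K h) (ℛ K L))
  rw [map_sum, map_smul, I.S2] at this
  rw [← smul_eq_mul, ← this]
  refine Finset.sum_congr rfl fun i _ => ?_
  rw [map_smul, smul_eq_mul, mul_comm]; rfl

lemma DD.dual (h : DD b L lam ρ y τ) (I : Ints K L lam) (w : D) :
    ∑ i ∈ (ℛ K L).index, ∑ j, τ (w * (yf b y (lam ∘ₗ LinearMap.mulLeft K (antipode K (b j))) *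
      ρ ((ℛ K L).left i))) • (ρ (antipode K ((ℛ K L).right i)) * y j) = lam L • w := by
  have : (∑ i ∈ (ℛ K L).index, ∑ j, ((τ ∘ₗ LinearMap.mulRight K (yf b y (lam ∘ₗ LinearMap.mulLeft K (antipode K (b j))) *
      ρ ((ℛ K L).left i))).smulRight (ρ (antipode K ((ℛ K L).right i)) * y j))) = lam L • LinearMap.id := by
    refine h.ext fun x φ => ?_
    simp only [LinearMap.sum_apply, LinearMap.smulRight_apply, LinearMap.comp_apply,
      LinearMap.mulRight_apply, LinearMap.smul_apply, LinearMap.id_apply]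
    have h1 : ∀ i j, τ (ρ x * yf b y φ * (yf b y (lam ∘ₗ LinearMap.mulLeft K (antipode K (b j))) *
        ρ ((ℛ K L).left i))) = lam ((ℛ K L).left i * x) * φ (b j) := by
      intro i j
      rw [← mul_assoc, h.tr, ← mul_assoc, ← mul_assoc, ← map_mul, mul_assoc, h.yd.y1, h.hy]
      change _ * (toConv φ * toConv (lam ∘ₗ LinearMap.mulLeft K (antipode K (b j)))) L = _
      rw [I.Lconv]
      linear_combination lam ((ℛ K L).left i * x) * φ (b j) * I.lamL
    simp only [h1]
    have h2 := congrArg (fun z => ρ (antipode K z) * yf b y φ) (I.L6 x (ℛ K L))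
    simp only [map_smul, map_sum, I.S2, Finset.sum_mul, smul_mul_assoc] at h2
    rw [← h2]
    refine Finset.sum_congr rfl fun i _ => ?_
    rw [yf, Finset.mul_sum, Finset.smul_sum]
    refine Finset.sum_congr rfl fun j _ => ?_
    rw [mul_smul_comm, smul_smul]
  have := congrArg (fun f => f w) this
  simpa [mul_assoc] using this

lemma DD.dual1 (h : DD b L lam ρ y τ) (I : Ints K L lam) :
    ∑ i ∈ (ℛ K L).index, ∑ j, (ρ (antipode K ((ℛ K L).right i)) * y j) *
     (yf b y (lam ∘ₗ LinearMap.mulLeft K (antipode K (b j))) *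
      ρ ((ℛ K L).left i)) = 1 := by
  have h1 : ∑ j, y j * yf b y (lam ∘ₗ LinearMap.mulLeft K (antipode K (b j))) = 1 := by
    rw [← h.yd.y2]
    have : ∀ j, y j * yf b y (lam ∘ₗ LinearMap.mulLeft K (antipode K (b j))) =
        yf b y (toConv (b.coord j) * toConv (lam ∘ₗ LinearMap.mulLeft K (antipode K (b j)))).ofConv := by
      intro j
      conv_lhs => rw [← yf_coord (b := b) y j, h.yd.y1]
    simp only [this]
    simp only [yf]
    rw [Finset.sum_comm]
    refine Finset.sum_congr rfl fun k _ => ?_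
    rw [← Finset.sum_smul]
    congr 1
    have h3 := congrArg (fun f : WithConv (H →ₗ[K] H) => lam (f.ofConv (b k))) (Sc_idc (K := K) (H := H))
    have h4 : lam ((1 : WithConv (H →ₗ[K] H)) (b k)) = counit (R := K) (b k) := by
      rw [LinearMap.convOne_apply, Algebra.algebraMap_eq_smul_one, map_smul, I.l1]; simp
    refine Eq.trans ?_ (h3.trans h4)
    change _ = lam ((Sc K H * idc K H) (b k))
    rw [(ℛ K (b k)).convMul_apply, map_sum]
    simp only [(ℛ K (b k)).convMul_apply]
    rw [Finset.sum_comm]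
    refine Finset.sum_congr rfl fun i _ => ?_
    have h5 := congrArg (fun z => lam (antipode K z * (ℛ K (b k)).right i)) (b.sum_repr ((ℛ K (b k)).left i))
    simp only [map_sum, map_smul, Finset.sum_mul, smul_mul_assoc, smul_eq_mul] at h5
    exact h5
  have h2 := skew1 I.S2 (ℛ K L)
  rw [I.e, map_one] at h2
  have h3 := congrArg ρ h2
  rw [map_sum, map_one] at h3
  rw [← h3]
  refine Finset.sum_congr rfl fun i _ => ?_
  rw [map_mul]
  conv_rhs => rw [← mul_one (ρ (antipode K _)), ← h1]
  rw [Finset.mul_sum, Finset.sum_mul]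
  simp only [mul_assoc]

lemma DD.trace (h : DD b L lam ρ y τ) (I : Ints K L lam) (z : D) :
    LinearMap.trace K D (LinearMap.mulLeft K z) = (Module.finrank K H : K) * τ z := by
  haveI := h.fin
  have h1 : lam L • LinearMap.mulLeft K z = ∑ i ∈ (ℛ K L).index, ∑ j,
      ((τ ∘ₗ LinearMap.mulRight K (yf b y (lam ∘ₗ LinearMap.mulLeft K (antipode K (b j))) *
      ρ ((ℛ K L).left i))).smulRight (z * (ρ (antipode K ((ℛ K L).right i)) * y j))) := by
    ext w
    have := congrArg (fun x => z * x) (h.dual I w)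
    simp only [Finset.mul_sum, mul_smul_comm] at this
    simp only [LinearMap.sum_apply, LinearMap.smulRight_apply, LinearMap.comp_apply,
      LinearMap.mulRight_apply, LinearMap.smul_apply, LinearMap.mulLeft_apply]
    exact this.symm
  have h2 := congrArg (LinearMap.trace K D) h1
  simp only [map_smul, map_sum, LinearMap.trace_smulRight, LinearMap.comp_apply,
      LinearMap.mulRight_apply, mul_assoc z] at h2
  simp only [← map_sum, ← Finset.mul_sum] at h2
  rw [h.dual1 I, mul_one, smul_eq_mul] at h2
  linear_combination (Module.finrank K H : K) * h2 - LinearMap.trace K D (LinearMap.mulLeft K z) * I.lamL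

lemma DD.semisimple (h : DD b L lam ρ y τ) (I : Ints K L lam) : IsSemisimpleRing D := by
  haveI := h.fin
  haveI : IsArtinianRing D := IsArtinianRing.of_finite K D
  rw [IsArtinianRing.isSemisimpleRing_iff_jacobson, eq_bot_iff]
  intro z hz
  refine (Submodule.mem_bot D).mpr (h.nondeg I fun w => ?_)
  have h1 : z * w ∈ Ring.jacobson D := Ideal.mul_mem_right _ _ hz
  have h2 : IsNilpotent (z * w) := by
    obtain ⟨n, hn⟩ := IsArtinianRing.isNilpotent_jacobson_bot (R := D)
    refine ⟨n, ?_⟩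
    have := Ideal.pow_mem_pow h1 n
    rw [← Ideal.jacobson_bot] at this
    rw [hn] at this
    simpa using this
  have h3 : IsNilpotent (LinearMap.mulLeft K (z * w)) := h2.map (Algebra.lmul K D)
  have h4 := (LinearMap.isNilpotent_trace_of_isNilpotent h3).eq_zero
  rw [h.trace I] at h4
  exact (mul_eq_zero.mp h4).resolve_left I.d_ne

end
end HE
end
noncomputable section
open TensorProduct Coalgebra WithConv HopfAlgebra
set_option linter.all false
namespace HE

variable {K H B B1 B2 C ι : Type*} [CommRing K] [Ring H] [HopfAlgebra K H] [Ring B] [Algebra K B]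
  [Ring B1] [Algebra K B1] [Ring B2] [Algebra K B2]
  [Ring C] [Algebra K C] [Fintype ι] {b : Module.Basis ι K H}

section two
variable {r1 : H →ₐ[K] B1} {y1 : ι → B1} {r2 : H →ₐ[K] B2} {y2 : ι → B2}
  {j1 : B1 →ₐ[K] C} {j2 : B2 →ₐ[K] C} {i : H →ₐ[K] C}

lemma qybe (h1 : YD b r1 y1) (h2 : YD b r2 y2) (hc : ∀ x z, Commute (j1 x) (j2 z))
    (hi1 : ∀ x z, Commute (i x) (j1 z)) (hi2 : ∀ x z, Commute (i x) (j2 z)) :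
    pr b (fun k => j1 (y1 k)) (cv i) * pr b (fun k => j2 (y2 k)) (cv i) *
      pr b (fun k => j2 (y2 k)) (cv (j1.comp r1)) =
    pr b (fun k => j2 (y2 k)) (cv (j1.comp r1)) * pr b (fun k => j2 (y2 k)) (cv i) *
      pr b (fun k => j1 (y1 k)) (cv i) := by
  have ya2 := h2.ya.map j2
  have e1 : pr b (fun k => j2 (y2 k)) (cv i) * pr b (fun k => j2 (y2 k)) (cv (j1.comp r1)) =
    pr b (fun k => j2 (y2 k)) (cv i * cv (j1.comp r1)) :=
    ya2.pr_mul _ _ (fun k x => (hc (r1 x) (y2 k)).symm)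
  have e2 : pr b (fun k => j2 (y2 k)) (cv (j1.comp r1)) * pr b (fun k => j2 (y2 k)) (cv i) =
    pr b (fun k => j2 (y2 k)) (cv (j1.comp r1) * cv i) :=
    ya2.pr_mul _ _ (fun k x => (hi2 x (y2 k)).symm)
  rw [mul_assoc, e1, e2]
  have h3 := h1.amb i j1 hi1
  have lem : ∀ z : C, (∀ k, z * (cv i * cv (j1.comp r1)) (b k) * j2 (y2 k) = (cv (j1.comp r1) * cv i) (b k) * j2 (y2 k) * z) →
      z * pr b (fun k => j2 (y2 k)) (cv i * cv (j1.comp r1)) =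
      pr b (fun k => j2 (y2 k)) (cv (j1.comp r1) * cv i) * z := by
    intro z hz
    rw [pr, pr, Finset.mul_sum, Finset.sum_mul]
    refine Finset.sum_congr rfl fun k _ => ?_
    rw [← hz, mul_assoc]
  refine lem _ fun k => ?_
  have h4 := congrArg (fun f : WithConv (H →ₗ[K] C) => f.ofConv (b k)) h3
  have h5 : pr b (fun k => j1 (y1 k)) (cv i) * (cv i * cv (j1.comp r1)) (b k) =
    (cv (j1.comp r1) * cv i) (b k) * pr b (fun k => j1 (y1 k)) (cv i) := h4
  rw [h5, mul_assoc, mul_assoc]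
  congr 1
  refine Commute.eq (Commute.sum_left _ _ _ fun l _ => Commute.mul_left (hi2 _ _) (hc _ _))

/-- `Q = R R₂₁` -/
def Qm (b : Module.Basis ι K H) (r1 : H →ₐ[K] B1) (y1 : ι → B1) (r2 : H →ₐ[K] B2) (y2 : ι → B2)
    (j1 : B1 →ₐ[K] C) (j2 : B2 →ₐ[K] C) : C :=
  pr b (fun k => j2 (y2 k)) (cv (j1.comp r1)) * pr b (fun k => j1 (y1 k)) (cv (j2.comp r2))

lemma Qm_r (h1 : YD b r1 y1) (h2 : YD b r2 y2) (hc : ∀ x z, Commute (j1 x) (j2 z)) :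
    lmc (Qm b r1 y1 r2 y2 j1 j2) (cv (j2.comp r2) * cv (j1.comp r1)) =
      rmc (cv (j2.comp r2) * cv (j1.comp r1)) (Qm b r1 y1 r2 y2 j1 j2) := by
  have e1 := h2.amb (j1.comp r1) j2 (fun x z => hc _ _)
  have e2 := h1.amb (j2.comp r2) j1 (fun x z => (hc _ _).symm)
  have ll : ∀ (z w : C) (f : WithConv (H →ₗ[K] C)), lmc (z * w) f = lmc z (lmc w f) := by
    intro z w f; ext x; simp [mul_assoc]
  have rr : ∀ (z w : C) (f : WithConv (H →ₗ[K] C)), rmc f (z * w) = rmc (rmc f z) w := by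
    intro z w f; ext x; simp [mul_assoc]
  have lr : ∀ (z w : C) (f : WithConv (H →ₗ[K] C)), lmc z (rmc f w) = rmc (lmc z f) w := by
    intro z w f; ext x; simp [mul_assoc]
  rw [Qm, ll, e2, lr, e1, ← rr]

lemma Qm_y (h1 : YD b r1 y1) (h2 : YD b r2 y2) (hc : ∀ x z, Commute (j1 x) (j2 z))
    (hi1 : ∀ x z, Commute (i x) (j1 z)) (hi2 : ∀ x z, Commute (i x) (j2 z)) :
    Qm b r1 y1 r2 y2 j1 j2 * (pr b (fun k => j1 (y1 k)) (cv i) * pr b (fun k => j2 (y2 k)) (cv i)) =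
     (pr b (fun k => j1 (y1 k)) (cv i) * pr b (fun k => j2 (y2 k)) (cv i)) *
      Qm b r1 y1 r2 y2 j1 j2 := by
  have e1 := qybe h1 h2 hc hi1 hi2
  have e2 := qybe h2 h1 (fun x z => (hc z x).symm) hi2 hi1
  rw [Qm]
  simp only [← mul_assoc] at e1 e2 ⊢
  rw [e1]
  simp only [mul_assoc] at e1 e2 ⊢
  rw [e2]

/-- `P = id ⊗ τ` -/
structure PT (j1 : B1 →ₐ[K] C) (j2 : B2 →ₐ[K] C) (P : C →ₗ[K] B1) : Prop where
  l : ∀ a z, P (j1 a * z) = a * P z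
  r : ∀ a z, P (z * j1 a) = P z * a
  t : ∀ c z, P (j2 c * z) = P (z * j2 c)

lemma PQ_r (S2 : ∀ x : H, antipode K (antipode K x) = x)
    (h1 : YD b r1 y1) (h2 : YD b r2 y2) (hc : ∀ x z, Commute (j1 x) (j2 z))
    {P : C →ₗ[K] B1} (hP : PT j1 j2 P) (x : H) :
    Commute (P (Qm b r1 y1 r2 y2 j1 j2)) (r1 x) := by
  set Q := Qm b r1 y1 r2 y2 j1 j2
  have e := Qm_r h1 h2 hc
  have e1 : rmc (cv (j1.comp r1)) Q = cvS (j2.comp r2) * lmc Q (cv (j2.comp r2) * cv (j1.comp r1)) := by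
    rw [e, mul_rmc, ← mul_assoc, cvS_cv, one_mul]
  have e2 := congrArg (fun f : WithConv (H →ₗ[K] C) => P (f.ofConv x)) e1
  change P (rmc (cv (j1.comp r1)) Q x) = P ((cvS (j2.comp r2) * lmc Q (cv (j2.comp r2) * cv (j1.comp r1))) x) at e2
  rw [rmc_apply] at e2
  change P (j1 (r1 x) * Q) = _ at e2
  rw [hP.l, ← lmc_mul, ← mul_assoc] at e2
  refine Eq.symm (e2.trans ?_)
  rw [(ℛ K x).convMul_apply, map_sum]
  have e3 : ∀ x, P ((cvS (j2.comp r2) * lmc Q (cv (j2.comp r2))) x) = (counit (R := K) x) • P Q := by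
    intro x
    rw [(ℛ K x).convMul_apply, map_sum]
    have : ∀ i, P (cvS (j2.comp r2) ((ℛ K x).left i) * (lmc Q (cv (j2.comp r2))) ((ℛ K x).right i)) =
        P (Q * j2 (r2 ((ℛ K x).right i * antipode K ((ℛ K x).left i)))) := by
      intro i
      change P (j2 (r2 (antipode K ((ℛ K x).left i))) * (Q * j2 (r2 ((ℛ K x).right i)))) = _
      rw [hP.t, map_mul r2, map_mul j2, mul_assoc]
    simp only [this]
    rw [← map_sum, ← Finset.mul_sum, ← map_sum, ← map_sum, skew2 S2, AlgHom.commutes, AlgHom.commutes,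
      ← Algebra.commutes, ← Algebra.smul_def, map_smul]
  have e4 : ∀ i, P ((cvS (j2.comp r2) * lmc Q (cv (j2.comp r2))) ((ℛ K x).left i) *
      cv (j1.comp r1) ((ℛ K x).right i)) = P Q * r1 (counit (R := K) ((ℛ K x).left i) • (ℛ K x).right i) := by
    intro i
    change P (_ * j1 (r1 _)) = _
    rw [hP.r, e3, map_smul, smul_mul_assoc, mul_smul_comm]
  simp only [e4]
  rw [← Finset.mul_sum, ← map_sum, sum_counit_smul]

lemma PT.big {P : C →ₗ[K] B1} (hP : PT j1 j2 P) :
    PT (Algebra.TensorProduct.map (AlgHom.id K H) j1 : H ⊗[K] B1 →ₐ[K] H ⊗[K] C)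
     ((Algebra.TensorProduct.includeRight : C →ₐ[K] H ⊗[K] C).comp j2) (P.lTensor H) := by
  refine ⟨fun a z => ?_, fun a z => ?_, fun c z => ?_⟩
  · induction z with
    | zero => simp
    | add x y hx hy => simp only [mul_add, map_add, hx, hy]
    | tmul h z =>
      induction a with
      | zero => simp
      | add x y hx hy => simp only [add_mul, map_add, hx, hy]
      | tmul g a => simp [hP.l]
  · induction z with
    | zero => simp
    | add x y hx hy => simp only [add_mul, map_add, hx, hy]
    | tmul h z =>
      induction a with
      | zero => simp
      | add x y hx hy => simp only [mul_add, map_add, hx, hy]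
      | tmul g a => simp [hP.r]
  · induction z with
    | zero => simp
    | add x y hx hy => simp only [mul_add, add_mul, map_add, hx, hy]
    | tmul h z => simp [hP.t]

lemma PQ_y (S2 : ∀ x : H, antipode K (antipode K x) = x)
    (h1 : YD b r1 y1) (h2 : YD b r2 y2) (hc : ∀ x z, Commute (j1 x) (j2 z))
    {P : C →ₗ[K] B1} (hP : PT j1 j2 P) (k : ι) :
    Commute (P (Qm b r1 y1 r2 y2 j1 j2)) (y1 k) := by
  set Q := Qm b r1 y1 r2 y2 j1 j2 with hQ
  let iR : C →ₐ[K] H ⊗[K] C := Algebra.TensorProduct.includeRight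
  let i : H →ₐ[K] H ⊗[K] C := Algebra.TensorProduct.includeLeft
  have hi : ∀ x z, Commute (i x) (iR z) := fun x z => by simp [Commute, SemiconjBy, i, iR]
  have e := Qm_y (j1 := iR.comp j1) (j2 := iR.comp j2) (i := i) h1 h2
    (fun x z => (hc x z).map iR) (fun x z => hi _ _) (fun x z => hi _ _)
  have eQ : Qm b r1 y1 r2 y2 (iR.comp j1) (iR.comp j2) = iR Q := by
    rw [hQ, Qm, Qm, map_mul, map_pr, map_pr]; rfl
  rw [eQ] at e
  have A2 := h2.toAmb i (iR.comp j2) (fun x z => hi _ _)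
  set Y1 := pr b (fun k => (iR.comp j1) (y1 k)) (cv i) with hY1
  set Y2 := pr b (fun k => (iR.comp j2) (y2 k)) (cv i) with hY2
  set Y2' := pr b (fun k => (iR.comp j2) (y2 k)) (cvS i) with hY2'
  have e5 : Y2 * Y2' = 1 := A2.Y_Yinv
  have e1 : iR Q * Y1 = Y1 * (Y2 * iR Q * Y2') := by
    calc iR Q * Y1 = iR Q * (Y1 * Y2) * Y2' := by rw [mul_assoc, mul_assoc, e5, mul_one]
    _ = _ := by rw [e]; simp only [mul_assoc]
  set P' := P.lTensor H
  have hP' : PT (Algebra.TensorProduct.map (AlgHom.id K H) j1 : H ⊗[K] B1 →ₐ[K] H ⊗[K] C)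
    (iR.comp j2) P' := hP.big
  let Z := pr b (fun k => (1:H) ⊗ₜ[K] y1 k) (iL K H B1)
  have eZ : Y1 = Algebra.TensorProduct.map (AlgHom.id K H) j1 Z := by
    simp [hY1, Z, pr, iR, i]
  have e2 : P' (Y2 * iR Q * Y2') = P' (iR Q) := by
    have : ∀ p q, P' (i (b p) * (iR.comp j2) (y2 p) * iR Q * (i (antipode K (b q)) * (iR.comp j2) (y2 q))) =
        P' (iR Q * (i (b p * antipode K (b q)) * ((iR.comp j2) (y2 q) * (iR.comp j2) (y2 p)))) := by
      intro p q
      have c1 : i (b p) * (iR.comp j2) (y2 p) * iR Q * (i (antipode K (b q)) * (iR.comp j2) (y2 q)) =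
        (iR.comp j2) (y2 p) * (iR Q * (i (b p * antipode K (b q)) * (iR.comp j2) (y2 q))) := by
        simp [i, iR, mul_assoc]
      rw [c1, hP'.t]
      simp only [mul_assoc]
    rw [hY2, hY2', pr, pr]
    simp only [Finset.sum_mul, Finset.mul_sum, map_sum]
    have e6 := A2.ya.skew2 S2 i
    conv_rhs => rw [← mul_one (iR Q), ← e6, Finset.mul_sum, map_sum]
    simp only [Finset.mul_sum, map_sum]
    refine Finset.sum_congr rfl fun p _ => Finset.sum_congr rfl fun q _ => ?_
    exact this q p
  have e3 := congrArg P' e1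
  rw [eZ, hP'.r, hP'.l, e2] at e3
  have e4 : P' (iR Q) = (1:H) ⊗ₜ P Q := by simp [P', iR]
  rw [e4] at e3
  have c1 := contract (b := b) k y1 (P Q) 1
  have c2 := contract (b := b) k y1 1 (P Q)
  have e7 : (1:H) ⊗ₜ[K] (P Q) * (Z * (1:H) ⊗ₜ[K] (1:B1)) = (1:H) ⊗ₜ[K] (1:B1) * (Z * (1:H) ⊗ₜ[K] (P Q)) := by
    rw [← Algebra.TensorProduct.one_def, mul_one, one_mul, e3]
  rw [e7, c2, one_mul, mul_one] at c1
  exact c1.symm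
end two
end HE
end
noncomputable section
open TensorProduct Coalgebra WithConv HopfAlgebra
set_option linter.all false
namespace HE

variable {K H B B1 B2 C ι : Type*} [CommRing K] [Ring H] [HopfAlgebra K H] [Ring B] [Algebra K B]
  [Ring B1] [Algebra K B1] [Ring B2] [Algebra K B2]
  [Ring C] [Algebra K C] [Fintype ι] {b : Module.Basis ι K H}

def ch (b : Module.Basis ι K H) (ρ : H →ₐ[K] B) (y : ι → B) (τ : B →ₗ[K] K) :
    WithConv (H →ₗ[K] H) :=
  toConv (∑ l, (τ ∘ₗ LinearMap.mulLeft K (y l) ∘ₗ ρ.toLinearMap).smulRight (antipode K (b l)))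

lemma ch_apply (ρ : H →ₐ[K] B) (y : ι → B) (τ : B →ₗ[K] K) (x : H) :
    ch b ρ y τ x = ∑ l, τ (y l * ρ x) • antipode K (b l) := by
  simp [ch]

lemma ch_sum {κ : Type*} (s : Finset κ) (ρ : H →ₐ[K] B) (y : ι → B) (t : κ → B →ₗ[K] K) (c : κ → K) :
    ch b ρ y (∑ i ∈ s, c i • t i) = ∑ i ∈ s, c i • ch b ρ y (t i) := by
  ext x
  change _ = (∑ i ∈ s, c i • ch b ρ y (t i)).ofConv x
  rw [ch_apply, ofConv_sum, LinearMap.sum_apply]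
  simp only [LinearMap.sum_apply, LinearMap.smul_apply, ofConv_smul, Finset.sum_smul, ch_apply, Finset.smul_sum]
  rw [Finset.sum_comm]
  simp [smul_smul]

lemma ch_map (β : B →ₐ[K] C) (ρ : H →ₐ[K] B) (y : ι → B) (τ : C →ₗ[K] K) :
    ch b (β.comp ρ) (fun k => β (y k)) τ = ch b ρ y (τ ∘ₗ β.toLinearMap) := by
  ext x
  simp [ch_apply]

def idT (B1 : Type*) {B2 : Type*} [Ring B1] [Algebra K B1] [Ring B2] [Algebra K B2]
    (τ : B2 →ₗ[K] K) : B1 ⊗[K] B2 →ₗ[K] B1 :=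
  TensorProduct.lift ((LinearMap.lsmul K B1).flip.compl₂ τ)
lemma idT_tmul (τ : B2 →ₗ[K] K) (T : B1) (x : B2) : idT B1 τ (T ⊗ₜ x) = τ x • T := rfl

lemma idT_PT {τ : B2 →ₗ[K] K} (hτ : ∀ z w, τ (z * w) = τ (w * z)) :
    PT (Algebra.TensorProduct.includeLeft : B1 →ₐ[K] B1 ⊗[K] B2)
      (Algebra.TensorProduct.includeRight) (idT B1 τ) := by
  refine ⟨fun a z => ?_, fun a z => ?_, fun a z => ?_⟩
  · induction z with
    | zero => simp
    | add x y hx hy => simp only [mul_add, add_mul, map_add, hx, hy]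
    | tmul h z => simp [idT_tmul]
  · induction z with
    | zero => simp
    | add x y hx hy => simp only [mul_add, add_mul, map_add, hx, hy]
    | tmul h z => simp [idT_tmul]
  · induction z with
    | zero => simp
    | add x y hx hy => simp only [mul_add, add_mul, map_add, hx, hy]
    | tmul h z => simp [idT_tmul, hτ a z]

lemma iLR_comm (x : B1) (z : B2) : Commute
  ((Algebra.TensorProduct.includeLeft : B1 →ₐ[K] B1 ⊗[K] B2) x)
   ((Algebra.TensorProduct.includeRight : B2 →ₐ[K] B1 ⊗[K] B2) z) := by
  simp [Commute, SemiconjBy]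

variable {r1 : H →ₐ[K] B1} {y1 : ι → B1} {r2 : H →ₐ[K] B2} {y2 : ι → B2}

lemma GG_ch (S2 : ∀ x : H, antipode K (antipode K x) = x) (τ : B2 →ₗ[K] K) :
    GG b r1 y1 (ch b r2 y2 τ) = idT B1 τ (Qm b r1 y1 r2 y2
      (Algebra.TensorProduct.includeLeft : B1 →ₐ[K] B1 ⊗[K] B2)
      (Algebra.TensorProduct.includeRight)) := by
  rw [Qm, pr, pr, GG, Finset.sum_mul_sum, map_sum]
  simp only [ch_apply, map_sum, Finset.sum_mul, map_smul, S2]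
  rw [Finset.sum_comm]
  refine Finset.sum_congr rfl fun l _ => Finset.sum_congr rfl fun k _ => ?_
  change _ = idT B1 τ ((r1 (b l) ⊗ₜ 1) * (1 ⊗ₜ y2 l) * ((1 ⊗ₜ r2 (b k)) * (y1 k ⊗ₜ 1)))
  simp [idT_tmul]

lemma GG_ch_r (S2 : ∀ x : H, antipode K (antipode K x) = x) {τ : B2 →ₗ[K] K}
    (hτ : ∀ z w, τ (z * w) = τ (w * z)) (h1 : YD b r1 y1) (h2 : YD b r2 y2) (x : H) :
    Commute (GG b r1 y1 (ch b r2 y2 τ)) (r1 x) := by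
  rw [GG_ch S2]
  exact PQ_r S2 h1 h2 iLR_comm (idT_PT hτ) x

lemma GG_ch_y (S2 : ∀ x : H, antipode K (antipode K x) = x) {τ : B2 →ₗ[K] K}
    (hτ : ∀ z w, τ (z * w) = τ (w * z)) (h1 : YD b r1 y1) (h2 : YD b r2 y2) (k : ι) :
    Commute (GG b r1 y1 (ch b r2 y2 τ)) (y1 k) := by
  rw [GG_ch S2]
  exact PQ_y S2 h1 h2 iLR_comm (idT_PT hτ) k

/-! tensor -/
section tensor
variable {j1 : B1 →ₐ[K] C} {j2 : B2 →ₐ[K] C}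

def yT (b : Module.Basis ι K H) (y1 : ι → B1) (y2 : ι → B2) (j1 : B1 →ₐ[K] C) (j2 : B2 →ₐ[K] C)
    (k : ι) : C := ∑ p, ∑ q, b.coord k (b q * b p) • (j1 (y1 p) * j2 (y2 q))

lemma sum_yT {M : Type*} [AddCommGroup M] [Module K M] (T : H →ₗ[K] C →ₗ[K] M) :
    ∑ k, T (b k) (yT b y1 y2 j1 j2 k) = ∑ p, ∑ q, T (b q * b p) (j1 (y1 p) * j2 (y2 q)) := by
  simp only [yT, map_sum, map_smul]
  rw [Finset.sum_comm]
  refine Finset.sum_congr rfl fun p _ => ?_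
  rw [Finset.sum_comm]
  refine Finset.sum_congr rfl fun q _ => ?_
  have h5 := congrArg (fun z => T z (j1 (y1 p) * j2 (y2 q))) (b.sum_repr (b q * b p))
  simp only [map_sum, map_smul, LinearMap.sum_apply, LinearMap.smul_apply] at h5
  exact h5

lemma yf_yT (φ : H →ₗ[K] K) : yf b (yT b y1 y2 j1 j2) φ =
    ∑ p, ∑ q, φ (b q * b p) • (j1 (y1 p) * j2 (y2 q)) :=
  sum_yT (b := b) (LinearMap.lsmul K C ∘ₗ φ)

lemma YA.tens (h1 : YA b y1) (h2 : YA b y2) (hc : ∀ x z, Commute (j1 x) (j2 z)) :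
    YA b (yT b y1 y2 j1 j2) := by
  constructor
  · intro φ ψ
    rw [yf_yT, yf_yT, yf_yT]
    have e1 : ∀ l, ∑ k, (toConv φ * toConv ψ).ofConv (b l * b k) • (j1 (y1 k) * j2 (y2 l)) = 
       ∑ p, ∑ q, ((LinearMap.mul' K K ∘ₗ TensorProduct.map φ ψ) (comul (b l) * (b p ⊗ₜ b q))) •
         (j1 (y1 p) * j1 (y1 q) * j2 (y2 l)) := by
      intro l
      have := (h1.map j1).split ((LinearMap.lsmul K (C →ₗ[K] C)).flip (LinearMap.mulRight K (j2 (y2 l))) ∘ₗ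
        ((LinearMap.mul' K K ∘ₗ TensorProduct.map φ ψ) ∘ₗ LinearMap.mulLeft K (comul (b l))))
      refine Eq.trans ?_ this
      refine Finset.sum_congr rfl fun k _ => ?_
      simp only [LinearMap.comp_apply, LinearMap.mulLeft_apply, ← Bialgebra.comul_mul]
      rfl
    have e2 : ∀ p q, ∑ l, ((LinearMap.mul' K K ∘ₗ TensorProduct.map φ ψ) (comul (b l) * (b p ⊗ₜ b q))) •
         (j1 (y1 p) * j1 (y1 q) * j2 (y2 l)) = ∑ r, ∑ s, (φ (b r * b p) * ψ (b s * b q)) •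
         (j1 (y1 p) * j1 (y1 q) * (j2 (y2 r) * j2 (y2 s))) := by
      intro p q
      have := (h2.map j2).split ((LinearMap.lsmul K (C →ₗ[K] C)).flip (LinearMap.mulLeft K (j1 (y1 p) * j1 (y1 q))) ∘ₗ
        ((LinearMap.mul' K K ∘ₗ TensorProduct.map φ ψ) ∘ₗ LinearMap.mulRight K (b p ⊗ₜ b q)))
      refine Eq.trans ?_ (this.trans ?_)
      · rfl
      · refine Finset.sum_congr rfl fun k _ => Finset.sum_congr rfl fun k _ => ?_
        simp [mul_assoc]
    rw [Finset.sum_comm (f := fun p q => (toConv φ * toConv ψ).ofConv (b q * b p) • _)]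
    rw [Finset.sum_congr rfl fun l _ => e1 l]
    refine Eq.symm ((Finset.sum_comm.trans (Finset.sum_congr rfl fun p _ =>
      Finset.sum_comm.trans (Finset.sum_congr rfl fun q _ => e2 p q))).trans ?_)
    symm
    rw [Finset.sum_mul_sum]
    refine Finset.sum_congr rfl fun p _ => Finset.sum_congr rfl fun q _ => ?_
    rw [Finset.sum_mul_sum]
    refine Finset.sum_congr rfl fun r _ => Finset.sum_congr rfl fun s _ => ?_
    rw [smul_mul_smul_comm]
    congr 1
    simp only [mul_assoc]
    rw [← mul_assoc (j2 _) (j1 _), ← (hc _ _).eq, mul_assoc]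
  · rw [yf_yT]
    have e1 := h1.y2
    have e2 := h2.y2
    have := congrArg₂ (fun a c => j1 a * j2 c) e1 e2
    simp only [yf, map_sum, map_smul, map_one, mul_one, Finset.sum_mul_sum] at this
    rw [← this]
    refine Finset.sum_congr rfl fun p _ => ?_
    refine Finset.sum_congr rfl fun q _ => ?_
    rw [smul_mul_smul_comm, Bialgebra.counit_mul, mul_comm]

lemma YD.tens (h1 : YD b r1 y1) (h2 : YD b r2 y2) (hc : ∀ x z, Commute (j1 x) (j2 z)) :
    YD b (mulHom (j1.comp r1) (j2.comp r2) (fun x z => hc _ _)) (yT b y1 y2 j1 j2) := by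
  have ya := h1.ya.tens h2.ya hc
  refine ⟨ya.y1, ya.y2, fun h => ?_⟩
  let iR' : C →ₐ[K] H ⊗[K] C := Algebra.TensorProduct.includeRight
  let i : H →ₐ[K] H ⊗[K] C := Algebra.TensorProduct.includeLeft
  have hi : ∀ x z, Commute (i x) (iR' z) := fun x z => by simp [Commute, SemiconjBy, i, iR']
  have A1 := h1.amb i (iR'.comp j1) (fun x z => hi _ _)
  have A2 := h2.amb i (iR'.comp j2) (fun x z => hi _ _)
  set Y1 := pr b (fun k => (iR'.comp j1) (y1 k)) (cv i) with hY1
  set Y2 := pr b (fun k => (iR'.comp j2) (y2 k)) (cv i) with hY2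
  have eY : pr b (fun k => (1:H) ⊗ₜ[K] yT b y1 y2 j1 j2 k) (iL K H C) = Y2 * Y1 := by
    have e1 : pr b (fun k => (1:H) ⊗ₜ[K] yT b y1 y2 j1 j2 k) (iL K H C) =
      ∑ k, TensorProduct.mk K H C (b k) (yT b y1 y2 j1 j2 k) := by simp [pr]
    rw [e1, sum_yT, hY1, hY2, pr, pr, Finset.sum_mul_sum, Finset.sum_comm]
    refine Finset.sum_congr rfl fun p _ => Finset.sum_congr rfl fun q _ => ?_
    simp [i, iR', (hc _ _).eq]
  rw [eY]
  let R1 : WithConv (H →ₗ[K] H ⊗[K] C) := cv ((iR'.comp j1).comp r1)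
  let R2 : WithConv (H →ₗ[K] H ⊗[K] C) := cv ((iR'.comp j2).comp r2)
  have eR : iR (mulHom (j1.comp r1) (j2.comp r2) (fun x z => hc _ _)) = R1 * R2 := by
    exact (congrArg (post iR') (cv_mulHom (j1.comp r1) (j2.comp r2) (fun x z => hc _ _))).trans
      (map_mul (post iR') _ _)
  rw [eR]
  change lmc Y1 (cv i * R1) = rmc (R1 * cv i) Y1 at A1
  change lmc Y2 (cv i * R2) = rmc (R2 * cv i) Y2 at A2
  have c1 : lmc Y1 R2 = rmc R2 Y1 := by
    ext x
    exact Commute.eq (Commute.sum_left _ _ _ fun k _ => Commute.mul_left (hi _ _) ((hc _ _).map iR'))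
  have c2 : lmc Y2 R1 = rmc R1 Y2 := by
    ext x
    exact Commute.eq (Commute.sum_left _ _ _ fun k _ => Commute.mul_left (hi _ _) ((hc _ _).symm.map iR'))
  have : lmc (Y2 * Y1) (cv i * (R1 * R2)) = rmc ((R1 * R2) * cv i) (Y2 * Y1) := by
    have ll : ∀ (z w : H ⊗[K] C) (f : WithConv (H →ₗ[K] H ⊗[K] C)), lmc (z * w) f = lmc z (lmc w f) := by
      intro z w f; ext x; simp [mul_assoc]
    have rr : ∀ (z w : H ⊗[K] C) (f : WithConv (H →ₗ[K] H ⊗[K] C)), rmc f (z * w) = rmc (rmc f z) w := by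
      intro z w f; ext x; simp [mul_assoc]
    have lr : ∀ (z w : H ⊗[K] C) (f : WithConv (H →ₗ[K] H ⊗[K] C)), lmc z (rmc f w) = rmc (lmc z f) w := by
      intro z w f; ext x; simp [mul_assoc]
    have k1 : lmc Y1 (cv i * R1 * R2) = rmc (R1 * cv i * R2) Y1 := by
      rw [← lmc_mul, A1, ← mul_lmc, c1, mul_rmc]
    have k2 : lmc Y2 (R1 * (cv i * R2)) = rmc (R1 * (R2 * cv i)) Y2 := by
      rw [← lmc_mul, c2, ← mul_lmc, A2, mul_rmc]
    rw [ll, ← mul_assoc, k1, lr, mul_assoc R1, k2, rr, mul_assoc]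
  exact congrArg (fun f : WithConv (H →ₗ[K] H ⊗[K] C) => f.ofConv h) this
end tensor
end HE
end
noncomputable section
open TensorProduct Coalgebra WithConv HopfAlgebra
set_option linter.all false
namespace HE

variable {K H B B1 B2 C ι : Type*} [CommRing K] [Ring H] [HopfAlgebra K H] [Ring B] [Algebra K B]
  [Ring B1] [Algebra K B1] [Ring B2] [Algebra K B2]
  [Ring C] [Algebra K C] [Fintype ι] {b : Module.Basis ι K H}
  {r1 : H →ₐ[K] B1} {y1 : ι → B1} {r2 : H →ₐ[K] B2} {y2 : ι → B2}
  {j1 : B1 →ₐ[K] C} {j2 : B2 →ₐ[K] C}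

lemma ch_tens (hc : ∀ x z, Commute (j1 x) (j2 z)) {τ : C →ₗ[K] K} {τ1 : B1 →ₗ[K] K}
    {τ2 : B2 →ₗ[K] K} (ht : ∀ x z, τ (j1 x * j2 z) = τ1 x * τ2 z) :
    ch b (mulHom (j1.comp r1) (j2.comp r2) (fun x z => hc _ _)) (yT b y1 y2 j1 j2) τ =
      ch b r1 y1 τ1 * ch b r2 y2 τ2 := by
  ext x
  rw [(ℛ K x).convMul_apply, ch_apply]
  have := sum_yT (b := b) (y1 := y1) (y2 := y2) (j1 := j1) (j2 := j2)
    ((LinearMap.lsmul K H).flip.compl₂ (τ ∘ₗ LinearMap.mulRight K (mulHom (j1.comp r1) (j2.comp r2) (fun x z => hc _ _) x)) ∘ₗ antipode K)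
  refine Eq.trans this ?_
  simp only [ch_apply, Finset.sum_mul_sum]
  symm
  rw [Finset.sum_comm]
  refine Finset.sum_congr rfl fun p _ => ?_
  rw [Finset.sum_comm]
  refine Finset.sum_congr rfl fun q _ => ?_
  change _ = τ (j1 (y1 p) * j2 (y2 q) * mulHom (j1.comp r1) (j2.comp r2) (fun x z => hc _ _) x) •
    antipode K (b q * b p)
  have hm := mulHom_repr (j1.comp r1) (j2.comp r2) (fun x z => hc _ _) (ℛ K x)
  refine Eq.trans ?_ (congrArg (fun w => τ (j1 (y1 p) * j2 (y2 q) * w) • antipode K (b q * b p)) hm).symm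
  rw [Finset.mul_sum, map_sum, Finset.sum_smul]
  refine Finset.sum_congr rfl fun i _ => ?_
  rw [smul_mul_smul_comm, ← antipode_mul_antidistrib, ← ht]
  congr 2
  simp only [map_mul, mul_assoc, AlgHom.comp_apply]
  rw [← mul_assoc (j2 _) (j1 _), ← (hc _ _).eq, mul_assoc]

/-! opposite -/
open MulOpposite

def rO (r : H →ₐ[K] B) : H →ₐ[K] Bᵐᵒᵖ :=
  AlgHom.ofLinearMap ((opLinearEquiv K).toLinearMap ∘ₗ r.toLinearMap ∘ₗ antipode K)
    (by simp) (by intro x z; simp [antipode_mul_antidistrib])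
@[simp] lemma rO_apply (r : H →ₐ[K] B) (x : H) : rO r x = op (r (antipode K x)) := rfl

def yO (b : Module.Basis ι K H) (y : ι → B) (l : ι) : Bᵐᵒᵖ :=
  ∑ k, b.coord l (antipode K (b k)) • op (y k)

lemma sum_yO {M : Type*} [AddCommGroup M] [Module K M] (y : ι → B) (T : H →ₗ[K] Bᵐᵒᵖ →ₗ[K] M) :
    ∑ l, T (b l) (yO b y l) = ∑ k, T (antipode K (b k)) (op (y k)) := by
  simp only [yO, map_sum, map_smul]
  rw [Finset.sum_comm]
  refine Finset.sum_congr rfl fun p _ => ?_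
  have h5 := congrArg (fun z => T z (op (y p))) (b.sum_repr (antipode K (b p)))
  simp only [map_sum, map_smul, LinearMap.sum_apply, LinearMap.smul_apply] at h5
  exact h5

lemma yf_yO (y : ι → B) (φ : H →ₗ[K] K) : yf b (yO b y) φ = op (yf b y (φ ∘ₗ antipode K)) := by
  refine (sum_yO (b := b) y (LinearMap.lsmul K _ ∘ₗ φ)).trans ?_
  simp [yf]

def sgO (K H B : Type*) [CommRing K] [Ring H] [HopfAlgebra K H] [Ring B] [Algebra K B] :
    H ⊗[K] B →ₗ[K] H ⊗[K] Bᵐᵒᵖ :=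
  TensorProduct.map (antipode K) (opLinearEquiv K).toLinearMap
lemma sgO_tmul (x : H) (z : B) : sgO K H B (x ⊗ₜ z) = antipode K x ⊗ₜ op z := rfl
lemma sgO_mul (z w : H ⊗[K] B) : sgO K H B (z * w) = sgO K H B w * sgO K H B z := by
  induction z with
  | zero => simp
  | add x y hx hy => simp only [mul_add, add_mul, map_add, hx, hy]
  | tmul x z =>
    induction w with
    | zero => simp
    | add x y hx hy => simp only [mul_add, add_mul, map_add, hx, hy]
    | tmul h z => simp [sgO_tmul, antipode_mul_antidistrib]

lemma conv_S {A : Type*} [Ring A] [Algebra K A] (f g : WithConv (H →ₗ[K] A)) (h : H) :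
    (f * g) (antipode K h) = ∑ i ∈ (ℛ K h).index, f (antipode K ((ℛ K h).right i)) *
      g (antipode K ((ℛ K h).left i)) := by
  rw [LinearMap.convMul_apply, antipode_anti, ← (ℛ K h).eq]
  simp

lemma YD.opp (S2 : ∀ x : H, antipode K (antipode K x) = x) {r : H →ₐ[K] B} {y : ι → B}
    (h : YD b r y) : YD b (rO r) (yO b y) := by
  refine ⟨fun φ ψ => ?_, ?_, fun x => ?_⟩
  · rw [yf_yO, yf_yO, yf_yO, ← op_mul, h.y1]
    congr 2
    ext x
    refine Eq.trans ?_ (conv_S (toConv φ) (toConv ψ) x).symm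
    refine ((ℛ K x).convMul_apply (f := toConv (ψ ∘ₗ antipode K)) (g := toConv (φ ∘ₗ antipode K))).trans ?_
    exact Finset.sum_congr rfl fun i _ => mul_comm _ _
  · rw [yf_yO]
    have : (counit (R := K) (A := H)) ∘ₗ antipode K = counit := by ext x; simp
    rw [this, h.y2]; rfl
  · rw [← S2 x]
    generalize antipode K x = x
    have eY : pr b (fun k => (1:H) ⊗ₜ[K] yO b y k) (iL K H Bᵐᵒᵖ) =
        sgO K H B (pr b (fun k => (1:H) ⊗ₜ[K] y k) (iL K H B)) := by
      have := sum_yO (b := b) y (TensorProduct.mk K H Bᵐᵒᵖ)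
      simp only [pr, map_sum]
      refine Eq.trans ?_ (this.trans ?_)
      · exact Finset.sum_congr rfl fun k _ => by simp
      · exact Finset.sum_congr rfl fun k _ => by simp [sgO_tmul]
    have e1 : (iL K H Bᵐᵒᵖ * iR (rO r)) (antipode K x) = sgO K H B ((iR r * iL K H B) x) := by
      rw [conv_S, (ℛ K x).convMul_apply, map_sum]
      exact Finset.sum_congr rfl fun i _ => by simp [sgO_tmul, S2]
    have e2 : (iR (rO r) * iL K H Bᵐᵒᵖ) (antipode K x) = sgO K H B ((iL K H B * iR r) x) := by
      rw [conv_S, (ℛ K x).convMul_apply, map_sum]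
      exact Finset.sum_congr rfl fun i _ => by simp [sgO_tmul, S2]
    rw [eY, e1, e2, ← sgO_mul, ← sgO_mul, h.y3]

def chS (f : WithConv (H →ₗ[K] H)) : WithConv (H →ₗ[K] H) :=
  toConv (antipode K ∘ₗ f.ofConv ∘ₗ antipode K)
lemma chS_apply (f : WithConv (H →ₗ[K] H)) (x : H) : chS f x = antipode K (f (antipode K x)) := rfl

lemma ch_opp {r : H →ₐ[K] B} {y : ι → B} {τ : B →ₗ[K] K} (hτ : ∀ z w, τ (z * w) = τ (w * z)) :
    ch b (rO r) (yO b y) (τ ∘ₗ (opLinearEquiv K).symm.toLinearMap) = chS (ch b r y τ) := by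
  ext x
  rw [ch_apply, chS_apply, ch_apply]
  have := sum_yO (b := b) y ((LinearMap.lsmul K H).flip.compl₂ ((τ ∘ₗ (opLinearEquiv K).symm.toLinearMap) ∘ₗ LinearMap.mulRight K (rO r x)) ∘ₗ antipode K)
  refine Eq.trans this ?_
  rw [map_sum]
  refine Finset.sum_congr rfl fun k _ => ?_
  rw [map_smul, hτ]
  rfl
end HE
end
noncomputable section
open TensorProduct Coalgebra WithConv HopfAlgebra
set_option linter.all false
namespace HE

/-- tracial functional with natural values on idempotents -/
structure GT {K B : Type*} [Field K] [Ring B] [Algebra K B] (t : B →ₗ[K] K) : Prop where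
  tr : ∀ z w, t (z * w) = t (w * z)
  id : ∀ p, p * p = p → ∃ m : ℕ, t p = m

variable {K B C D : Type*} [Field K] [Ring B] [Algebra K B] [Ring C] [Algebra K C] [Ring D] [Algebra K D]

lemma GT.end {V : Type*} [AddCommGroup V] [Module K V] [FiniteDimensional K V] :
    GT (LinearMap.trace K V : Module.End K V →ₗ[K] K) :=
  ⟨fun z w => LinearMap.trace_mul_comm K z w, fun p hp => ⟨_, trace_idem p hp⟩⟩

lemma GT.comp {t : C →ₗ[K] K} (h : GT t) (f : B →ₐ[K] C) : GT (t ∘ₗ f.toLinearMap) :=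
  ⟨fun z w => by simp [h.tr (f z)], fun p hp => h.id (f p) (by rw [← map_mul, hp])⟩

lemma GT.opp {t : B →ₗ[K] K} (h : GT t) :
    GT (t ∘ₗ (MulOpposite.opLinearEquiv K).symm.toLinearMap) :=
  ⟨fun z w => h.tr _ _, fun p hp => h.id _ (congrArg MulOpposite.unop hp)⟩

structure Wed {J : Type*} [Fintype J] (v : J → ℕ) (π : ∀ j, D →ₐ[K] Module.End K (Fin (v j) → K))
    (E : J → D) : Prop where
  v0 : ∀ j, v j ≠ 0
  tr : ∀ z, LinearMap.trace K D (LinearMap.mulLeft K z) = ∑ j, (v j : K) * LinearMap.trace K _ (π j z)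
  E0 : ∀ j, π j (E j) = 1
  E1 : ∀ j i, i ≠ j → π i (E j) = 0
  inj : ∀ z w, (∀ j, π j z = π j w) → z = w
  cen : ∀ z, (∀ w, Commute z w) → ∀ j, ∃ c : K, π j z = c • 1
  dec : ∀ t : D →ₗ[K] K, GT t → ∃ N : J → ℕ, t = ∑ j, (N j : K) • (LinearMap.trace K _ ∘ₗ (π j).toLinearMap)

lemma mat_dec {n : ℕ} [NeZero n] (s : Matrix (Fin n) (Fin n) K →ₗ[K] K)
    (hs : ∀ z w, s (z * w) = s (w * z)) :
    s = s (Matrix.single 0 0 1) • Matrix.traceLinearMap (Fin n) K K := by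
  refine Matrix.ext_linearMap K fun i j => ?_
  ext
  have h1 : Matrix.single i j (1:K) = Matrix.single i 0 1 * Matrix.single 0 j 1 := by
    rw [Matrix.single_mul_single_same, one_mul]
  simp only [LinearMap.comp_apply, Matrix.singleLinearMap_apply, LinearMap.smul_apply,
    Matrix.traceLinearMap_apply]
  by_cases hij : i = j
  · subst hij
    rw [h1, hs, Matrix.single_mul_single_same]
    simp
  · rw [h1, hs, Matrix.single_mul_single_of_ne _ _ _ _ (Ne.symm hij), map_zero, ← h1]
    rw [Matrix.trace_single_eq_of_ne _ _ _ hij]; simp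

lemma exists_wed [IsAlgClosed K] [IsSemisimpleRing D] [FiniteDimensional K D] :
    ∃ (n : ℕ) (v : Fin n → ℕ) (π : ∀ j, D →ₐ[K] Module.End K (Fin (v j) → K)) (E : Fin n → D), Wed v π E := by
  obtain ⟨n, v, hv, ⟨e⟩⟩ := IsSemisimpleRing.exists_algEquiv_pi_matrix_of_isAlgClosed K D
  let π : ∀ j, D →ₐ[K] Module.End K (Fin (v j) → K) := fun j =>
    (Matrix.toLinAlgEquiv' (R := K)).toAlgHom.comp ((Pi.evalAlgHom K _ j).comp e.toAlgHom)
  have hπ : ∀ j z, π j z = Matrix.toLin' (e z j) := fun j z => rfl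
  have ht : ∀ j z, LinearMap.trace K _ (π j z) = Matrix.trace (e z j) := fun j z => by
    rw [hπ, Matrix.trace_toLin'_eq]
  refine ⟨n, v, π, fun j => e.symm (Pi.single j 1), fun j => (hv j).out, fun z => ?_, fun j => ?_, fun j i hij => ?_,
    fun z w h => ?_, fun z hz j => ?_, fun t T => ?_⟩
  · have h1 : LinearMap.trace K D (LinearMap.mulLeft K z) = LinearMap.trace K _ (LinearMap.mulLeft K (e z)) := by
      rw [← LinearMap.trace_conj' (LinearMap.mulLeft K z) e.toLinearEquiv]
      congr 1
      ext x
      simp [LinearEquiv.conj_apply]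
    rw [h1, LinearMap.trace_eq_matrix_trace K (Pi.basis (fun i => Matrix.stdBasis K (Fin (v i)) (Fin (v i)))),
      Matrix.trace, Fintype.sum_sigma]
    refine Finset.sum_congr rfl fun j _ => ?_
    rw [ht, Fintype.sum_prod_type, Matrix.trace, Finset.mul_sum]
    refine Finset.sum_congr rfl fun a _ => ?_
    have : ∀ c, (LinearMap.toMatrix (Pi.basis fun i => Matrix.stdBasis K (Fin (v i)) (Fin (v i))) (Pi.basis fun i => Matrix.stdBasis K (Fin (v i)) (Fin (v i)))
           (LinearMap.mulLeft K (e z))).diag ⟨j, a, c⟩ = e z j a a := by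
      intro c
      rw [Matrix.diag_apply, LinearMap.toMatrix_apply, Pi.basis_repr, LinearMap.mulLeft_apply, Pi.basis_apply]
      rw [Matrix.stdBasis_eq_single]
      change ((e z * Pi.single j (Matrix.single a c 1) : ∀ i, Matrix (Fin (v i)) (Fin (v i)) K) j) a c = _
      rw [Pi.mul_apply, Pi.single_eq_same, Matrix.mul_single_apply_same, mul_one]
    rw [Finset.sum_congr rfl fun c _ => this c]
    simp
  · rw [hπ]; simp; rfl
  · rw [hπ]; simp [hij]
  · apply e.injective
    funext j
    exact (Matrix.toLin' (R := K)).injective (h j)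
  · have : e z j ∈ Set.range (Matrix.scalar (Fin (v j)) : K → Matrix (Fin (v j)) (Fin (v j)) K) := by
      refine Matrix.mem_range_scalar_of_commute_single fun a c _ => ?_
      have := (hz (e.symm (Pi.single j (Matrix.single a c 1)))).map e
      have := congrFun this.eq j
      simpa [Commute, SemiconjBy, eq_comm] using this
    obtain ⟨c, hc⟩ := this
    refine ⟨c, ?_⟩
    rw [hπ, ← hc]
    ext x k
    simp [Matrix.toLin'_apply, Pi.single_apply]
  · haveI := hv
    have key : ∀ j, ∃ N : ℕ, ∀ M : Matrix (Fin (v j)) (Fin (v j)) K, t (e.symm (Pi.single j M)) = N * M.trace := by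
      intro j
      obtain ⟨N, hN⟩ := T.id (e.symm (Pi.single j (Matrix.single 0 0 1))) (by
        rw [← map_mul, ← Pi.single_mul, Matrix.single_mul_single_same, one_mul])
      refine ⟨N, fun M => ?_⟩
      have := mat_dec (t ∘ₗ e.symm.toLinearMap ∘ₗ LinearMap.single K (fun j => Matrix (Fin (v j)) (Fin (v j)) K) j) (fun z w => by
        simp only [LinearMap.comp_apply, LinearMap.single_apply, Pi.single_mul, AlgEquiv.toLinearMap_apply, map_mul]
        exact T.tr _ _)
      have := congrArg (fun f => f M) this
      simp only [LinearMap.comp_apply, LinearMap.single_apply, AlgEquiv.toLinearMap_apply, LinearMap.smul_apply,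
         Matrix.traceLinearMap_apply, hN] at this
      exact this
    choose N hN using key
    refine ⟨N, ?_⟩
    ext z
    have h1 : z = ∑ j, e.symm (Pi.single j (e z j)) := by
      rw [← map_sum, Finset.univ_sum_single, AlgEquiv.symm_apply_apply]
    conv_lhs => rw [h1]
    rw [map_sum, LinearMap.sum_apply]
    refine Finset.sum_congr rfl fun j _ => ?_
    rw [hN]
    simp [ht]
end HE
end
noncomputable section
open TensorProduct Coalgebra WithConv HopfAlgebra
set_option linter.all false
namespace HE

section
variable {K H B ι : Type*} [CommRing K] [Ring H] [HopfAlgebra K H] [Ring B] [Algebra K B]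
  [Fintype ι] {b : Module.Basis ι K H} {ρ : H →ₐ[K] B} {y : ι → B}

def GLin (b : Module.Basis ι K H) (ρ : H →ₐ[K] B) (y : ι → B) : WithConv (H →ₗ[K] H) →ₗ[K] B where
  toFun := GG b ρ y
  map_add' f g := by
    simp only [GG, ← Finset.sum_add_distrib]
    refine Finset.sum_congr rfl fun k _ => ?_
    rw [← add_mul, ← map_add, ← map_add]; rfl
  map_smul' c f := by
    simp only [GG, Finset.smul_sum]
    refine Finset.sum_congr rfl fun k _ => ?_
    rw [← smul_mul_assoc, RingHom.id_apply, ← map_smul, ← map_smul]; rfl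
lemma GLin_apply (f : WithConv (H →ₗ[K] H)) : GLin b ρ y f = GG b ρ y f := rfl

lemma GG_sym (S2 : ∀ x : H, antipode K (antipode K x) = x) {σ τ : B →ₗ[K] K}
    (hσ : ∀ z w, σ (z * w) = σ (w * z)) (hτ : ∀ z w, τ (z * w) = τ (w * z)) :
    σ (GG b ρ y (ch b ρ y τ)) = τ (GG b ρ y (ch b ρ y σ)) := by
  simp only [GG, ch_apply, map_sum, map_smul, S2, Finset.sum_mul, smul_mul_assoc, smul_eq_mul]
  rw [Finset.sum_comm]
  refine Finset.sum_congr rfl fun k _ => Finset.sum_congr rfl fun l _ => ?_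
  rw [mul_comm, hσ, hτ]

lemma GG_symS (S2 : ∀ x : H, antipode K (antipode K x) = x) {σ τ : B →ₗ[K] K}
    (hσ : ∀ z w, σ (z * w) = σ (w * z)) (hτ : ∀ z w, τ (z * w) = τ (w * z)) :
    σ (GG b ρ y (chS (ch b ρ y τ))) = τ (GG b ρ y (chS (ch b ρ y σ))) := by
  simp only [GG, chS_apply, ch_apply, map_sum, map_smul, S2, Finset.sum_mul, smul_mul_assoc, smul_eq_mul]
  rw [Finset.sum_comm]
  refine Finset.sum_congr rfl fun k _ => Finset.sum_congr rfl fun l _ => ?_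
  rw [mul_comm, hσ, hτ]
end

variable {K H ι D J : Type*} [Field K] [CharZero K] [Ring H] [HopfAlgebra K H] [FiniteDimensional K H]
  [Fintype ι] {b : Module.Basis ι K H} {L : H} {lam : H →ₗ[K] K}
  [Ring D] [Algebra K D] {ρ : H →ₐ[K] D} {y : ι → D} {τ : D →ₗ[K] K} [Fintype J] {v : J → ℕ}
  {π : ∀ j, D →ₐ[K] Module.End K (Fin (v j) → K)} {E : J → D}

abbrev tt (π : ∀ j, D →ₐ[K] Module.End K (Fin (v j) → K)) (j : J) : D →ₗ[K] K :=
  LinearMap.trace K _ ∘ₗ (π j).toLinearMap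

lemma GT.tt (j : J) : GT (tt π j) := GT.end.comp (π j)

lemma Wed.cmul (W : Wed v π E) {z : D} (hz : ∀ w, Commute z w) (j : J) (w : D) :
    tt π j (z * w) * v j = tt π j z * tt π j w := by
  obtain ⟨c, hc⟩ := W.cen z hz j
  simp [hc]; ring

lemma DD.central (h : DD b L lam ρ y τ) {z : D} (h1 : ∀ x, Commute z (ρ x)) (h2 : ∀ k, Commute z (y k))
    (w : D) : Commute z w := by
  have : LinearMap.mulLeft K z = LinearMap.mulRight K z := by
    refine h.ext fun x φ => ?_
    exact ((h1 x).mul_right (Commute.sum_right _ _ _ fun k _ => (h2 k).smul_right _)).eq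
  exact congrArg (fun f => f w) this

lemma DD.cen_ch (h : DD b L lam ρ y τ) (I : Ints K L lam) {σ : D →ₗ[K] K}
    (hσ : ∀ z w, σ (z * w) = σ (w * z)) (w : D) : Commute (GG b ρ y (ch b ρ y σ)) w :=
  h.central (GG_ch_r I.S2 hσ h.yd h.yd) (GG_ch_y I.S2 hσ h.yd h.yd) w

lemma DD.ch_dec (h : DD b L lam ρ y τ) (I : Ints K L lam) (W : Wed v π E) {C : Type*} [Ring C] [Algebra K C]
    {ρ' : H →ₐ[K] C} {y' : ι → C} (h' : YD b ρ' y') {t : C →ₗ[K] K} (T : GT t) :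
    ∃ N : J → ℕ, ch b ρ' y' t = ∑ j, (N j : K) • ch b ρ y (tt π j) := by
  obtain ⟨θ, hθ, hy⟩ := h.yd.exists_hom I.S2 h.bij h'
  obtain ⟨N, hN⟩ := W.dec _ (T.comp θ)
  refine ⟨N, ?_⟩
  have hy' : y' = fun k => θ (y k) := funext fun k => (hy k).symm
  rw [← hθ, hy', ch_map, hN, ch_sum]

lemma DD.ch_mul (h : DD b L lam ρ y τ) (I : Ints K L lam) (W : Wed v π E) (i j : J) :
    ∃ N : J → ℕ, ch b ρ y (tt π i) * ch b ρ y (tt π j) = ∑ k, (N k : K) • ch b ρ y (tt π k) := by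
  let j1 : D →ₐ[K] D ⊗[K] D := Algebra.TensorProduct.includeLeft
  let j2 : D →ₐ[K] D ⊗[K] D := Algebra.TensorProduct.includeRight
  let P : D ⊗[K] D →ₐ[K] Module.End K ((Fin (v i) → K) ⊗[K] (Fin (v j) → K)) :=
    (Module.endTensorEndAlgHom (R := K) (S := K) (A := K)).comp (Algebra.TensorProduct.map (π i) (π j))
  have T : GT (LinearMap.trace K _ ∘ₗ P.toLinearMap) := GT.end.comp P
  obtain ⟨N, hN⟩ := h.ch_dec I W (h.yd.tens h.yd (j1 := j1) (j2 := j2) iLR_comm) T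
  refine ⟨N, hN ▸ (ch_tens iLR_comm fun x z => ?_).symm⟩
  simp only [LinearMap.comp_apply, j1, j2, P, AlgHom.toLinearMap_apply]
  rw [← LinearMap.trace_tensorProduct']
  simp
  rfl

lemma DD.ch_star (h : DD b L lam ρ y τ) (I : Ints K L lam) (W : Wed v π E) (i : J) :
    ∃ N : J → ℕ, chS (ch b ρ y (tt π i)) = ∑ k, (N k : K) • ch b ρ y (tt π k) := by
  obtain ⟨N, hN⟩ := h.ch_dec I W (h.yd.opp I.S2) (GT.tt (π := π) i).opp
  exact ⟨N, hN ▸ (ch_opp (GT.tt (π := π) i).tr).symm⟩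

/-- central character -/
def om (b : Module.Basis ι K H) (ρ : H →ₐ[K] D) (y : ι → D) (π : ∀ j, D →ₐ[K] Module.End K (Fin (v j) → K))
  (V : J) (f : WithConv (H →ₗ[K] H)) : K := tt π V (GG b ρ y f) / v V

lemma om_sum (V : J) (N : J → ℕ) (f : J → WithConv (H →ₗ[K] H)) :
    om b ρ y π V (∑ k, (N k : K) • f k) = ∑ k, (N k : K) * om b ρ y π V (f k) := by
  simp only [om, ← GLin_apply, map_sum, map_smul, Finset.sum_div, smul_eq_mul, mul_div_assoc]

lemma DD.om_mul (h : DD b L lam ρ y τ) (I : Ints K L lam) (W : Wed v π E) (V i : J) (f : WithConv (H →ₗ[K] H)) :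
    om b ρ y π V (ch b ρ y (tt π i) * f) = om b ρ y π V (ch b ρ y (tt π i)) * om b ρ y π V f := by
  have hc := h.cen_ch I (GT.tt (π := π) i).tr
  have := W.cmul hc V (GG b ρ y f)
  rw [om, h.yd.ya.GG_mul _ _ fun x => hc _, om, om, div_mul_div_comm, ← this]
  have := W.v0 V
  field_simp

lemma DD.om_int (h : DD b L lam ρ y τ) (I : Ints K L lam) (W : Wed v π E) (V i : J) :
    IsIntegral ℤ (om b ρ y π V (ch b ρ y (tt π i))) := by
  set a : J → K := fun k => om b ρ y π V (ch b ρ y (tt π k)) with ha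
  change IsIntegral ℤ (a i)
  by_cases h0 : a i = 0
  · rw [h0]; exact isIntegral_zero
  refine isIntegral_of_smul_mem_submodule (Submodule.span ℤ (Set.range a)) ?_
    (Submodule.fg_span (Set.finite_range a)) _ fun n hn => ?_
  · intro hb
    have : a i ∈ Submodule.span ℤ (Set.range a) := Submodule.subset_span ⟨i, rfl⟩
    rw [hb] at this
    exact h0 ((Submodule.mem_bot ℤ).1 this)
  · induction hn using Submodule.span_induction with
    | mem x hx =>
      obtain ⟨j, rfl⟩ := hx
      obtain ⟨N, hN⟩ := h.ch_mul I W i j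
      rw [smul_eq_mul, ha]
      simp only []
      rw [← h.om_mul I W, hN, om_sum]
      refine Submodule.sum_mem _ fun k _ => ?_
      have : (N k : K) * om b ρ y π V (ch b ρ y (tt π k)) = (N k : ℤ) • a k := by simp [ha]
      rw [this]
      exact Submodule.smul_mem _ _ (Submodule.subset_span ⟨k, rfl⟩)
    | zero => simp
    | add x z _ _ hx hz => rw [smul_add]; exact Submodule.add_mem _ hx hz
    | smul c x _ hx => rw [smul_comm]; exact Submodule.smul_mem _ _ hx

lemma DD.om_int' (h : DD b L lam ρ y τ) (I : Ints K L lam) (W : Wed v π E) (V i : J) :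
    IsIntegral ℤ (om b ρ y π V (chS (ch b ρ y (tt π i)))) := by
  obtain ⟨N, hN⟩ := h.ch_star I W i
  rw [hN, om_sum]
  refine IsIntegral.sum _ fun k _ => IsIntegral.mul ?_ (h.om_int I W V k)
  exact isIntegral_natCast _

/-! orthogonality -/
def ZZ (b : Module.Basis ι K H) (L : H) (lam : H →ₗ[K] K) (ρ : H →ₐ[K] D) (y : ι → D) (σ : D →ₗ[K] K) : D :=
  ∑ i ∈ (ℛ K L).index, yf b y (lam ∘ₗ LinearMap.mulLeft K (ch b ρ y σ (antipode K ((ℛ K L).right i)))) *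
    ρ ((ℛ K L).left i)

lemma DD.Z1 (h : DD b L lam ρ y τ) (I : Ints K L lam) {σ : D →ₗ[K] K}
    (hσ : ∀ z w, σ (z * w) = σ (w * z)) (w : D) : τ (w * ZZ b L lam ρ y σ) = lam L * σ w := by
  have := congrArg σ (h.dual I w)
  rw [map_smul, smul_eq_mul] at this
  rw [← this, ZZ, Finset.mul_sum, map_sum, map_sum]
  refine Finset.sum_congr rfl fun i _ => ?_
  rw [map_sum]
  have e : yf b y (lam ∘ₗ LinearMap.mulLeft K (ch b ρ y σ (antipode K ((ℛ K L).right i)))) =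
      ∑ j, σ (y j * ρ (antipode K ((ℛ K L).right i))) • yf b y (lam ∘ₗ LinearMap.mulLeft K (antipode K (b j))) := by
    simp only [yf, Finset.smul_sum]
    rw [Finset.sum_comm]
    refine Finset.sum_congr rfl fun k _ => ?_
    simp only [smul_smul, ← Finset.sum_smul]
    congr 1
    simp [ch_apply, Finset.sum_mul]
  rw [e, Finset.sum_mul, Finset.mul_sum, map_sum]
  refine Finset.sum_congr rfl fun j _ => ?_
  rw [map_smul, smul_mul_assoc, mul_smul_comm, map_smul, hσ (y j), smul_eq_mul, smul_eq_mul, mul_comm]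

lemma DD.Z2 (h : DD b L lam ρ y τ) (I : Ints K L lam) (σ t : D →ₗ[K] K) :
    lam ((ch b ρ y t * chS (ch b ρ y σ)) L) = t (ZZ b L lam ρ y σ) := by
  rw [(ℛ K L).convMul_apply, ZZ, map_sum, map_sum]
  refine Finset.sum_congr rfl fun i _ => ?_
  rw [chS_apply, ch_apply, Finset.sum_mul, map_sum, yf, Finset.sum_mul, map_sum]
  refine Finset.sum_congr rfl fun l _ => ?_
  rw [smul_mul_assoc, map_smul, smul_mul_assoc, map_smul, ← antipode_mul_antidistrib, I.lam_S,
    smul_eq_mul, smul_eq_mul, mul_comm]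
  rfl

lemma DD.τG (h : DD b L lam ρ y τ) (I : Ints K L lam) (f : WithConv (H →ₗ[K] H)) :
    τ (GG b ρ y f) = Module.finrank K H * lam (f L) := by
  have h5 := congrArg (fun z => lam (antipode K (f z))) (b.sum_repr L)
  simp only [map_sum, map_smul, I.lam_S] at h5
  rw [GG, map_sum, ← h5, Finset.mul_sum]
  refine Finset.sum_congr rfl fun k _ => ?_
  have := h.hy (antipode K (f (b k))) (b.coord k)
  rw [yf_coord, I.lam_S] at this
  rw [this, Module.Basis.coord_apply, smul_eq_mul]; ring

lemma DD.ortho (h : DD b L lam ρ y τ) (I : Ints K L lam) (W : Wed v π E) (V : J) :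
    tt π V (ZZ b L lam ρ y (tt π V)) = 1 := by
  have h1 := W.tr (E V * ZZ b L lam ρ y (tt π V))
  rw [h.trace I, h.Z1 I (GT.tt (π := π) V).tr, Finset.sum_eq_single V] at h1
  · have hv : (v V : K) ≠ 0 := by exact_mod_cast W.v0 V
    rw [map_mul, W.E0, one_mul, ← mul_assoc, mul_comm _ (lam L), I.lamL, one_mul] at h1
    have h2 : tt π V (E V) = v V := by simp [W.E0]
    rw [h2] at h1
    exact mul_left_cancel₀ hv (h1.symm.trans (mul_one _).symm)
  · intro i _ hi
    rw [map_mul, W.E1 V i hi]; simp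
  · simp

lemma DD.v_dvd (h : DD b L lam ρ y τ) (I : Ints K L lam) (W : Wed v π E) (V : J) :
    v V ∣ Module.finrank K H := by
  have S2 := I.S2
  have hv : (v V : K) ≠ 0 := by exact_mod_cast W.v0 V
  have tr := fun j => (GT.tt (π := π) j).tr
  have hc := h.cen_ch I (tr V)
  set d := Module.finrank K H
  have key : (v V : K) ^ 2 * ∑ j, om b ρ y π V (ch b ρ y (tt π j)) * om b ρ y π V (chS (ch b ρ y (tt π j))) = (d:K) ^ 2 := by
    have e1 : ∀ j, (v V : K) ^ 2 * (om b ρ y π V (ch b ρ y (tt π j)) * om b ρ y π V (chS (ch b ρ y (tt π j)))) =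
        v j * tt π j (GG b ρ y (ch b ρ y (tt π V) * chS (ch b ρ y (tt π V)))) := by
      intro j
      rw [om, om, GG_sym S2 (tr V) (tr j), GG_symS S2 (tr V) (tr j), h.yd.ya.GG_mul _ _ fun x => hc _,
        mul_comm (v j : K), W.cmul hc]
      field_simp
    rw [Finset.mul_sum, Finset.sum_congr rfl fun j _ => e1 j]
    refine (W.tr _).symm.trans ?_
    rw [h.trace I, h.τG I, h.Z2 I, h.ortho I W]
    ring
  have hint : IsIntegral ℤ (∑ j, om b ρ y π V (ch b ρ y (tt π j)) * om b ρ y π V (chS (ch b ρ y (tt π j)))) :=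
    IsIntegral.sum _ fun j _ => (h.om_int I W V j).mul (h.om_int' I W V j)
  set s := ∑ j, om b ρ y π V (ch b ρ y (tt π j)) * om b ρ y π V (chS (ch b ρ y (tt π j)))
  have hs : s = algebraMap ℚ K ((d:ℚ) ^ 2 / (v V : ℚ) ^ 2) := by
    rw [map_div₀]; simp only [map_pow, map_natCast]
    rw [← key]; field_simp
  rw [hs, isIntegral_algebraMap_iff (algebraMap ℚ K).injective, IsIntegrallyClosed.isIntegral_iff] at hint
  obtain ⟨m, hm⟩ := hint
  have hv' : (v V : ℚ) ≠ 0 := by exact_mod_cast W.v0 V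
  have h2 : (d:ℤ) ^ 2 = (v V : ℤ) ^ 2 * m := by
    have : (d:ℚ) ^ 2 = (v V : ℚ) ^ 2 * m := by
      rw [eq_div_iff (pow_ne_zero 2 hv')] at hm
      rw [← hm, mul_comm]; simp
    exact_mod_cast this
  have h3 : (v V : ℤ) ∣ d := (Int.pow_dvd_pow_iff two_ne_zero).1 ⟨m, h2⟩
  exact_mod_cast h3
end HE
end
noncomputable section
open TensorProduct Coalgebra WithConv HopfAlgebra
set_option linter.all false
namespace HE

section
variable {K H V ι : Type*} [CommRing K] [Ring H] [HopfAlgebra K H] [AddCommGroup V] [Module K V]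
  [Fintype ι] {b : Module.Basis ι K H}

def lT (K H V : Type*) [CommRing K] [Ring H] [HopfAlgebra K H] [AddCommGroup V] [Module K V] :
    Module.End K V →ₐ[K] Module.End K (H ⊗[K] V) := Module.End.lTensorAlgHom K V H
def rT (K H V : Type*) [CommRing K] [Ring H] [HopfAlgebra K H] [AddCommGroup V] [Module K V] :
    Module.End K H →ₐ[K] Module.End K (H ⊗[K] V) := Module.End.rTensorAlgHom K H V
abbrev pT (K H V : Type*) [CommRing K] [Ring H] [HopfAlgebra K H] [AddCommGroup V] [Module K V] :
    WithConv (H →ₗ[K] Module.End K V) →+* WithConv (H →ₗ[K] Module.End K (H ⊗[K] V)) :=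
  post (A := Module.End K V) (B := Module.End K (H ⊗[K] V)) (lT K H V)
@[simp] lemma lT_tmul (T : Module.End K V) (x : H) (w : V) : lT K H V T (x ⊗ₜ w) = x ⊗ₜ T w := rfl
@[simp] lemma rT_tmul (T : Module.End K H) (x : H) (w : V) : rT K H V T (x ⊗ₜ w) = T x ⊗ₜ w := rfl
lemma lrT (T : Module.End K V) (U : Module.End K H) : Commute (rT K H V U) (lT K H V T) := by
  refine TensorProduct.ext' fun x w => ?_
  simp
/-- left multiplication -/
def iM (K H V : Type*) [CommRing K] [Ring H] [HopfAlgebra K H] [AddCommGroup V] [Module K V] :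
    H →ₐ[K] Module.End K (H ⊗[K] V) := (rT K H V).comp (Algebra.lmul K H)
@[simp] lemma iM_tmul (a : H) (x : H) (w : V) : iM K H V a (x ⊗ₜ w) = (a * x) ⊗ₜ w := rfl

abbrev cM (K H V : Type*) [CommRing K] [Ring H] [HopfAlgebra K H] [AddCommGroup V] [Module K V] :
    WithConv (H →ₗ[K] Module.End K (H ⊗[K] V)) := cv (B := Module.End K (H ⊗[K] V)) (iM K H V)
abbrev cMS (K H V : Type*) [CommRing K] [Ring H] [HopfAlgebra K H] [AddCommGroup V] [Module K V] :
    WithConv (H →ₗ[K] Module.End K (H ⊗[K] V)) := cvS (B := Module.End K (H ⊗[K] V)) (iM K H V)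
lemma yaT : YA b (fun k => rT K H V (yN b k)) :=
  YA.map (B := Module.End K H) (C := Module.End K (H ⊗[K] V)) yaN (rT K H V)
def XX (b : Module.Basis ι K H) (f : WithConv (H →ₗ[K] Module.End K V)) : Module.End K (H ⊗[K] V) :=
  pr b (fun k => rT K H V (yN b k)) (pT K H V f)

lemma XX_mul (f g : WithConv (H →ₗ[K] Module.End K V)) : XX b f * XX b g = XX b (f * g) := by
  rw [XX, XX, XX, map_mul]
  exact yaT.pr_mul _ _ fun k x => (lrT _ _)
lemma XX_one : XX b (1 : WithConv (H →ₗ[K] Module.End K V)) = 1 := by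
  rw [XX, map_one]; exact yaT.pr_one
lemma lT_XX (T : Module.End K V) (f : WithConv (H →ₗ[K] Module.End K V)) :
    lT K H V T * XX b f = XX b (lmc T f) := by
  simp [XX, pr, Finset.mul_sum, mul_assoc]
lemma XX_lT (T : Module.End K V) (f : WithConv (H →ₗ[K] Module.End K V)) :
    XX b f * lT K H V T = XX b (rmc f T) := by
  simp only [XX, pr, Finset.sum_mul, post_apply, rmc_apply, map_mul]
  refine Finset.sum_congr rfl fun k _ => ?_
  rw [mul_assoc, (lrT T (yN b k)).eq, mul_assoc]
lemma XX_repr (f : WithConv (H →ₗ[K] Module.End K V)) {x : H} {κ : Type*} (r : Coalgebra.Repr K x κ)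
    (w : V) : XX b f (x ⊗ₜ w) = ∑ i ∈ r.index, r.left i ⊗ₜ f (r.right i) w := by
  simp only [XX, pr, LinearMap.sum_apply, Module.End.mul_apply, post_apply, rT_tmul, lT_tmul]
  simp only [yN, rc_repr r, sum_tmul]
  rw [Finset.sum_comm]
  refine Finset.sum_congr rfl fun i _ => ?_
  have h5 := congrArg (fun z => r.left i ⊗ₜ[K] f z w) (b.sum_repr (r.right i))
  simp only [map_sum, map_smul, tmul_sum, LinearMap.sum_apply, LinearMap.smul_apply, tmul_smul] at h5
  rw [← h5]
  refine Finset.sum_congr rfl fun k _ => ?_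
  rw [smul_tmul', Module.Basis.coord_apply]
lemma XX_apply (f : WithConv (H →ₗ[K] Module.End K V)) (x : H) (w : V) :
    XX b f (x ⊗ₜ w) = LinearMap.lTensor H (LinearMap.applyₗ w ∘ₗ f.ofConv) (comul x) := by
  rw [XX_repr f (ℛ K x), ← (ℛ K x).eq, map_sum]; rfl

lemma XX_i (f : WithConv (H →ₗ[K] Module.End K V)) (f' : H →ₐ[K] Module.End K V) (hf : cv f' = f) :
    lmc (XX b f) (cM K H V) = rmc (cM K H V * pT K H V f) (XX b f) := by
  ext x : 2
  refine TensorProduct.ext' fun z w => ?_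
  subst hf
  change XX b _ ((x * z) ⊗ₜ w) = _
  rw [XX_apply, comul_mul_repr (ℛ K x) (ℛ K z)]
  simp only [rmc_apply]
  change _ = ((cM K H V * pT K H V (cv f')) x * XX b (cv f')) (z ⊗ₜ w)
  rw [(ℛ K x).convMul_apply, Module.End.mul_apply, XX_repr _ (ℛ K z)]
  simp only [map_sum, LinearMap.sum_apply, LinearMap.lTensor_tmul]
  rw [Finset.sum_comm]
  refine Finset.sum_congr rfl fun i _ => Finset.sum_congr rfl fun j _ => ?_
  simp

def YL (b : Module.Basis ι K H) (y : ι → Module.End K V) : Module.End K (H ⊗[K] V) :=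
  pr b (fun k => lT K H V (y k)) (cM K H V)
def YLS (b : Module.Basis ι K H) (y : ι → Module.End K V) : Module.End K (H ⊗[K] V) :=
  pr b (fun k => lT K H V (y k)) (cMS K H V)
def Sb (K H V : Type*) [CommRing K] [Ring H] [HopfAlgebra K H] [AddCommGroup V] [Module K V] :
    Module.End K (H ⊗[K] V) := rT K H V (antipode K)
lemma Sb_Sb (S2 : ∀ x : H, antipode K (antipode K x) = x) : Sb K H V * Sb K H V = 1 := by
  refine TensorProduct.ext' fun x w => ?_
  simp [Sb, S2]

lemma Sb_YLS (S2 : ∀ x : H, antipode K (antipode K x) = x) (y : ι → Module.End K V) :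
    Sb K H V * YLS b y * Sb K H V =
     ∑ k, rT K H V (LinearMap.mulRight K (b k)) * lT K H V (y k) := by
  refine TensorProduct.ext' fun x w => ?_
  simp [Sb, YLS, pr, LinearMap.sum_apply, sum_tmul, S2, antipode_mul_antidistrib]

lemma Sb_XX (S2 : ∀ x : H, antipode K (antipode K x) = x) (f : H →ₐ[K] Module.End K V) {x : H} {κ : Type*}
    (r : Coalgebra.Repr K x κ) (w : V) :
    (Sb K H V * XX b (cvS f) * Sb K H V) (x ⊗ₜ w) = ∑ i ∈ r.index, r.right i ⊗ₜ f (r.left i) w := by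
  change rT K H V (antipode K) (XX b (cvS f) ((antipode K x) ⊗ₜ w)) = _
  rw [XX_apply, antipode_anti, ← r.eq]
  simp [S2]

variable {ρ : H →ₐ[K] Module.End K V} {y : ι → Module.End K V}

lemma YD.ambM (h : YD b ρ y) : Amb (C := Module.End K (H ⊗[K] V)) b (iM K H V) ((lT K H V).comp ρ)
    (fun k => lT K H V (y k)) :=
  h.toAmb (C := Module.End K (H ⊗[K] V)) (iM K H V) (lT K H V) fun x z => lrT _ _

lemma YA.u_u' (S2 : ∀ x : H, antipode K (antipode K x) = x) {B : Type*} [Ring B] [Algebra K B]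
    {ρ : H →ₐ[K] B} {y : ι → B} (h : YD b ρ y) : pr b y (cvS ρ) * pr b y (cv ρ) = 1 := by
  rw [← h.ya.skew2 S2 ρ, Finset.sum_comm, pr, pr, Finset.sum_mul_sum, Finset.sum_comm]
  refine Finset.sum_congr rfl fun q _ => ?_
  have := (h.u_ρ' S2 (b q)).eq
  rw [← Finset.sum_mul]
  change pr b y (cvS ρ) * (ρ (b q) * y q) = _
  rw [← mul_assoc, this, pr, Finset.mul_sum, Finset.sum_mul]
  refine Finset.sum_congr rfl fun p _ => ?_
  simp [mul_assoc]

/-- left-right exchange -/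
lemma YD.exch (h : YD b ρ y) {x : H} {κ : Type*} (r : Coalgebra.Repr K x κ) (w : V) :
    (YL b y * XX b (cv ρ)) (x ⊗ₜ w) =
      ∑ q, ∑ i ∈ r.index, (r.right i * b q) ⊗ₜ (ρ (r.left i) (y q w)) := by
  have := congrArg (LinearMap.lTensor H (LinearMap.applyₗ w)) (h.y3 x)
  rw [r.convMul_apply, r.convMul_apply] at this
  simp only [pr, Finset.sum_mul_sum, map_sum] at this
  rw [Module.End.mul_apply, XX_repr _ r, map_sum]
  simp only [YL, pr, LinearMap.sum_apply]
  rw [Finset.sum_comm]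
  refine Eq.trans ?_ (this.trans ?_)
  · simp
  · rw [Finset.sum_comm]; simp


lemma YD.conv2 (h : YD b ρ y) {c : K} (hu : pr b y (cv ρ) = c • 1) :
    pr (B := Module.End K (H ⊗[K] V)) b (fun k => lT K H V (y k)) (pT K H V (cv ρ) * cM K H V) = c • YL b y := by
  have h1 := YA.map (B := Module.End K V) (C := Module.End K (H ⊗[K] V)) h.ya (lT K H V)
  rw [← h1.pr_mul (pT K H V (cv ρ)) (cM K H V) fun k x => ((lrT (y k) (Algebra.lmul K H x)).symm : _)]
  have h2 := map_pr (B := Module.End K V) (C := Module.End K (H ⊗[K] V)) (lT K H V) y (cv ρ) (b := b)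
  have h3 : lT K H V (pr b y (cv ρ)) = c • 1 := by rw [hu, map_smul, map_one]
  refine (congrArg (fun z => z * YL b y) (h2.symm.trans h3)).trans ?_
  rw [smul_mul_assoc, one_mul]

lemma YD.main (S2 : ∀ x : H, antipode K (antipode K x) = x) (h : YD b ρ y) {c : K}
    (hu : pr b y (cv ρ) = c • 1) :
    (Sb K H V * XX b (cvS ρ) * Sb K H V) * (Sb K H V * YLS b y * Sb K H V) = c • (YL b y * XX b (cv ρ)) := by
  refine TensorProduct.ext' fun x w => ?_
  rw [LinearMap.smul_apply, h.exch (ℛ K x), Sb_YLS S2, Module.End.mul_apply, LinearMap.sum_apply, map_sum]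
  have key := congrArg (fun T : Module.End K (H ⊗[K] V) => T (1 ⊗ₜ w)) (h.conv2 hu)
  have e : ∀ k, (Sb K H V * XX b (cvS ρ) * Sb K H V) ((rT K H V (LinearMap.mulRight K (b k)) * lT K H V (y k)) (x ⊗ₜ w)) =
     ∑ i ∈ (ℛ K x).index, iM K H V ((ℛ K x).right i) (lT K H V (ρ ((ℛ K x).left i))
       ((pT K H V (cv ρ) * cM K H V) (b k) (lT K H V (y k) (1 ⊗ₜ w)))) := by
    intro k
    change (Sb K H V * XX b (cvS ρ) * Sb K H V) ((x * b k) ⊗ₜ y k w) = _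
    rw [lT_tmul, Sb_XX S2 ρ (x := x * b k) (.mk (((ℛ K x).index) ×ˢ (ℛ K (b k)).index) (fun p : _ × _ => (ℛ K x).left p.1 * (ℛ K (b k)).left p.2) 
        (fun p : _ × _ => (ℛ K x).right p.1 * (ℛ K (b k)).right p.2) (by
          rw [comul_mul_repr (ℛ K x) (ℛ K (b k)), Finset.sum_product])), Finset.sum_product]
    refine Finset.sum_congr rfl fun i _ => ?_
    rw [(ℛ K (b k)).convMul_apply]
    simp [LinearMap.sum_apply]
  rw [Finset.sum_congr rfl fun k _ => e k, Finset.sum_comm]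
  simp only [← map_sum]
  simp only [pr, LinearMap.sum_apply, Module.End.mul_apply] at key
  rw [key, Finset.sum_comm, Finset.smul_sum]
  refine Finset.sum_congr rfl fun i _ => ?_
  simp [YL, pr, LinearMap.sum_apply]


end

section
variable {K H V ι : Type*} [Field K] [Ring H] [HopfAlgebra K H] [AddCommGroup V] [Module K V]
  [Fintype ι] {b : Module.Basis ι K H} [FiniteDimensional K H] [FiniteDimensional K V]
  {ρ : H →ₐ[K] Module.End K V} {y : ι → Module.End K V}

lemma det_lT (T : Module.End K V) : LinearMap.det (lT K H V T) = LinearMap.det T ^ Module.finrank K H := by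
  classical
  let e := Module.finBasis K V
  let e' := Module.finBasis K H
  have : lT K H V T = TensorProduct.map LinearMap.id T := rfl
  rw [this, ← LinearMap.det_toMatrix (e'.tensorProduct e), TensorProduct.toMatrix_map, Matrix.det_kronecker]
  simp

lemma XX_inv (ρ : H →ₐ[K] Module.End K V) : XX b (cv ρ) * XX b (cvS ρ) = 1 := by
  rw [XX_mul, cv_cvS, XX_one]

lemma det_unit {M : Type*} [AddCommGroup M] [Module K M] {T U : Module.End K M} (h : T * U = 1) :
    LinearMap.det T * LinearMap.det U = 1 := by
  rw [← map_mul, h, map_one]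

lemma det_XX : LinearMap.det (XX b (cv ρ)) ^ Module.finrank K H = 1 := by
  have h1 : lT K H (H ⊗[K] V) (XX b (cv ρ)) * XX (V := H ⊗[K] V) b (cM K H V) =
     XX (V := H ⊗[K] V) b (cM K H V) * XX (V := H ⊗[K] V) b (pT K H V (cv ρ)) *
       lT K H (H ⊗[K] V) (XX b (cv ρ)) := by
    refine (lT_XX _ _).trans ?_
    rw [XX_mul]
    refine Eq.trans ?_ (XX_lT _ _).symm
    exact congrArg (XX b) (XX_i _ ρ rfl)
  have h2 := congrArg LinearMap.det h1
  rw [map_mul, map_mul, map_mul, det_lT] at h2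
  have n1 := det_unit (XX_inv (b := b) ρ)
  have n2 := det_unit (XX_inv (V := H ⊗[K] V) (b := b) (iM K H V))
  have n1' : LinearMap.det (XX b (cv ρ)) ^ Module.finrank K H ≠ 0 := pow_ne_zero _ (left_ne_zero_of_mul_eq_one n1)
  have n2' := left_ne_zero_of_mul_eq_one n2
  have h3 : LinearMap.det (XX (V := H ⊗[K] V) b (pT K H V (cv ρ))) = 1 := by
    have : LinearMap.det (XX (V := H ⊗[K] V) b (cM K H V)) * LinearMap.det (XX b (cv ρ)) ^ Module.finrank K H ≠ 0 :=
      mul_ne_zero n2' n1'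
    refine mul_left_cancel₀ this ?_
    rw [mul_one]
    refine Eq.trans ?_ (h2.symm.trans (mul_comm _ _))
    ring
  rw [← det_lT, ← h3, ← LinearMap.det_conj _ (TensorProduct.leftComm K H H V)]
  congr 1
  refine TensorProduct.ext' fun x w => ?_
  induction w using TensorProduct.induction_on with
  | zero => simp
  | add w1 w2 h1 h2 => rw [tmul_add, map_add, map_add, h1, h2]
  | tmul z w =>
    rw [XX_repr (V := H ⊗[K] V) _ (ℛ K x)]
    simp [XX_repr _ (ℛ K x), tmul_sum]

lemma YD.det_YL (h : YD b ρ y) : LinearMap.det (YL b y) ^ Module.finrank K H = 1 := by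
  set Y13 := YL (V := H ⊗[K] V) b (fun k => lT K H V (y k))
  set G := XX (V := H ⊗[K] V) b (cM K H V)
  have h' : YD (B := Module.End K (H ⊗[K] V)) b ((lT K H V).comp ρ) (fun k => lT K H V (y k)) :=
    YD.map (C := Module.End K (H ⊗[K] V)) h (lT K H V)
  have h'' : YA (B := Module.End K (H ⊗[K] (H ⊗[K] V))) b (fun k => lT K H (H ⊗[K] V) (lT K H V (y k))) :=
    YA.map (B := Module.End K (H ⊗[K] V)) (C := Module.End K (H ⊗[K] (H ⊗[K] V)))
      (y := fun k => lT K H V (y k)) h'.ya (lT K H (H ⊗[K] V))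
  have e1 : lT K H (H ⊗[K] V) (YL b y) = pr (B := Module.End K (H ⊗[K] (H ⊗[K] V))) b (fun k => lT K H (H ⊗[K] V) (lT K H V (y k)))
      (pT K H (H ⊗[K] V) (cM K H V)) :=
    map_pr (C := Module.End K (H ⊗[K] (H ⊗[K] V))) (B := Module.End K (H ⊗[K] V)) (lT K H (H ⊗[K] V)) _ _
  have e2 : Y13 * lT K H (H ⊗[K] V) (YL b y) = pr (B := Module.End K (H ⊗[K] (H ⊗[K] V))) b (fun k => lT K H (H ⊗[K] V) (lT K H V (y k)))
      (cM K H (H ⊗[K] V) * pT K H (H ⊗[K] V) (cM K H V)) := by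
    rw [e1]
    refine YA.pr_mul (B := Module.End K (H ⊗[K] (H ⊗[K] V))) h'' (cM K H (H ⊗[K] V)) (pT K H (H ⊗[K] V) (cM K H V)) fun k x => ?_
    change lT K H (H ⊗[K] V) _ * lT K H (H ⊗[K] V) (iM K H V x) = lT K H (H ⊗[K] V) (iM K H V x) * lT K H (H ⊗[K] V) _
    rw [← map_mul, ← map_mul]
    exact congrArg _ (lrT _ _).symm.eq
  have h1 : G * Y13 = Y13 * lT K H (H ⊗[K] V) (YL b y) * G := by
    rw [e2]
    have hG := XX_i (V := H ⊗[K] V) (b := b) (cM K H V) (iM K H V) rfl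
    have hy : ∀ k, G * lT K H (H ⊗[K] V) (lT K H V (y k)) = lT K H (H ⊗[K] V) (lT K H V (y k)) * G := by
      intro k
      refine (XX_lT _ _).trans (Eq.trans ?_ (lT_XX _ _).symm)
      congr 1
      ext x : 2
      exact lrT _ _
    simp only [Y13, YL, pr, Finset.mul_sum, Finset.sum_mul]
    refine Finset.sum_congr rfl fun k _ => ?_
    have := congrArg (fun f : WithConv (H →ₗ[K] Module.End K (H ⊗[K] (H ⊗[K] V))) => f (b k)) hG
    simp only [lmc_apply, rmc_apply] at this
    rw [← mul_assoc, mul_assoc _ _ G, ← hy, ← mul_assoc]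
    exact congrArg (fun z => z * lT K H (H ⊗[K] V) (lT K H V (y k))) this
  have h2 := congrArg LinearMap.det h1
  rw [map_mul, map_mul, map_mul, det_lT] at h2
  have n1 := det_unit h'.ambM.Y_Yinv
  have n2 := det_unit (XX_inv (V := H ⊗[K] V) (b := b) (iM K H V))
  have : LinearMap.det G * LinearMap.det Y13 ≠ 0 :=
    mul_ne_zero (left_ne_zero_of_mul_eq_one n2) (left_ne_zero_of_mul_eq_one n1)
  refine mul_left_cancel₀ this ?_
  rw [mul_one]
  refine Eq.trans ?_ h2.symm
  ring

lemma YD.det_fin (S2 : ∀ x : H, antipode K (antipode K x) = x) (h : YD b ρ y) {c : K}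
    (hu : pr b y (cvS ρ) = c • 1) : c ^ (Module.finrank K H ^ 2 * Module.finrank K V) = 1 := by
  by_cases hV : Module.finrank K V = 0
  · simp [hV]
  have hn : Nontrivial V := Module.nontrivial_of_finrank_pos (R := K) (Nat.pos_of_ne_zero hV)
  have u1 := YA.u_u' S2 h
  have hc : c ≠ 0 := by
    rintro rfl
    rw [hu, zero_smul, zero_mul] at u1
    exact zero_ne_one u1
  have u2 : pr b y (cv ρ) = c⁻¹ • 1 := by
    rw [hu, smul_mul_assoc, one_mul] at u1
    rw [← u1, smul_smul, inv_mul_cancel₀ hc, one_smul]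
  have m := congrArg LinearMap.det (h.main S2 u2)
  simp only [map_mul, LinearMap.det_smul] at m
  have s := det_unit (Sb_Sb (V := V) S2)
  have n1 := det_unit h.ambM.Y_Yinv
  have n2 := det_unit (XX_inv (b := b) ρ)
  change LinearMap.det (YL b y) * LinearMap.det (YLS b y) = 1 at n1
  have d1 := h.det_YL
  have d2 := det_XX (b := b) (ρ := ρ)
  rw [Module.finrank_tensorProduct] at m
  set A := LinearMap.det (YL b y)
  set B := LinearMap.det (YLS b y)
  set C := LinearMap.det (XX b (cv ρ))
  set D := LinearMap.det (XX b (cvS ρ))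
  set σ := LinearMap.det (Sb K H V)
  set d := Module.finrank K H
  set n := Module.finrank K V
  have m2 : c ^ (d * n) = (A * C) ^ 2 := by
    have : D * B = c⁻¹ ^ (d * n) * (A * C) := by
      rw [← m]
      calc D * B = (σ * σ) * (σ * σ) * (D * B) := by rw [s]; ring
        _ = _ := by ring
    have h3 : (A * C) * (D * B) = 1 := by
      calc (A * C) * (D * B) = (A * B) * (C * D) := by ring
        _ = 1 := by rw [n1, n2, one_mul]
    rw [this] at h3
    rw [inv_pow] at h3
    field_simp at h3
    rw [← h3]; ring
  calc c ^ (d ^ 2 * n) = (c ^ (d * n)) ^ d := by rw [← pow_mul]; ring_nf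
    _ = (A ^ d) ^ 2 * (C ^ d) ^ 2 := by rw [m2]; ring
    _ = 1 := by rw [d1, d2]; ring
end

theorem Ints.exp_char0 {K H : Type*} [Field K] [CharZero K] [IsAlgClosed K] [Ring H] [HopfAlgebra K H]
    [FiniteDimensional K H] {L : H} {lam : H →ₗ[K] K} (I : Ints K L lam) :
    idc K H ^ (Module.finrank K H ^ 3) = 1 := by
  let b := Module.finBasis K H
  obtain ⟨D, _, _, ρ, y, τ, h⟩ := I.exists_D b
  have := h.fin
  have := h.semisimple I
  obtain ⟨n, v, π, E, W⟩ := exists_wed (K := K) (D := D)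
  have S2 := I.S2
  have hu : pr b y (cvS ρ) ^ (Module.finrank K H ^ 3) = 1 := by
    refine W.inj _ _ fun j => ?_
    obtain ⟨c, hc⟩ := W.cen _ (h.central (h.yd.u_ρ' S2) (h.yd.u_y S2)) j
    have hd := YD.map (C := Module.End K (Fin (v j) → K)) h.yd (π j)
    have hu : pr (B := Module.End K (Fin (v j) → K)) b (fun k => π j (y k)) (cvS (B := Module.End K (Fin (v j) → K)) ((π j).comp ρ)) = c • 1 := by
      rw [← hc, pr, pr, map_sum]
      refine Finset.sum_congr rfl fun k _ => ?_
      rw [map_mul]; rfl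
    have := YD.det_fin S2 hd hu
    obtain ⟨m, hm⟩ := h.v_dvd I W j
    rw [Module.finrank_fin_fun] at this
    rw [map_pow, map_one, hc, smul_pow, one_pow, pow_succ (Module.finrank K H) 2]
    nth_rw 2 [hm]
    rw [← mul_assoc, pow_mul, this, one_pow, one_smul]
  rw [← h.yd.u_pow S2, ← h.yd.ya.GG_one (ρ := ρ)] at hu
  have := h.bij.1 (a₁ := fun k => antipode K ((idc K H ^ (Module.finrank K H ^ 3)) (b k)))
    (a₂ := fun k => antipode K ((1 : WithConv (H →ₗ[K] H)) (b k))) hu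
  have e : (idc K H ^ (Module.finrank K H ^ 3)).ofConv = (1 : WithConv (H →ₗ[K] H)).ofConv :=
    b.ext fun k => I.S_inj (congrFun this k)
  exact congrArg toConv e
end HE
end
noncomputable section
open TensorProduct Coalgebra WithConv HopfAlgebra
set_option linter.all false
namespace HE
section
variable {R : Type*} [CommRing R] [IsDomain R]

/-- base data: complete ring with residue field `k` -/
structure Bs (k : Type*) [Field k] [Algebra R k] (p : R) : Prop where
  p0 : p ≠ 0
  surj : Function.Surjective (algebraMap R k)
  ker : ∀ r : R, algebraMap R k r = 0 → ∃ s, r = p * s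
  kp : algebraMap R k p = 0
  compl : IsAdicComplete (Ideal.span {p}) R

variable {k : Type*} [Field k] [Algebra R k] {p : R}
variable {M N : Type*} [AddCommGroup M] [Module R M] [AddCommGroup N] [Module R N]

lemma smul_canc [Module.Free R M] {u : R} (hu : u ≠ 0) {x y : M} (h : u • x = u • y) : x = y := by
  have b := Module.Free.chooseBasis R M
  apply b.repr.injective
  ext i
  have := congrArg (fun t => b.repr t i) h
  simp only [map_smul, Finsupp.smul_apply, smul_eq_mul] at this
  exact mul_left_cancel₀ hu this

lemma Bs.haus1 (hb : Bs k p) {r : R} (h : ∀ n, ∃ s, r = p ^ n * s) : r = 0 := by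
  have := hb.compl
  refine IsHausdorff.haus (I := Ideal.span {p}) inferInstance r fun n => ?_
  rw [SModEq.zero, smul_eq_mul, Ideal.mul_top, Ideal.span_singleton_pow, Ideal.mem_span_singleton']
  obtain ⟨s, hs⟩ := h n
  exact ⟨s, by rw [hs, mul_comm]⟩

lemma Bs.haus (hb : Bs k p) [Module.Free R M] {x : M} (h : ∀ n, 1 ≤ n → ∃ y, x = p ^ n • y) : x = 0 := by
  have b := Module.Free.chooseBasis R M
  apply b.repr.injective
  ext i
  rw [map_zero]
  apply hb.haus1
  intro n
  rcases n with _ | n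
  · exact ⟨_, by rw [pow_zero, one_mul]⟩
  obtain ⟨y, rfl⟩ := h (n+1) (by omega)
  exact ⟨b.repr y i, by simp⟩

lemma Bs.limit (hb : Bs k p) [Module.Free R M] [Module.Finite R M] (P : ℕ → M → Prop)
    (h1 : ∃ x, P 1 x) (hs : ∀ n x, 1 ≤ n → P n x → ∃ h, P (n+1) (x + p ^ n • h)) :
    ∃ X : M, ∀ n, 1 ≤ n → ∃ x h, P n x ∧ X = x + p ^ n • h := by
  classical
  obtain ⟨x1, hx1⟩ := h1
  choose! h hh using hs
  let s : ℕ → M := fun n => Nat.rec x1 (fun n x => x + p ^ (n+1) • h (n+1) x) n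
  have hP : ∀ n, P (n+1) (s n) := by
    intro n
    induction n with
    | zero => exact hx1
    | succ n ih => exact hh (n+1) (s n) (by omega) ih
  have hstep : ∀ n m, ∃ y, s (n + m) = s n + p ^ (n+1) • y := by
    intro n m
    induction m with
    | zero => exact ⟨0, by simp⟩
    | succ m ih =>
      obtain ⟨y, hy⟩ := ih
      refine ⟨y + p ^ m • h (n+m+1) (s (n+m)), ?_⟩
      have : s (n + (m+1)) = s (n+m) + p ^ (n+m+1) • h (n+m+1) (s (n+m)) := rfl
      rw [this, hy, smul_add, smul_smul, ← pow_add, add_assoc, show n + 1 + m = n + m + 1 by omega]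
  let b := Module.Free.chooseBasis R M
  have := hb.compl
  have hc : ∀ i, ∃ L : R, ∀ n, ∃ t, L = b.repr (s n) i + p ^ n * t := by
    intro i
    obtain ⟨L, hL⟩ := IsPrecomplete.prec (I := Ideal.span {p}) inferInstance
      (f := fun n => b.repr (s n) i) (by
        intro m n hmn
        obtain ⟨y, hy⟩ := hstep m (n - m)
        rw [show m + (n - m) = n by omega] at hy
        rw [SModEq.sub_mem, smul_eq_mul, Ideal.mul_top, Ideal.span_singleton_pow,
          Ideal.mem_span_singleton', hy]
        exact ⟨-(p * b.repr y i), by simp; ring⟩)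
    refine ⟨L, fun n => ?_⟩
    have := hL n
    rw [SModEq.sub_mem, smul_eq_mul, Ideal.mul_top, Ideal.span_singleton_pow,
          Ideal.mem_span_singleton'] at this
    obtain ⟨t, ht⟩ := this
    exact ⟨-t, by linear_combination ht⟩
  choose L hL using hc
  choose t ht using hL
  refine ⟨∑ i, L i • b i, fun n hn => ?_⟩
  obtain ⟨m, rfl⟩ : ∃ m, n = m + 1 := ⟨n - 1, by omega⟩
  refine ⟨s m, h (m+1) (s m) + ∑ i, t i (m+1) • b i, hP m, ?_⟩
  have hs1 : s (m+1) = s m + p ^ (m+1) • h (m+1) (s m) := rfl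
  rw [smul_add, ← add_assoc, ← hs1, Finset.smul_sum]
  conv_rhs => rw [← b.sum_repr (s (m+1))]
  rw [← Finset.sum_add_distrib]
  refine Finset.sum_congr rfl fun i _ => ?_
  rw [smul_smul, ← add_smul, ht i (m+1)]

/-- Nakayama -/
lemma Bs.surj_of (hb : Bs k p) [Module.Finite R N] (f : M →ₗ[R] N)
    (h : ∀ y, ∃ x z, y = f x + p • z) : Function.Surjective f := by
  have := hb.compl
  rw [← LinearMap.range_eq_top, ← top_le_iff]
  refine Submodule.le_of_le_smul_of_le_jacobson_bot (I := Ideal.span {p}) Module.Finite.fg_top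
    (IsAdicComplete.le_jacobson_bot _) fun y _ => ?_
  obtain ⟨x, z, rfl⟩ := h y
  exact Submodule.add_mem_sup ⟨x, rfl⟩
    (Submodule.smul_mem_smul (Ideal.mem_span_singleton_self p) trivial)

lemma Bs.bij_of (hb : Bs k p) [Module.Finite R M] (f : M →ₗ[R] M)
    (h : ∀ y, ∃ z, f y = y + p • z) : Function.Bijective f := by
  have hs : Function.Surjective f := hb.surj_of f fun y => by
    obtain ⟨z, hz⟩ := h y
    exact ⟨y, -z, by rw [hz]; simp⟩
  exact ⟨OrzechProperty.injective_of_surjective_endomorphism f hs, hs⟩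

lemma Bs.unit (hb : Bs k p) {C : Type*} [Ring C] [Algebra R C] [Module.Finite R C] {y x : C}
    (h : y = 1 + p • x) : IsUnit y := by
  have h1 := (hb.bij_of (LinearMap.mulLeft R y) fun z => ⟨x * z, by simp [h, add_mul]⟩).2 1
  have h2 := (hb.bij_of (LinearMap.mulRight R y) fun z => ⟨z * x, by simp [h, mul_add]⟩).2 1
  obtain ⟨a, ha⟩ := h1
  obtain ⟨c, hc⟩ := h2
  simp only [LinearMap.mulLeft_apply, LinearMap.mulRight_apply] at ha hc
  have : c = a := by
    calc c = c * (y * a) := by rw [ha, mul_one]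
      _ = a := by rw [← mul_assoc, hc, one_mul]
  exact ⟨⟨y, a, ha, this ▸ hc⟩, rfl⟩

lemma Bs.idem (hb : Bs k p) {C : Type*} [Ring C] [Algebra R C] [Module.Finite R C] {y x : C}
    (h : y = 1 + p • x) (hi : y * y = y) : y = 1 :=
  (hb.unit h).mul_left_cancel (by rw [hi, mul_one])

end

section
variable {R : Type*} [CommRing R] [IsDomain R] {k : Type*} [Field k] [Algebra R k] {p : R}
variable {M N M' N' : Type*} [AddCommGroup M] [Module R M] [AddCommGroup N] [Module R N]
  [AddCommGroup M'] [Module R M'] [Module k M'] [IsScalarTower R k M']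
  [AddCommGroup N'] [Module R N'] [Module k N'] [IsScalarTower R k N']

def Red (k : Type*) [Field k] [Algebra R k] [Module k M'] (π : M →ₗ[R] M') : Prop :=
  ∃ (n : ℕ) (b : Module.Basis (Fin n) R M) (b' : Module.Basis (Fin n) k M'), ∀ i, π (b i) = b' i

lemma Red.mk {π : M →ₗ[R] M'} {ι : Type*} [Fintype ι] (b : Module.Basis ι R M)
    (b' : Module.Basis ι k M') (h : ∀ i, π (b i) = b' i) : Red k π :=
  ⟨_, b.reindex (Fintype.equivFin ι), b'.reindex (Fintype.equivFin ι), fun i => by simp [h]⟩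

variable {π : M →ₗ[R] M'} {ρ : N →ₗ[R] N'}

lemma Red.free (h : Red k π) : Module.Free R M := by
  obtain ⟨n, b, b', hb⟩ := h
  exact Module.Free.of_basis b

lemma Red.fin (h : Red k π) : Module.Finite R M := by
  obtain ⟨n, b, b', hb⟩ := h
  exact Module.Finite.of_basis b

lemma Red.rank (h : Red k π) : Module.finrank R M = Module.finrank k M' := by
  obtain ⟨n, b, b', hb⟩ := h
  rw [Module.finrank_eq_card_basis b, Module.finrank_eq_card_basis b']

lemma red_ap {n : ℕ} {b : Module.Basis (Fin n) R M} {b' : Module.Basis (Fin n) k M'}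
    (h : ∀ i, π (b i) = b' i) (x : M) : π x = ∑ i, algebraMap R k (b.repr x i) • b' i := by
  conv_lhs => rw [← b.sum_repr x]
  simp only [map_sum, map_smul, h, algebraMap_smul]

lemma Red.p_smul (hb : Bs k p) (x : M') : p • x = 0 := by
  rw [← algebraMap_smul k p x, hb.kp, zero_smul]

lemma Red.div1 (hb : Bs k p) (h : Red k π) {x : M} (hx : π x = 0) : ∃ y, x = p • y := by
  obtain ⟨n, b, b', hbb⟩ := h
  rw [red_ap hbb] at hx
  have h0 := Fintype.linearIndependent_iff.1 b'.linearIndependent _ hx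
  choose s hs using fun i => hb.ker _ (h0 i)
  refine ⟨∑ i, s i • b i, ?_⟩
  conv_lhs => rw [← b.sum_repr x]
  rw [Finset.smul_sum]
  exact Finset.sum_congr rfl fun i _ => by rw [hs, mul_smul]

lemma Red.div (hb : Bs k p) (h : Red k π) [Module.Free R N] (f : N →ₗ[R] M) (hf : ∀ x, π (f x) = 0) :
    ∃ g : N →ₗ[R] M, f = p • g := by
  let b := Module.Free.chooseBasis R N
  choose y hy using fun i => h.div1 hb (hf (b i))
  refine ⟨b.constr R y, b.ext fun i => ?_⟩
  rw [LinearMap.smul_apply, b.constr_basis, ← hy]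

lemma Red.surj (hb : Bs k p) (h : Red k π) : Function.Surjective π := by
  obtain ⟨n, b, b', hbb⟩ := h
  intro y
  choose s hs using fun i => hb.surj (b'.repr y i)
  refine ⟨∑ i, s i • b i, ?_⟩
  conv_rhs => rw [← b'.sum_repr y]
  simp [hbb, ← hs]

lemma Red.lift (hb : Bs k p) (h : Red k π) (h' : Red k ρ) (g : M' →ₗ[k] N') :
    ∃ f : M →ₗ[R] N, ∀ x, ρ (f x) = g (π x) := by
  obtain ⟨n, b, b', hbb⟩ := h
  choose y hy using fun i => h'.surj hb (g (b' i))
  refine ⟨b.constr R y, fun x => ?_⟩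
  exact LinearMap.congr_fun (f := ρ ∘ₗ b.constr R y) (g := (g.restrictScalars R) ∘ₗ π)
    (b.ext fun i => by simp [hy, hbb]) x

lemma Red.ind (h : Red k π) (f : M →ₗ[R] N) :
    ∃ g : M' →ₗ[k] N', ∀ x, ρ (f x) = g (π x) := by
  obtain ⟨n, b, b', hbb⟩ := h
  refine ⟨b'.constr k (fun i => ρ (f (b i))), fun x => ?_⟩
  exact LinearMap.congr_fun (f := ρ ∘ₗ f)
    (g := ((b'.constr k (fun i => ρ (f (b i)))).restrictScalars R) ∘ₗ π)
    (b.ext fun i => by simp [hbb]) x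

def tm (k : Type*) [Field k] [Algebra R k] [Module k M'] [IsScalarTower R k M'] [Module k N'] [IsScalarTower R k N']
    (π : M →ₗ[R] M') (ρ : N →ₗ[R] N') : M ⊗[R] N →ₗ[R] M' ⊗[k] N' :=
  TensorProduct.lift (LinearMap.mk₂ R (fun x y => π x ⊗ₜ[k] ρ y)
    (fun _ _ _ => by simp [add_tmul]) (fun c m n => by
      rw [map_smul, ← algebraMap_smul k c (π m), ← algebraMap_smul k c, smul_tmul'])
    (fun _ _ _ => by simp [tmul_add]) (fun c m n => by
      rw [map_smul, ← algebraMap_smul k c (ρ n), ← algebraMap_smul k c, tmul_smul]))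

@[simp] lemma tm_tmul (x : M) (y : N) : tm k π ρ (x ⊗ₜ y) = π x ⊗ₜ ρ y := rfl

lemma Red.tens (h : Red k π) (h' : Red k ρ) : Red k (tm k π ρ) := by
  obtain ⟨n, b, b', hbb⟩ := h
  obtain ⟨m, c, c', hcc⟩ := h'
  exact Red.mk (b.tensorProduct c) (b'.tensorProduct c') fun i => by
    rw [Module.Basis.tensorProduct_apply', Module.Basis.tensorProduct_apply', tm_tmul, hbb, hcc]

lemma tm_map {M₁ N₁ M₁' N₁' : Type*} [AddCommGroup M₁] [Module R M₁] [AddCommGroup N₁] [Module R N₁]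
  [AddCommGroup M₁'] [Module R M₁'] [Module k M₁'] [IsScalarTower R k M₁']
  [AddCommGroup N₁'] [Module R N₁'] [Module k N₁'] [IsScalarTower R k N₁']
  {π₁ : M₁ →ₗ[R] M₁'} {ρ₁ : N₁ →ₗ[R] N₁'} {f : M →ₗ[R] M₁} {g : N →ₗ[R] N₁} {f' : M' →ₗ[k] M₁'} {g' : N' →ₗ[k] N₁'}
  (hf : ∀ x, π₁ (f x) = f' (π x)) (hg : ∀ x, ρ₁ (g x) = g' (ρ x)) (x : M ⊗[R] N) :
  tm k π₁ ρ₁ (TensorProduct.map f g x) = TensorProduct.map f' g' (tm k π ρ x) := by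
  induction x with
  | zero => simp
  | add x y hx hy => simp only [map_add, hx, hy]
  | tmul x y => simp [hf, hg]

lemma tm_assoc {Q Q' : Type*} [AddCommGroup Q] [Module R Q]
  [AddCommGroup Q'] [Module R Q'] [Module k Q'] [IsScalarTower R k Q'] {σ : Q →ₗ[R] Q'} (x : M ⊗[R] N ⊗[R] Q) :
  tm k π (tm k ρ σ) (TensorProduct.assoc R M N Q x) =
    TensorProduct.assoc k M' N' Q' (tm k (tm k π ρ) σ x) := by
  induction x with
  | zero => simp
  | add x y hx hy => simp only [map_add, hx, hy]
  | tmul x q =>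
    induction x with
    | zero => simp [zero_tmul]
    | add x y hx hy => simp only [map_add, add_tmul, hx, hy]
    | tmul x y => simp
end
end HE
end
noncomputable section
open TensorProduct Coalgebra WithConv HopfAlgebra
set_option linter.all false
namespace HE
section
variable {k H : Type*} [CommRing k] [Ring H]

structure Sep (k : Type*) {H : Type*} [CommRing k] [Ring H] [Algebra k H] {ι : Type*} (s : Finset ι) (x y : ι → H) : Prop where
  c : ∀ h, ∑ i ∈ s, (h * x i) ⊗ₜ[k] y i = ∑ i ∈ s, x i ⊗ₜ[k] (y i * h)
  o : ∑ i ∈ s, x i * y i = 1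

lemma sep_of_int [HopfAlgebra k H] {L : H} (hl : ∀ h, h * L = counit (R := k) h • L)
    (e : counit (R := k) L = 1) {ι : Type*} (r : Coalgebra.Repr k L ι) :
    Sep k r.index r.left (fun i => antipode k (r.right i)) := by
  have key : ∀ h, (rmc (cv (Algebra.TensorProduct.includeLeft : H →ₐ[k] H ⊗[k] H))
      (∑ i ∈ r.index, r.left i ⊗ₜ[k] antipode k (r.right i))
      * cvS (Algebra.TensorProduct.includeRight : H →ₐ[k] H ⊗[k] H)) h
      = (lmc (∑ i ∈ r.index, r.left i ⊗ₜ[k] antipode k (r.right i)) 1 :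
          WithConv (H →ₗ[k] H ⊗[k] H)) h := by
    intro h
    rw [(ℛ k h).convMul_apply]
    have h2 := congrArg (TensorProduct.map LinearMap.id (antipode k)) (comul_mul_repr (ℛ k h) r)
    rw [hl, map_smul, ← r.eq] at h2
    simp only [map_smul, map_sum, TensorProduct.map_tmul, LinearMap.id_apply, antipode_mul] at h2
    simp only [rmc_apply, lmc_apply, LinearMap.convOne_apply]
    rw [← Algebra.commutes, ← Algebra.smul_def, h2]
    simp only [Finset.mul_sum, Finset.sum_mul]
    refine Finset.sum_congr rfl fun i _ => ?_
    refine Finset.sum_congr rfl fun j _ => ?_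
    simp
  constructor
  · intro h
    have h3 : rmc (cv (Algebra.TensorProduct.includeLeft : H →ₐ[k] H ⊗[k] H))
      (∑ i ∈ r.index, r.left i ⊗ₜ[k] antipode k (r.right i))
      = lmc (∑ i ∈ r.index, r.left i ⊗ₜ[k] antipode k (r.right i))
        (cv (Algebra.TensorProduct.includeRight : H →ₐ[k] H ⊗[k] H)) := by
      have h4 := congrArg (· * cv (Algebra.TensorProduct.includeRight : H →ₐ[k] H ⊗[k] H))
        (WithConv.ext (LinearMap.ext key))
      simp only [mul_assoc, cvS_cv, mul_one, lmc_mul, one_mul] at h4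
      exact h4
    have h5 := congrArg (fun t : WithConv (H →ₗ[k] H ⊗[k] H) => t h) h3
    simpa [Finset.mul_sum, Finset.sum_mul] using h5
  · have := congrArg (fun f : WithConv (H →ₗ[k] H) => f L) (idc_Sc (K := k) (H := H))
    simp only [r.convMul_apply] at this
    simpa [e] using this

variable [Algebra k H] {C M : Type*} [Ring C] [Algebra k C] [AddCommGroup M] [Module k M]
variable {ι : Type*} {s : Finset ι} {x y : ι → H}

lemma Sep.ap (h : Sep k s x y) (Z : H →ₗ[k] H →ₗ[k] M) (a : H) :
    ∑ i ∈ s, Z (a * x i) (y i) = ∑ i ∈ s, Z (x i) (y i * a) := by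
  simpa using congrArg (TensorProduct.lift Z) (h.c a)

lemma Sep.K1 (h : Sep k s x y) (ρ : H →ₐ[k] C) (D : H →ₗ[k] C)
    (hD : ∀ a b, D (a * b) = ρ a * D b + D a * ρ b) : ∃ φ, ∀ a, D a = φ * ρ a - ρ a * φ := by
  refine ⟨∑ i ∈ s, D (x i) * ρ (y i), fun a => ?_⟩
  have h1 := h.ap ((LinearMap.mul k C).compl₁₂ D ρ.toLinearMap) a
  simp only [LinearMap.compl₁₂_apply, LinearMap.mul_apply', AlgHom.toLinearMap_apply, hD, map_mul,
    add_mul, Finset.sum_add_distrib] at h1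
  have h2 := congrArg (fun t => D a * ρ t) h.o
  simp only [map_sum, map_mul, map_one, mul_one, Finset.mul_sum] at h2
  rw [Finset.sum_mul, Finset.mul_sum]
  simp only [mul_assoc] at h1 ⊢
  rw [← h1, h2]; abel

lemma Sep.K2 (h : Sep k s x y) (ρ : H →ₐ[k] C) (E : H ⊗[k] H →ₗ[k] C)
    (hE : ∀ a b c, ρ a * E (b ⊗ₜ c) - E ((a * b) ⊗ₜ c) + E (a ⊗ₜ (b * c)) - E (a ⊗ₜ b) * ρ c = 0) :
    ∃ g : H →ₗ[k] C, ∀ a b, E (a ⊗ₜ b) + g (a * b) - ρ a * g b - g a * ρ b = 0 := by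
  refine ⟨∑ i ∈ s, LinearMap.mulLeft k (ρ (x i)) ∘ₗ E ∘ₗ TensorProduct.mk k H H (y i), fun a b => ?_⟩
  have h1 := h.ap ((LinearMap.mul k C).compl₁₂ ρ.toLinearMap (E ∘ₗ (TensorProduct.mk k H H).flip b)) a
  have h2 := congrArg (fun t => ρ t * E (a ⊗ₜ b)) h.o
  have h3 := Finset.sum_congr rfl fun i (_ : i ∈ s) => congrArg (ρ (x i) * ·) (hE (y i) a b)
  simp only [mul_sub, mul_add, mul_zero, Finset.sum_sub_distrib, Finset.sum_add_distrib,
    Finset.sum_const_zero] at h3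
  simp only [map_sum, map_mul, map_one, one_mul, Finset.sum_mul] at h2
  simp only [LinearMap.compl₁₂_apply, LinearMap.mul_apply', AlgHom.toLinearMap_apply, map_mul,
    LinearMap.comp_apply, LinearMap.flip_apply, TensorProduct.mk_apply] at h1
  simp only [LinearMap.sum_apply, LinearMap.comp_apply, TensorProduct.mk_apply,
    LinearMap.mulLeft_apply, Finset.sum_mul, Finset.mul_sum]
  simp only [← mul_assoc] at h1 h2 h3 ⊢
  rw [h2, ← h1] at h3
  rw [← h3]; abel

lemma Sep.K3 (h : Sep k s x y) (E : H ⊗[k] (H ⊗[k] H) →ₗ[k] H)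
    (hE : ∀ a b c d, a * E (b ⊗ₜ (c ⊗ₜ d)) - E ((a * b) ⊗ₜ (c ⊗ₜ d)) + E (a ⊗ₜ ((b * c) ⊗ₜ d))
      - E (a ⊗ₜ (b ⊗ₜ (c * d))) + E (a ⊗ₜ (b ⊗ₜ c)) * d = 0) :
    ∃ g : H ⊗[k] H →ₗ[k] H, ∀ a b c, E (a ⊗ₜ (b ⊗ₜ c)) + g ((a * b) ⊗ₜ c) + g (a ⊗ₜ b) * c
      - g (a ⊗ₜ (b * c)) - a * g (b ⊗ₜ c) = 0 := by
  refine ⟨∑ i ∈ s, LinearMap.mulLeft k (x i) ∘ₗ E ∘ₗ TensorProduct.mk k H (H ⊗[k] H) (y i), fun a b c => ?_⟩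
  have h1 := h.ap ((LinearMap.mul k H).compl₁₂ LinearMap.id
    (E ∘ₗ (TensorProduct.mk k H (H ⊗[k] H)).flip (b ⊗ₜ c))) a
  have h2 := congrArg (fun t => t * E (a ⊗ₜ (b ⊗ₜ c))) h.o
  have h3 := Finset.sum_congr rfl fun i (_ : i ∈ s) => congrArg (x i * ·) (hE (y i) a b c)
  simp only [mul_sub, mul_add, mul_zero, Finset.sum_sub_distrib, Finset.sum_add_distrib,
    Finset.sum_const_zero] at h3
  simp only [one_mul, Finset.sum_mul] at h2
  simp only [LinearMap.compl₁₂_apply, LinearMap.mul_apply', LinearMap.id_apply,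
    LinearMap.comp_apply, LinearMap.flip_apply, TensorProduct.mk_apply] at h1
  simp only [LinearMap.sum_apply, LinearMap.comp_apply, TensorProduct.mk_apply,
    LinearMap.mulLeft_apply, Finset.sum_mul, Finset.mul_sum]
  simp only [← mul_assoc] at h1 h2 h3 ⊢
  rw [h2, ← h1] at h3
  rw [← h3]; abel
end
end HE
end
noncomputable section
open TensorProduct Coalgebra WithConv HopfAlgebra
set_option linter.all false
namespace HE
section
universe u
variable {R : Type u} [CommRing R] {k H : Type*}

def Vec (R : Type u) (n : ℕ) : Type u := Fin n → R
instance (n : ℕ) : AddCommGroup (Vec R n) := inferInstanceAs (AddCommGroup (Fin n → R))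
instance (n : ℕ) : Module R (Vec R n) := inferInstanceAs (Module R (Fin n → R))
def vecb (R : Type u) [CommRing R] (n : ℕ) : Module.Basis (Fin n) R (Vec R n) := Pi.basisFun R (Fin n)

section
variable {A : Type*} [AddCommGroup A] [Module R A]
def Bd (m1 m2 : A ⊗[R] A →ₗ[R] A) : A ⊗[R] (A ⊗[R] A) →ₗ[R] A :=
  m1 ∘ₗ TensorProduct.map m2 LinearMap.id ∘ₗ (TensorProduct.assoc R A A A).symm.toLinearMap
    - m1 ∘ₗ TensorProduct.map LinearMap.id m2
@[simp] lemma Bd_ap (m1 m2 : A ⊗[R] A →ₗ[R] A) (a b c : A) : Bd m1 m2 (a ⊗ₜ (b ⊗ₜ c)) =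
    m1 (m2 (a ⊗ₜ b) ⊗ₜ c) - m1 (a ⊗ₜ m2 (b ⊗ₜ c)) := by simp [Bd]
lemma ext3 {M : Type*} [AddCommGroup M] [Module R M] {f g : A ⊗[R] (A ⊗[R] A) →ₗ[R] M}
    (h : ∀ a b c, f (a ⊗ₜ (b ⊗ₜ c)) = g (a ⊗ₜ (b ⊗ₜ c))) : f = g := by
  ext a b c; exact h a b c
lemma Bd_exp (m1 m2 : A ⊗[R] A →ₗ[R] A) (u : R) : Bd (m1 + u • m2) (m1 + u • m2) =
    Bd m1 m1 + u • (Bd m1 m2 + Bd m2 m1 + u • Bd m2 m2) := by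
  refine ext3 fun a b c => ?_
  simp only [Bd_ap, LinearMap.add_apply, LinearMap.smul_apply, add_tmul, tmul_add, map_add,
    ← smul_tmul', tmul_smul, map_smul]
  module
end

variable [IsDomain R] [Field k] [Algebra R k] {p : R} [Ring H] [Algebra k H] [Algebra R H] [IsScalarTower R k H]
variable {ι : Type*} {s : Finset ι} {x y : ι → H}

lemma Bs.pn (hb : Bs k p) (n : ℕ) : p ^ n ≠ 0 := pow_ne_zero n hb.p0

lemma mulLift (hb : Bs k p) (hs : Sep k s x y) {A : Type*} [AddCommGroup A] [Module R A]
    {π : A →ₗ[R] H} (hπ : Red k π) : ∃ μ : A ⊗[R] A →ₗ[R] A, Bd μ μ = 0 ∧ ∀ a b, π (μ (a ⊗ₜ b)) = π a * π b := by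
  have := hπ.free
  have := hπ.fin
  have hp := fun x : H => Red.p_smul hb x
  have hpn : ∀ n, 1 ≤ n → ∀ x : H, p ^ n • x = 0 := by
    intro n hn x
    obtain ⟨m, rfl⟩ : ∃ m, n = m + 1 := ⟨n - 1, by omega⟩
    rw [pow_succ', mul_smul, hp]
  have lim := hb.limit (M := A ⊗[R] A →ₗ[R] A) (fun n μ => (∃ F, Bd μ μ = p ^ n • F) ∧
    ∀ a b, π (μ (a ⊗ₜ b)) = π a * π b) ?_ ?_
  · obtain ⟨μ, hμ⟩ := lim
    refine ⟨μ, ?_, ?_⟩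
    · refine hb.haus fun n hn => ?_
      obtain ⟨x, h, ⟨⟨F, hF⟩, -⟩, rfl⟩ := hμ n hn
      exact ⟨_, by rw [Bd_exp, hF, ← smul_add]⟩
    · obtain ⟨x, h, ⟨-, h2⟩, rfl⟩ := hμ 1 le_rfl
      intro a b
      simp [h2, hp]
  · obtain ⟨μ, hμ⟩ := (hπ.tens hπ).lift hb hπ (LinearMap.mul' k H)
    have h2 : ∀ a b, π (μ (a ⊗ₜ b)) = π a * π b := fun a b => by simp [hμ]
    refine ⟨μ, ?_, h2⟩
    obtain ⟨g, hg⟩ := hπ.div hb (Bd μ μ) (fun t => LinearMap.congr_fun (f := π ∘ₗ Bd μ μ) (g := 0)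
      (ext3 fun a b c => by simp [h2, mul_assoc]) t)
    exact ⟨g, by rw [hg, pow_one]⟩
  · rintro n μ hn ⟨⟨F, hF⟩, h2⟩
    have hF' : ∀ a b c, μ (μ (a ⊗ₜ b) ⊗ₜ c) - μ (a ⊗ₜ μ (b ⊗ₜ c)) = p ^ n • F (a ⊗ₜ (b ⊗ₜ c)) :=
      fun a b c => by rw [← Bd_ap, hF, LinearMap.smul_apply]
    obtain ⟨E, hE⟩ := (hπ.tens (hπ.tens hπ)).ind (ρ := π) F
    obtain ⟨g, hg⟩ := hs.K3 E (by
      intro a b c d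
      obtain ⟨a, rfl⟩ := hπ.surj hb a
      obtain ⟨b, rfl⟩ := hπ.surj hb b
      obtain ⟨c, rfl⟩ := hπ.surj hb c
      obtain ⟨d, rfl⟩ := hπ.surj hb d
      have h3 : μ (a ⊗ₜ F (b ⊗ₜ (c ⊗ₜ d))) - F (μ (a ⊗ₜ b) ⊗ₜ (c ⊗ₜ d)) + F (a ⊗ₜ (μ (b ⊗ₜ c) ⊗ₜ d))
        - F (a ⊗ₜ (b ⊗ₜ μ (c ⊗ₜ d))) + μ (F (a ⊗ₜ (b ⊗ₜ c)) ⊗ₜ d) = 0 := by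
        apply smul_canc (hb.pn n)
        have e1 : ∀ t t', p ^ n • μ (t ⊗ₜ t') = μ (t ⊗ₜ (p ^ n • t')) := fun t t' => by
          rw [tmul_smul, map_smul]
        have e2 : ∀ t t', p ^ n • μ (t ⊗ₜ t') = μ ((p ^ n • t) ⊗ₜ t') := fun t t' => by
          rw [← smul_tmul', map_smul]
        rw [smul_zero, smul_add, smul_sub, smul_add, smul_sub, e1, e2]
        simp only [← hF']
        simp only [tmul_sub, sub_tmul, map_sub]
        abel
      have h4 := congrArg π h3
      simpa [hE, h2] using h4)
    obtain ⟨g', hg'⟩ := (hπ.tens hπ).lift hb hπ g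
    obtain ⟨G, hG⟩ := hπ.div hb (F + (Bd μ g' + Bd g' μ + p ^ n • Bd g' g')) (fun t =>
      LinearMap.congr_fun (f := π ∘ₗ (F + (Bd μ g' + Bd g' μ + p ^ n • Bd g' g'))) (g := 0)
      (ext3 fun a b c => by
        have := hg (π a) (π b) (π c)
        simp only [LinearMap.comp_apply, LinearMap.add_apply, LinearMap.smul_apply, map_add, map_smul,
          Bd_ap, map_sub, h2, hE, hg', tm_tmul, hpn n hn, LinearMap.zero_apply]
        refine Eq.trans ?_ this; abel) t)
    refine ⟨g', ⟨G, ?_⟩, ?_⟩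
    · rw [Bd_exp, hF, ← smul_add, hG, smul_smul, pow_succ]
    · intro a b
      simp [h2, hpn n hn]

theorem algLift (hb : Bs k p) (hs : Sep k s x y) [FiniteDimensional k H] :
    ∃ (A : Type u) (_ : Ring A) (_ : Algebra R A) (π : A →ₐ[R] H), Red k π.toLinearMap := by
  let n := Module.finrank k H
  let b' : Module.Basis (Fin n) k H := Module.finBasis k H
  let π : Vec R n →ₗ[R] H := (vecb R n).constr R b'
  have hπ : Red k π := ⟨n, vecb R n, b', fun i => by simp [π]⟩
  obtain ⟨μ, hμ, h2⟩ := mulLift hb hs hπ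
  have as : ∀ a b c, μ (μ (a ⊗ₜ b) ⊗ₜ c) = μ (a ⊗ₜ μ (b ⊗ₜ c)) := fun a b c => by
    rw [← sub_eq_zero, ← Bd_ap, hμ]; rfl
  obtain ⟨e0, he0⟩ := hπ.surj hb 1
  have := hπ.fin
  have hL := (hb.bij_of (μ ∘ₗ TensorProduct.mk R _ _ e0) fun y => by
    obtain ⟨z, hz⟩ := hπ.div1 hb (x := μ (e0 ⊗ₜ y) - y) (by simp [h2, he0])
    exact ⟨z, by rw [← hz]; simp⟩).2
  have hR := (hb.bij_of (μ ∘ₗ (TensorProduct.mk R _ _).flip e0) fun y => by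
    obtain ⟨z, hz⟩ := hπ.div1 hb (x := μ (y ⊗ₜ e0) - y) (by simp [h2, he0])
    exact ⟨z, by rw [← hz]; simp⟩).2
  simp only [Function.Surjective, LinearMap.comp_apply, TensorProduct.mk_apply, LinearMap.flip_apply] at hL hR
  obtain ⟨e, he⟩ := hL e0
  obtain ⟨e', he'⟩ := hR e0
  have hr : ∀ y, μ (y ⊗ₜ e) = y := fun y => by
    obtain ⟨z, rfl⟩ := hR y
    rw [as, he]
  have hl : ∀ y, μ (e' ⊗ₜ y) = y := fun y => by
    obtain ⟨z, rfl⟩ := hL y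
    rw [← as, he']
  have hee : e' = e := by rw [← hr e', hl]
  subst hee
  letI rA : Ring (Vec R n) :=
    { (inferInstance : AddCommGroup (Vec R n)) with
      mul := fun a b => μ (a ⊗ₜ b)
      one := e'
      mul_assoc := as
      one_mul := hl
      mul_one := hr
      left_distrib := fun a b c => by
        change μ (a ⊗ₜ (b + c)) = μ (a ⊗ₜ b) + μ (a ⊗ₜ c)
        rw [tmul_add, map_add]
      right_distrib := fun a b c => by
        change μ ((a + b) ⊗ₜ c) = μ (a ⊗ₜ c) + μ (b ⊗ₜ c)
        rw [add_tmul, map_add]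
      zero_mul := fun a => by
        change μ (0 ⊗ₜ a) = 0
        rw [zero_tmul, map_zero]
      mul_zero := fun a => by
        change μ (a ⊗ₜ 0) = 0
        rw [tmul_zero, map_zero] }
  letI aA : Algebra R (Vec R n) := Algebra.ofModule
    (fun r a b => by
      change μ ((r • a) ⊗ₜ b) = r • μ (a ⊗ₜ b)
      rw [← smul_tmul', map_smul])
    (fun r a b => by
      change μ (a ⊗ₜ (r • b)) = r • μ (a ⊗ₜ b)
      rw [tmul_smul, map_smul])
  refine ⟨Vec R n, rA, aA, AlgHom.ofLinearMap π ?_ h2, hπ⟩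
  change π e' = 1
  have := h2 e0 e'
  rw [he, he0, one_mul] at this
  exact this.symm

theorem homLift (hb : Bs k p) (hs : Sep k s x y) {A C C' : Type*} [Ring A] [Algebra R A] [Ring C] [Algebra R C]
    [Ring C'] [Algebra k C'] [Algebra R C'] [IsScalarTower R k C'] {π : A →ₐ[R] H} {σ : C →ₐ[R] C'}
    (hπ : Red k π.toLinearMap) (hσ : Red k σ.toLinearMap) (ρ : H →ₐ[k] C') :
    ∃ f : A →ₐ[R] C, ∀ a, σ (f a) = ρ (π a) := by
  have := hπ.free
  have := hπ.fin
  have := hσ.free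
  have := hσ.fin
  have hp := fun x : C' => Red.p_smul hb x
  have hpn : ∀ n, 1 ≤ n → ∀ x : C', p ^ n • x = 0 := by
    intro n hn x
    obtain ⟨m, rfl⟩ : ∃ m, n = m + 1 := ⟨n - 1, by omega⟩
    rw [pow_succ', mul_smul, hp]
  have dv : ∀ f : A ⊗[R] A →ₗ[R] C, (∀ a b, σ (f (a ⊗ₜ b)) = 0) → ∃ g, f = p • g := fun f hf =>
    hσ.div hb f fun t => LinearMap.congr_fun (f := σ.toLinearMap ∘ₗ f) (g := 0) (TensorProduct.ext' hf) t
  let T : (A →ₗ[R] C) → (A ⊗[R] A →ₗ[R] C) := fun f => f ∘ₗ LinearMap.mul' R A - LinearMap.mul' R C ∘ₗ TensorProduct.map f f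
  have hT : ∀ f a b, T f (a ⊗ₜ b) = f (a * b) - f a * f b := fun f a b => by simp [T]
  have lim := hb.limit (M := A →ₗ[R] C) (fun n f => (∃ F, T f = p ^ n • F) ∧
    ∀ a, σ (f a) = ρ (π a)) ?_ ?_
  · obtain ⟨f, hf⟩ := lim
    have h1 : ∀ a, σ (f a) = ρ (π a) := by
      obtain ⟨x, h, ⟨-, h2⟩, rfl⟩ := hf 1 le_rfl
      intro a
      simp [h2, hp]
    have h2 : ∀ a b, f (a * b) = f a * f b := by
      intro a b
      rw [← sub_eq_zero]
      refine hb.haus fun n hn => ?_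
      obtain ⟨x, h, ⟨⟨F, hF⟩, -⟩, rfl⟩ := hf n hn
      refine ⟨F (a ⊗ₜ b) + h (a * b) - x a * h b - h a * x b - p ^ n • (h a * h b), ?_⟩
      have h3 := hT x a b
      rw [hF, LinearMap.smul_apply] at h3
      simp only [smul_add, smul_sub, h3, LinearMap.add_apply, LinearMap.smul_apply, add_mul, mul_add,
        smul_mul_assoc, mul_smul_comm]
      abel
    refine ⟨AlgHom.ofLinearMap f ?_ h2, h1⟩
    obtain ⟨z, hz⟩ := hσ.div1 hb (x := f 1 - 1) (by simp [h1])
    exact hb.idem (x := z) (by rw [← hz]; simp) (by rw [← h2, mul_one])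
  · obtain ⟨f, hf⟩ := hπ.lift hb hσ ρ.toLinearMap
    simp only [AlgHom.toLinearMap_apply] at hf
    obtain ⟨g, hg⟩ := dv (T f) (by intro a b; simp [hT, hf])
    exact ⟨f, ⟨g, by rw [hg, pow_one]⟩, hf⟩
  · rintro n f hn ⟨⟨F, hF⟩, h2⟩
    have hF' : ∀ a b, f (a * b) - f a * f b = p ^ n • F (a ⊗ₜ b) := fun a b => by
      rw [← hT, hF, LinearMap.smul_apply]
    obtain ⟨E, hE⟩ := (hπ.tens hπ).ind (ρ := σ.toLinearMap) F
    simp only [AlgHom.toLinearMap_apply] at hE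
    obtain ⟨g, hg⟩ := hs.K2 ρ E (by
      intro a b c
      obtain ⟨a, rfl⟩ := hπ.surj hb a
      obtain ⟨b, rfl⟩ := hπ.surj hb b
      obtain ⟨c, rfl⟩ := hπ.surj hb c
      have h3 : f a * F (b ⊗ₜ c) - F ((a * b) ⊗ₜ c) + F (a ⊗ₜ (b * c)) - F (a ⊗ₜ b) * f c = 0 := by
        apply smul_canc (hb.pn n)
        rw [smul_zero, smul_sub, smul_add, smul_sub, ← mul_smul_comm, ← smul_mul_assoc]
        simp only [← hF']
        simp only [mul_sub, sub_mul, mul_assoc]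
        abel
      have h4 := congrArg σ h3
      simpa [hE, h2] using h4)
    obtain ⟨g', hg'⟩ := hπ.lift hb hσ g
    simp only [AlgHom.toLinearMap_apply] at hg' hg
    obtain ⟨G, hG⟩ := dv (F + (g' ∘ₗ LinearMap.mul' R A - LinearMap.mul' R C ∘ₗ TensorProduct.map f g'
      - LinearMap.mul' R C ∘ₗ TensorProduct.map g' f - p ^ n • (LinearMap.mul' R C ∘ₗ TensorProduct.map g' g'))) (by
        intro a b
        have := hg (π a) (π b)
        simp only [LinearMap.comp_apply, LinearMap.add_apply, LinearMap.sub_apply, LinearMap.smul_apply, map_add, map_smul,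
          map_sub, h2, hE, hg', tm_tmul, hpn n hn, TensorProduct.map_tmul, LinearMap.mul'_apply, map_mul, AlgHom.toLinearMap_apply]
        refine Eq.trans ?_ this; abel)
    refine ⟨g', ⟨G, ?_⟩, ?_⟩
    · rw [pow_succ, mul_smul, ← hG, smul_add, ← hF]
      refine TensorProduct.ext' fun a b => ?_
      simp only [hT, LinearMap.comp_apply, LinearMap.add_apply, LinearMap.sub_apply, LinearMap.smul_apply, TensorProduct.map_tmul, LinearMap.mul'_apply,
        smul_add, smul_sub, add_mul, mul_add, smul_mul_assoc, mul_smul_comm]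
      abel
    · intro a
      simp [h2, hpn n hn]
end
end HE
end
noncomputable section
open TensorProduct Coalgebra WithConv HopfAlgebra
set_option linter.all false
namespace HE
section lin
variable {R A : Type*} [CommRing R] [AddCommGroup A] [Module R A]
/-- `f ⊗ 1` reassociated -/
def q1 (T : Type*) [AddCommGroup T] [Module R T] (f : A →ₗ[R] A ⊗[R] A) : A ⊗[R] T →ₗ[R] A ⊗[R] (A ⊗[R] T) :=
  (TensorProduct.assoc R A A T).toLinearMap ∘ₗ TensorProduct.map f LinearMap.id
abbrev q0 {T T' : Type*} [AddCommGroup T] [Module R T] [AddCommGroup T'] [Module R T'] (f : T →ₗ[R] T') :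
  A ⊗[R] T →ₗ[R] A ⊗[R] T' := TensorProduct.map LinearMap.id f
def rr (R A : Type*) [CommRing R] [AddCommGroup A] [Module R A] :
    (A ⊗[R] (A ⊗[R] A)) ⊗[R] A →ₗ[R] A ⊗[R] (A ⊗[R] (A ⊗[R] A)) :=
  q0 (TensorProduct.assoc R A A A).toLinearMap ∘ₗ (TensorProduct.assoc R A (A ⊗[R] A) A).toLinearMap
@[simp] lemma rr_tmul (x y z w : A) : rr R A ((x ⊗ₜ (y ⊗ₜ z)) ⊗ₜ w) = x ⊗ₜ (y ⊗ₜ (z ⊗ₜ w)) := rfl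
variable {T T' : Type*} [AddCommGroup T] [Module R T] [AddCommGroup T'] [Module R T']
lemma q1_tmul (f : A →ₗ[R] A ⊗[R] A) (a : A) (t : T) : q1 T f (a ⊗ₜ t) = TensorProduct.assoc R A A T (f a ⊗ₜ t) := rfl
variable (f : A →ₗ[R] A ⊗[R] A)
lemma as0 (g : T →ₗ[R] T') (u : A ⊗[R] A) (t : T) : q0 (q0 g) (TensorProduct.assoc R A A T (u ⊗ₜ t)) =
    TensorProduct.assoc R A A T' (u ⊗ₜ g t) := by
  induction u with
  | zero => simp
  | add x y hx hy => simp only [add_tmul, map_add, hx, hy]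
  | tmul x y => rfl
lemma l1 (t : A ⊗[R] A) : q0 (q0 f) (q1 A f t) = q1 _ f (q0 f t) := by
  induction t with
  | zero => simp
  | add x y hx hy => simp only [map_add, hx, hy]
  | tmul x y => rw [q1_tmul, as0]; rfl
lemma l2a (u : A ⊗[R] A) (b : A) : q0 (q1 A f) (TensorProduct.assoc R A A A (u ⊗ₜ b)) = rr R A (q0 f u ⊗ₜ b) := by
  induction u with
  | zero => simp
  | add x y hx hy => simp only [add_tmul, map_add, hx, hy]
  | tmul x y => rfl
lemma l2 (t : A ⊗[R] A) : q0 (q1 A f) (q1 A f t) = rr R A (TensorProduct.map (q0 f ∘ₗ f) LinearMap.id t) := by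
  induction t with
  | zero => simp
  | add x y hx hy => simp only [map_add, hx, hy]
  | tmul x y => rw [q1_tmul, l2a]; rfl
lemma l3c (u : A ⊗[R] A) (x y : A) : TensorProduct.assoc R A A (A ⊗[R] A) (u ⊗ₜ (x ⊗ₜ[R] y)) =
    rr R A (TensorProduct.assoc R A A A (u ⊗ₜ x) ⊗ₜ y) := by
  induction u with
  | zero => simp
  | add x y hx hy => simp only [add_tmul, map_add, hx, hy]
  | tmul x y => rfl
lemma l3a (u : A ⊗[R] A) (b : A) : q1 _ f (TensorProduct.assoc R A A A (u ⊗ₜ b)) = rr R A (q1 A f u ⊗ₜ b) := by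
  induction u with
  | zero => simp
  | add x y hx hy => simp only [add_tmul, map_add, hx, hy]
  | tmul x y => exact l3c _ _ _
lemma l3 (t : A ⊗[R] A) : q1 _ f (q1 A f t) = rr R A (TensorProduct.map (q1 A f ∘ₗ f) LinearMap.id t) := by
  induction t with
  | zero => simp
  | add x y hx hy => simp only [map_add, hx, hy]
  | tmul x y => rw [q1_tmul, l3a]; rfl
lemma q0q0 {T'' : Type*} [AddCommGroup T''] [Module R T''] (g : T' →ₗ[R] T'') (h : T →ₗ[R] T') (t : A ⊗[R] T) :
    q0 g (q0 h t) = q0 (g ∘ₗ h) t := by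
  induction t with
  | zero => simp
  | add x y hx hy => simp only [map_add, hx, hy]
  | tmul x y => rfl
/-- coassociator -/
def Cb (f g : A →ₗ[R] A ⊗[R] A) : A →ₗ[R] A ⊗[R] (A ⊗[R] A) := q0 f ∘ₗ g - q1 A f ∘ₗ g
lemma Cb_ap (f g : A →ₗ[R] A ⊗[R] A) (a : A) : Cb f g a = q0 f (g a) - q1 A f (g a) := rfl
lemma map_sub' {T T' S S' : Type*} [AddCommGroup T] [Module R T] [AddCommGroup T'] [Module R T'] [AddCommGroup S] [Module R S]
  [AddCommGroup S'] [Module R S'] (f g : T →ₗ[R] T') (h : S →ₗ[R] S') (t : T ⊗[R] S) :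
  TensorProduct.map (f - g) h t = TensorProduct.map f h t - TensorProduct.map g h t := by
  induction t with
  | zero => simp
  | add x y hx hy => simp only [map_add, hx, hy]; abel
  | tmul x y => simp [sub_tmul]
lemma q0_sub (g h : T →ₗ[R] T') (t : A ⊗[R] T) : q0 (g - h) t = q0 g t - q0 h t := by
  induction t with
  | zero => simp
  | add x y hx hy => simp only [map_add, hx, hy]; abel
  | tmul x y => simp [tmul_sub]
lemma cb_id (a : A) : q0 (Cb f f) (f a) - q1 _ f (Cb f f a) + q0 (q1 A f) (Cb f f a) - q0 (q0 f) (Cb f f a)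
    + rr R A (TensorProduct.map (Cb f f) LinearMap.id (f a)) = 0 := by
  rw [Cb_ap]
  simp only [map_sub, l1, l2, l3, Cb, map_sub', q0_sub, q0q0]
  abel
lemma q1_add (f g : A →ₗ[R] A ⊗[R] A) (t : A ⊗[R] T) : q1 T (f + g) t = q1 T f t + q1 T g t := by
  simp [q1, TensorProduct.map_add_left]
lemma q1_smul (u : R) (f : A →ₗ[R] A ⊗[R] A) (t : A ⊗[R] T) : q1 T (u • f) t = u • q1 T f t := by
  simp [q1, TensorProduct.map_smul_left]
lemma q0_add (g h : T →ₗ[R] T') (t : A ⊗[R] T) : q0 (g + h) t = q0 g t + q0 h t := by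
  rw [q0, TensorProduct.map_add_right]; rfl
lemma q0_smul (u : R) (g : T →ₗ[R] T') (t : A ⊗[R] T) : q0 (u • g) t = u • q0 g t := by
  rw [q0, TensorProduct.map_smul_right]; rfl
lemma Cb_exp (f g : A →ₗ[R] A ⊗[R] A) (u : R) : Cb (f + u • g) (f + u • g) =
    Cb f f + u • (Cb f g + Cb g f + u • Cb g g) := by
  ext a
  simp only [Cb_ap, LinearMap.add_apply, LinearMap.smul_apply, q1_add, q1_smul, q0_add, q0_smul, map_add, map_smul]
  module
end lin
section mul
variable {R A B C D : Type*} [CommRing R] [Ring A] [Algebra R A] [Ring B] [Algebra R B] [Ring C] [Algebra R C] [Ring D] [Algebra R D]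
def IsM (f : A →ₗ[R] B) : Prop := ∀ x y, f (x * y) = f x * f y
lemma IsM.map {f : A →ₗ[R] B} {g : C →ₗ[R] D} (hf : IsM f) (hg : IsM g) : IsM (TensorProduct.map f g) := by
  intro x y
  induction x with
  | zero => simp
  | add x z hx hz => simp only [add_mul, map_add, hx, hz]
  | tmul a c =>
    induction y with
    | zero => simp
    | add x z hx hz => simp only [mul_add, map_add, hx, hz]
    | tmul a' c' => simp [hf a a', hg c c']
lemma IsM.comp {f : B →ₗ[R] C} {g : A →ₗ[R] B} (hf : IsM f) (hg : IsM g) : IsM (f ∘ₗ g) := fun x y => by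
  simp [hf _ _, hg _ _]
lemma IsM.id : IsM (LinearMap.id : A →ₗ[R] A) := fun _ _ => rfl
lemma IsM.assoc : IsM (TensorProduct.assoc R A B C).toLinearMap := fun x y =>
  map_mul (Algebra.TensorProduct.assoc R R R A B C) x y
lemma IsM.alg (f : A →ₐ[R] B) : IsM f.toLinearMap := fun x y => map_mul f x y
lemma IsM.q0 {f : B →ₗ[R] C} (hf : IsM f) : IsM (q0 (A := A) f) := IsM.id.map hf
lemma IsM.q1 {f : A →ₗ[R] A ⊗[R] A} (hf : IsM f) : IsM (q1 B f) := IsM.assoc.comp (hf.map .id)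
lemma IsM.rr : IsM (R := R) (A := (A ⊗[R] (A ⊗[R] A)) ⊗[R] A) (B := A ⊗[R] (A ⊗[R] (A ⊗[R] A))) (rr R A) :=
  (IsM.q0 (A := A) (IsM.assoc (R := R) (A := A) (B := A) (C := A))).comp (IsM.assoc (R := R) (A := A) (B := A ⊗[R] A) (C := A))
lemma IsM.br {f : A →ₗ[R] B} (hf : IsM f) (x y : A) : f (x * y - y * x) = f x * f y - f y * f x := by
  rw [map_sub, hf, hf]
lemma br0 (g : A →ₗ[R] B) (φ : B) (D : A →ₗ[R] B) (hD : ∀ a, D a = φ * g a - g a * φ) (t : C ⊗[R] A) :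
    q0 D t = (1 ⊗ₜ φ) * q0 g t - q0 g t * (1 ⊗ₜ φ) := by
  induction t with
  | zero => simp
  | add x y hx hy => simp only [map_add, hx, hy, mul_add, add_mul]; abel
  | tmul x y => simp [hD, tmul_sub]
lemma br4 (g : A →ₗ[R] B) (φ : B) (D : A →ₗ[R] B) (hD : ∀ a, D a = φ * g a - g a * φ) (t : A ⊗[R] C) :
    TensorProduct.map D LinearMap.id t = (φ ⊗ₜ 1) * TensorProduct.map g LinearMap.id t - TensorProduct.map g LinearMap.id t * (φ ⊗ₜ 1) := by
  induction t with
  | zero => simp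
  | add x y hx hy => simp only [map_add, hx, hy, mul_add, add_mul]; abel
  | tmul x y => simp [hD, sub_tmul]
end mul
end HE
end
noncomputable section
open TensorProduct Coalgebra WithConv HopfAlgebra
set_option linter.all false
namespace HE
section
variable {k H T : Type*} [Field k] [Ring H] [HopfAlgebra k H] [FiniteDimensional k H] [Ring T] [Algebra k T]
variable {L : H} {lam : H →ₗ[k] k}
/-- `lam ⊗ id` -/
def sl (lam : H →ₗ[k] k) (T : Type*) [AddCommGroup T] [Module k T] : H ⊗[k] T →ₗ[k] T :=
  (TensorProduct.lid k T).toLinearMap ∘ₗ TensorProduct.map lam LinearMap.id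
@[simp] lemma sl_tmul {T : Type*} [AddCommGroup T] [Module k T] (x : H) (t : T) : sl lam T (x ⊗ₜ t) = lam x • t := by simp [sl]
lemma sl_mulr (x : H ⊗[k] T) (t : T) : sl lam T (x * (1 ⊗ₜ t)) = sl lam T x * t := by
  induction x with
  | zero => simp
  | add x y hx hy => simp only [map_add, add_mul, hx, hy]
  | tmul x y => simp
lemma sl_mull (x : H ⊗[k] T) (t : T) : sl lam T ((1 ⊗ₜ t) * x) = t * sl lam T x := by
  induction x with
  | zero => simp
  | add x y hx hy => simp only [map_add, mul_add, hx, hy]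
  | tmul x y => simp
lemma Ints.lam_ad (I : Ints k L lam) (x h : H) :
    lam ((Sc k H * lmc x (idc k H)) h) = counit (R := k) h * lam x := by
  have h1 := congrArg (fun f : WithConv (H →ₗ[k] H) => lam (antipode k (f h) * x)) (idc_Sc (K := k) (H := H))
  simp only [(ℛ k h).convMul_apply, map_sum, lmc_apply, LinearMap.convOne_apply, antipode_one, Finset.sum_mul,
    Algebra.algebraMap_eq_smul_one, map_smul, smul_mul_assoc, one_mul, smul_eq_mul] at h1 ⊢
  rw [← h1]
  refine Finset.sum_congr rfl fun i _ => ?_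
  rw [← mul_assoc, I.lam_mul, antipode_mul_antidistrib, mul_assoc]; rfl
lemma Ints.sl_ad (I : Ints k L lam) (ψ : H ⊗[k] T) (h : H) :
    sl lam T ((cvS (K := k) (H := H) (B := H ⊗[k] T) Algebra.TensorProduct.includeLeft *
      lmc ψ (cv (K := k) (H := H) (B := H ⊗[k] T) Algebra.TensorProduct.includeLeft)) h) = counit (R := k) h • sl lam T ψ := by
  rw [(ℛ k h).convMul_apply]
  induction ψ with
  | zero => simp
  | add x y hx hy =>
    simp only [lmc_apply] at hx hy ⊢
    simp only [map_add, mul_add, add_mul, smul_add, ← hx, ← hy, Finset.sum_add_distrib]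
  | tmul x y =>
    have := congrArg (· • y) (I.lam_ad x h)
    simp only [(ℛ k h).convMul_apply, map_sum, lmc_apply, Finset.sum_smul] at this
    simpa [mul_smul] using this
lemma Ints.inv (I : Ints k L lam) (ψ : H ⊗[k] T) (δ : H →ₐ[k] T)
    (hψ : ∀ h, ψ * q0 δ.toLinearMap (comul (R := k) h) = q0 δ.toLinearMap (comul (R := k) h) * ψ) (h : H) :
    sl lam T ψ * δ h = δ h * sl lam T ψ := by
  set j : H →ₐ[k] H ⊗[k] T := Algebra.TensorProduct.includeLeft with hj
  set d : H →ₐ[k] H ⊗[k] T := Algebra.TensorProduct.includeRight.comp δ with hd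
  have hN : ∀ h, (cv j * cv d) h = q0 δ.toLinearMap (comul (R := k) h) := by
    intro h
    rw [(ℛ k h).convMul_apply]
    conv_rhs => rw [← (ℛ k h).eq]
    simp [hj, hd]
  have h1 : lmc ψ (cv j * cv d) = rmc (cv j * cv d) ψ := by
    ext h
    simpa [hN] using hψ h
  have h2 : (cvS j * lmc ψ (cv j)) * cv d = rmc (cv d) ψ := by
    rw [mul_assoc, lmc_mul, h1, mul_rmc, ← mul_assoc, cvS_cv, one_mul]
  have h3 := congrArg (fun f => sl lam T (f h)) h2
  simp only [(ℛ k h).convMul_apply (f := cvS j * lmc ψ (cv j)), map_sum, rmc_apply] at h3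
  have h4 := Coalgebra.sum_counit_smul (ℛ k h)
  have h5 : sl lam T ((d h) * ψ) = δ h * sl lam T ψ := sl_mull _ _
  refine Eq.trans ?_ (h3.trans h5)
  conv_lhs => rw [← h4]
  rw [map_sum, Finset.mul_sum]
  refine Finset.sum_congr rfl fun i _ => ?_
  have := sl_mulr (lam := lam) ((cvS j * lmc ψ (cv j)) ((ℛ k h).left i)) (δ ((ℛ k h).right i))
  refine Eq.trans ?_ this.symm
  rw [I.sl_ad]; simp

lemma co1 (h : H) : q1 H (comul (R := k)) (comul (R := k) h) = q0 (comul (R := k)) (comul (R := k) h) := by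
  exact Coalgebra.coassoc_apply (R := k) h
lemma co1' : q1 H (comul (R := k) (A := H)) ∘ₗ comul (R := k) = q0 (comul (R := k)) ∘ₗ comul (R := k) :=
  LinearMap.ext co1
lemma cMu : IsM (comul (R := k) (A := H)) := IsM.alg (Bialgebra.comulAlgHom k H)
def D3 (k H : Type*) [Field k] [Ring H] [HopfAlgebra k H] : H →ₐ[k] H ⊗[k] (H ⊗[k] H) :=
  (Algebra.TensorProduct.map (AlgHom.id k H) (Bialgebra.comulAlgHom k H)).comp (Bialgebra.comulAlgHom k H)
lemma D3_ap (h : H) : D3 k H h = q0 (comul (R := k)) (comul (R := k) h) := rfl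
lemma D3_lin : (D3 k H).toLinearMap = q0 (comul (R := k)) ∘ₗ comul (R := k) := rfl
lemma Ints.ll' (I : Ints k L lam) (t : H ⊗[k] T) : sl lam (H ⊗[k] T) (q1 T (comul (R := k)) t) = 1 ⊗ₜ sl lam T t := by
  induction t with
  | zero => simp
  | add x y hx hy => simp only [map_add, tmul_add, hx, hy]
  | tmul x y =>
    have := congrArg (fun f : WithConv (H →ₗ[k] H) => f x ⊗ₜ[k] y) I.ll
    simp only [lc_repr (ℛ k x), sum_tmul, iot_apply] at this
    rw [q1_tmul, ← (ℛ k x).eq]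
    simp only [sum_tmul, map_sum, TensorProduct.assoc_tmul, sl_tmul]
    simpa [Algebra.algebraMap_eq_smul_one, smul_tmul'] using this
lemma sl_q0 {T T' : Type*} [AddCommGroup T] [Module k T] [AddCommGroup T'] [Module k T'] (f : T →ₗ[k] T') (t : H ⊗[k] T) :
    sl lam T' (q0 f t) = f (sl lam T t) := by
  induction t with
  | zero => simp
  | add x y hx hy => simp only [map_add, hx, hy]
  | tmul x y => simp
abbrev j1 (k H : Type*) [Field k] [Ring H] [HopfAlgebra k H] : H →ₗ[k] H ⊗[k] H :=
  (Algebra.TensorProduct.includeLeft : H →ₐ[k] H ⊗[k] H).toLinearMap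
lemma rr_one (φ : H ⊗[k] (H ⊗[k] H)) : rr k H (φ ⊗ₜ 1) = q0 (q0 (j1 k H)) φ := by
  induction φ with
  | zero => simp
  | add x y hx hy => simp only [map_add, add_tmul, hx, hy]
  | tmul x y => 
    induction y with
    | zero => simp
    | add x y hx hy => simp only [map_add, add_tmul, tmul_add, hx, hy]
    | tmul x y => rfl
lemma brs {C : Type*} [Ring C] (a b c d e N : C) : (a - b + c - d + e) * N - N * (a - b + c - d + e) =
    a * N - N * a - (b * N - N * b) + (c * N - N * c) - (d * N - N * d) + (e * N - N * e) := by noncomm_ring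
theorem Ints.cobound (I : Ints k L lam) (D : H →ₗ[k] H ⊗[k] (H ⊗[k] H)) (φ : H ⊗[k] (H ⊗[k] H))
    (hD : ∀ a, D a = φ * D3 k H a - D3 k H a * φ)
    (hc : ∀ a : H, q0 D (comul (R := k) a) - q1 _ (comul (R := k)) (D a) + q0 (q1 H (comul (R := k))) (D a) - q0 (q0 (comul (R := k))) (D a)
    + rr k H (TensorProduct.map D LinearMap.id (comul (R := k) a)) = 0) :
    ∃ χ : H ⊗[k] H, ∀ δ : H →ₗ[k] H ⊗[k] H, (∀ a, δ a = χ * comul (R := k) a - comul (R := k) a * χ) →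
      D + Cb δ (comul (R := k)) + Cb (comul (R := k)) δ = 0 := by
  set N : H →ₗ[k] H ⊗[k] (H ⊗[k] (H ⊗[k] H)) := q0 (D3 k H).toLinearMap ∘ₗ comul (R := k) with hN
  have n1 : ∀ a, q0 (D3 k H).toLinearMap (comul (R := k) a) = N a := fun a => rfl
  have n4 : ∀ a, q0 (q0 (comul (R := k))) (D3 k H a) = N a := fun a => by rw [D3_ap, q0q0]; rfl
  have n3 : ∀ a, q0 (q1 H (comul (R := k))) (D3 k H a) = N a := fun a => by rw [D3_ap, q0q0, co1']; rfl
  have n2 : ∀ a, q1 _ (comul (R := k)) (D3 k H a) = N a := fun a => by rw [D3_ap, ← HE.l1, co1, ← D3_ap, n4]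
  have n5 : ∀ a, rr k H (TensorProduct.map (D3 k H).toLinearMap LinearMap.id (comul (R := k) a)) = N a := fun a => by
    rw [D3_lin, ← l2, co1, ← D3_ap, n3]
  set ψ : H ⊗[k] (H ⊗[k] (H ⊗[k] H)) := 1 ⊗ₜ φ - q1 _ (comul (R := k)) φ + q0 (q1 H (comul (R := k))) φ
    - q0 (q0 (comul (R := k))) φ + q0 (q0 (j1 k H)) φ with hψ
  have h1 : ∀ h, ψ * N h = N h * ψ := by
    intro h
    have := hc h
    rw [br0 (D3 k H).toLinearMap φ D hD, br4 (D3 k H).toLinearMap φ D hD, hD, (cMu.q1).br, (cMu.q1.q0).br, (cMu.q0.q0).br,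
      (IsM.rr (R := k) (A := H)).br, n1, n2, n3, n4, n5, rr_one] at this
    rw [← sub_eq_zero, hψ]
    refine Eq.trans ?_ this
    exact brs _ _ _ _ _ _
  have h2 := I.inv ψ (D3 k H) h1
  set χ := sl lam _ φ with hχ
  have h3 : sl lam _ ψ = φ - 1 ⊗ₜ χ + q1 H (comul (R := k)) χ - q0 (comul (R := k)) χ + q0 (j1 k H) χ := by
    rw [hψ]
    simp only [map_sub, map_add, I.ll', sl_q0, sl_tmul, I.l1, one_smul, ← hχ]
  rw [h3] at h2
  refine ⟨((-1 : k) • χ), fun δ hδ => ?_⟩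
  have hδ' : ∀ a, δ a = (((-1 : k) • χ)) * (Bialgebra.comulAlgHom k H).toLinearMap a - (Bialgebra.comulAlgHom k H).toLinearMap a * (((-1 : k) • χ)) := hδ
  ext1 a
  have m1 : TensorProduct.assoc k H H H ((((-1 : k) • χ)) ⊗ₜ 1) = (-1 : k) • q0 (j1 k H) χ := by
    rw [← smul_tmul', map_smul]; congr 1
    induction χ using TensorProduct.induction_on with
    | zero => simp
    | add x y hx hy => simp only [map_add, add_tmul, hx, hy]
    | tmul x y => rfl
  have e1 := br0 (C := H) (Bialgebra.comulAlgHom k H).toLinearMap (((-1 : k) • χ)) δ hδ' (comul (R := k) a)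
  have e2 := congrArg (TensorProduct.assoc k H H H).toLinearMap (br4 (C := H) (Bialgebra.comulAlgHom k H).toLinearMap (((-1 : k) • χ)) δ hδ' (comul (R := k) a))
  rw [(IsM.assoc (R := k) (A := H) (B := H) (C := H)).br] at e2
  have e3 : q1 H δ (comul (R := k) a) = (-1 : k) • q0 (j1 k H) χ * D3 k H a - D3 k H a * (-1 : k) • q0 (j1 k H) χ := by
    rw [← m1, D3_ap, ← co1]; exact e2
  have e4 : q0 δ (comul (R := k) a) = (1 ⊗ₜ (((-1 : k) • χ))) * D3 k H a - D3 k H a * (1 ⊗ₜ (((-1 : k) • χ))) := e1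
  simp only [LinearMap.add_apply, Cb_ap, e3, e4, hD, hδ, cMu.q1.br, cMu.q0.br, co1, ← D3_ap, LinearMap.zero_apply]
  have := sub_eq_zero.2 (h2 a)
  refine Eq.trans ?_ this
  simp only [mul_sub, mul_add, add_mul, sub_mul, tmul_smul, smul_mul_assoc, mul_smul_comm, map_smul]; module
end
end HE
end
noncomputable section
open TensorProduct Coalgebra WithConv HopfAlgebra
set_option linter.all false
namespace HE
section
variable {R : Type*} [CommRing R] [IsDomain R] {k : Type*} [Field k] [Algebra R k]
section
variable {A T T₁ H T' T₁' : Type*} [AddCommGroup A] [Module R A] [AddCommGroup T] [Module R T] [AddCommGroup T₁] [Module R T₁]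
  [AddCommGroup H] [Module R H] [Module k H] [IsScalarTower R k H]
  [AddCommGroup T'] [Module R T'] [Module k T'] [IsScalarTower R k T']
  [AddCommGroup T₁'] [Module R T₁'] [Module k T₁'] [IsScalarTower R k T₁']
  {π : A →ₗ[R] H} {ρ : T →ₗ[R] T'} {ρ₁ : T₁ →ₗ[R] T₁'}
lemma tm_q0 {g : T →ₗ[R] T₁} {g' : T' →ₗ[k] T₁'} (hg : ∀ x, ρ₁ (g x) = g' (ρ x)) (t : A ⊗[R] T) :
    tm k π ρ₁ (q0 g t) = q0 g' (tm k π ρ t) := by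
  induction t with
  | zero => simp
  | add x y hx hy => simp only [map_add, hx, hy]
  | tmul x y => simp [hg]
lemma tm_q1 {f : A →ₗ[R] A ⊗[R] A} {f' : H →ₗ[k] H ⊗[k] H} (hf : ∀ x, tm k π π (f x) = f' (π x)) (t : A ⊗[R] T) :
    tm k π (tm k π ρ) (q1 T f t) = q1 T' f' (tm k π ρ t) := by
  refine (tm_assoc _).trans ?_
  rw [tm_map hf (g' := LinearMap.id) (fun _ => rfl)]; rfl
lemma tm_rr (t : (A ⊗[R] (A ⊗[R] A)) ⊗[R] A) :
    tm k π (tm k π (tm k π π)) (rr R A t) = rr k H (tm k (tm k π (tm k π π)) π t) := by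
  refine (tm_q0 (ρ := tm k (tm k π π) π) (g' := (TensorProduct.assoc k H H H).toLinearMap) (fun x => tm_assoc x) _).trans ?_
  exact congrArg _ (tm_assoc _)
lemma tm_Cb {f g : A →ₗ[R] A ⊗[R] A} {f' g' : H →ₗ[k] H ⊗[k] H} (hf : ∀ x, tm k π π (f x) = f' (π x))
    (hg : ∀ x, tm k π π (g x) = g' (π x)) (a : A) : tm k π (tm k π π) (Cb f g a) = Cb f' g' (π a) := by
  rw [Cb_ap, map_sub, tm_q0 hf, tm_q1 hf, hg]; rfl
end
variable {A B H H' : Type*} [Ring A] [Algebra R A] [Ring B] [Algebra R B] [Ring H] [Algebra R H] [Algebra k H] [IsScalarTower R k H]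
  [Ring H'] [Algebra R H'] [Algebra k H'] [IsScalarTower R k H']
lemma tm_mul {π : A →ₗ[R] H} {ρ : B →ₗ[R] H'} (hπ : ∀ x y, π (x * y) = π x * π y) (hρ : ∀ x y, ρ (x * y) = ρ x * ρ y)
    (x y : A ⊗[R] B) : tm k π ρ (x * y) = tm k π ρ x * tm k π ρ y := by
  induction x with
  | zero => simp
  | add x z hx hz => simp only [add_mul, map_add, hx, hz]
  | tmul a c =>
    induction y with
    | zero => simp
    | add x z hx hz => simp only [mul_add, map_add, hx, hz]
    | tmul a' c' => simp [hπ a a', hρ c c']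
variable (k) in
def tmA (π : A →ₐ[R] H) (ρ : B →ₐ[R] H') : A ⊗[R] B →ₐ[R] H ⊗[k] H' :=
  AlgHom.ofLinearMap (tm k π.toLinearMap ρ.toLinearMap) (by simp [Algebra.TensorProduct.one_def])
    (tm_mul (fun _ _ => map_mul π _ _) (fun _ _ => map_mul ρ _ _))
end
section
variable {R : Type*} [CommRing R] [IsDomain R] {k : Type*} [Field k] [Algebra R k] {p : R}
variable {A H : Type*} [Ring A] [Algebra R A] [Ring H] [HopfAlgebra k H] [FiniteDimensional k H] [Algebra R H] [IsScalarTower R k H]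
variable {L : H} {lam : H →ₗ[k] k}
lemma brd {C : Type*} [Ring C] (g g' f f' : C) : g * g' - f * f' = g * (g' - f') + (g - f) * f' := by noncomm_ring
lemma coStep (hb : Bs k p) (I : Ints k L lam) {π : A →ₐ[R] H} (hπ : Red k π.toLinearMap) (n : ℕ) (hn : 1 ≤ n)
    (f : A →ₗ[R] A ⊗[R] A) (hf : IsM f) (D : A →ₗ[R] A ⊗[R] (A ⊗[R] A)) (hD : Cb f f = p ^ n • D)
    (hr : ∀ a, tmA k π π (f a) = comul (R := k) (π a)) :
    ∃ g : A →ₗ[R] A ⊗[R] A, IsM (f + p ^ n • g) ∧ (∃ D', Cb (f + p ^ n • g) (f + p ^ n • g) = p ^ (n + 1) • D') ∧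
      ∀ a, tmA k π π ((f + p ^ n • g) a) = comul (R := k) (π a) := by
  have := hπ.free
  have := hπ.fin
  have hs := sep_of_int I.l I.e (ℛ k L)
  set π2 := tmA k π π with hπ2
  set π3 := tmA k π π2 with hπ3
  set π4 := tmA k π π3 with hπ4
  have r2 : Red k π2.toLinearMap := hπ.tens hπ
  have r3 : Red k π3.toLinearMap := hπ.tens r2
  have hr' : ∀ a, tm k π.toLinearMap π.toLinearMap (f a) = comul (R := k) (π.toLinearMap a) := hr
  obtain ⟨Db, hDb⟩ := hπ.ind (ρ := π3.toLinearMap) D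
  have hDb' : ∀ a, π3 (D a) = Db (π a) := hDb
  have hD' : ∀ a, q0 f (f a) - q1 A f (f a) = p ^ n • D a := fun a => by rw [← Cb_ap, hD]; rfl
  have g1 : ∀ a, π3 (q0 f (f a)) = D3 k H (π a) := fun a => by
    refine (tm_q0 hr' _).trans ?_; rw [hr']; rfl
  have g2 : ∀ a, π3 (q1 A f (f a)) = D3 k H (π a) := fun a => by
    refine (tm_q1 hr' _).trans ?_; rw [hr']; exact co1 _
  have der : ∀ a b, D (a * b) = q0 f (f a) * D b + D a * q1 A f (f b) := by
    intro a b
    refine smul_canc (hb.pn n) ?_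
    rw [smul_add, ← mul_smul_comm, ← smul_mul_assoc, ← hD', ← hD', ← hD', hf, hf.q0, hf.q1]
    exact brd _ _ _ _
  obtain ⟨φ, hφ⟩ := hs.K1 (D3 k H) Db (by
    intro a b
    obtain ⟨a, rfl⟩ := hπ.surj hb a
    obtain ⟨b, rfl⟩ := hπ.surj hb b
    have := congrArg π3 (der a b)
    simp only [map_add, map_mul, hDb', g1, g2] at this
    exact this)
  obtain ⟨χ, hχ⟩ := I.cobound Db φ hφ (by
    intro a
    obtain ⟨a, rfl⟩ := hπ.surj hb a
    have h1 := cb_id f a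
    have h2 : q0 D (f a) - q1 _ f (D a) + q0 (q1 A f) (D a) - q0 (q0 f) (D a)
        + rr R A (TensorProduct.map D LinearMap.id (f a)) = 0 := by
      refine smul_canc (hb.pn n) ?_
      rw [smul_zero, ← h1, hD, q0_smul, TensorProduct.map_smul_left]
      simp only [LinearMap.smul_apply, map_smul, smul_add, smul_sub]
    have h3 := congrArg (tm k π.toLinearMap (tm k π.toLinearMap (tm k π.toLinearMap π.toLinearMap))) h2
    have e1 := tm_q0 (π := π.toLinearMap) hDb (f a)
    have e2 := tm_q1 (ρ := tm k π.toLinearMap π.toLinearMap) hr' (D a)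
    have e3 := tm_q0 (π := π.toLinearMap) (fun x => tm_q1 (ρ := π.toLinearMap) hr' x) (D a)
    have e4 := tm_q0 (π := π.toLinearMap) (fun x => tm_q0 (π := π.toLinearMap) hr' x) (D a)
    have e5 := tm_map (ρ := π.toLinearMap) (ρ₁ := π.toLinearMap) hDb (g := LinearMap.id) (g' := LinearMap.id) (fun _ => rfl) (f a)
    have e6 : ∀ a, tm k π.toLinearMap (tm k π.toLinearMap π.toLinearMap) (D a) = Db (π.toLinearMap a) := hDb
    rw [hr'] at e1 e5
    rw [e6] at e2 e3 e4
    rw [map_add, map_sub, map_add, map_sub, tm_rr, e2, e3, e4, map_zero] at h3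
    refine Eq.trans ?_ h3
    rw [← e1, ← e5]; rfl)
  obtain ⟨X, hX⟩ := r2.surj hb χ
  obtain ⟨m, rfl⟩ : ∃ m, n = m + 1 := ⟨n - 1, by omega⟩
  obtain ⟨F, hF⟩ := hb.unit (C := A ⊗[R] A) (y := 1 + p ^ (m + 1) • X) (x := p ^ m • X) (by rw [smul_smul, pow_succ'])
  set G : A ⊗[R] A := F⁻¹.val with hG
  have FG : (1 + p ^ (m + 1) • X) * G = 1 := by rw [← hF, hG]; simp
  have GF : G * (1 + p ^ (m + 1) • X) = 1 := by rw [← hF, hG]; simp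
  have hp : ∀ x : H ⊗[k] H, p ^ (m + 1) • x = 0 := fun x => by rw [pow_succ', mul_smul, Red.p_smul hb]
  have hG1 : π2 G = 1 := by
    have := congrArg π2 FG
    simpa [hp] using this
  set g : A →ₗ[R] A ⊗[R] A := LinearMap.mulRight R G ∘ₗ (LinearMap.mulLeft R X - LinearMap.mulRight R X) ∘ₗ f with hg
  have ga : ∀ a, g a = (X * f a - f a * X) * G := fun a => rfl
  have f' : ∀ a, (f + p ^ (m + 1) • g) a = (1 + p ^ (m + 1) • X) * f a * G := by
    intro a
    have h1 : f a * ((1 + p ^ (m + 1) • X) * G) = f a := by rw [FG, mul_one]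
    have h2 : f a * G + p ^ (m + 1) • (f a * X * G) = f a := by
      conv_rhs => rw [← h1]
      simp only [add_mul, mul_add, smul_mul_assoc, mul_smul_comm, one_mul, mul_assoc]
    rw [LinearMap.add_apply, LinearMap.smul_apply, ga]
    nth_rw 1 [← h2]
    simp only [add_mul, one_mul, smul_mul_assoc, sub_mul, smul_sub]
    abel
  refine ⟨g, fun a b => ?_, ?_, fun a => ?_⟩
  · rw [f', f', f', hf]
    have : (1 + p ^ (m + 1) • X) * f a * G * ((1 + p ^ (m + 1) • X) * f b * G) = (1 + p ^ (m + 1) • X) * f a * (G * (1 + p ^ (m + 1) • X)) * f b * G := by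
      simp only [mul_assoc]
    rw [this, GF]; simp only [mul_assoc, one_mul]
  · obtain ⟨gb, hgb⟩ := hπ.ind (ρ := π2.toLinearMap) g
    have hgb' : ∀ a, tm k π.toLinearMap π.toLinearMap (g a) = gb (π.toLinearMap a) := hgb
    have key := hχ gb (by
      intro a
      obtain ⟨a, rfl⟩ := hπ.surj hb a
      have := congrArg π2 (ga a)
      simp only [map_mul, map_sub, hG1, mul_one, hr] at this
      refine (hgb a).symm.trans (this.trans ?_)
      rw [← hX]; rfl)
    obtain ⟨E, hE⟩ := r3.div hb (D + (Cb f g + Cb g f + p ^ (m + 1) • Cb g g)) (by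
      intro a
      have h1 := tm_Cb hr' hgb' a
      have h2 := tm_Cb hgb' hr' a
      have h3 := congrArg (fun f => f (π a)) key
      simp only [LinearMap.add_apply, LinearMap.zero_apply] at h3
      have h4 : ∀ x : H ⊗[k] (H ⊗[k] H), p ^ (m + 1) • x = 0 := fun x => by rw [pow_succ', mul_smul, Red.p_smul hb]
      simp only [LinearMap.add_apply, LinearMap.smul_apply, map_add, map_smul, h4]
      refine Eq.trans ?_ h3
      refine (congrArg₂ (· + ·) (hDb a) (congrArg₂ (· + ·) (congrArg₂ (· + ·) h1 h2) rfl)).trans ?_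
      rw [add_zero, add_comm (Cb _ _ _), add_assoc]; rfl)
    refine ⟨E, ?_⟩
    rw [Cb_exp, hD, ← smul_add, hE, smul_smul, ← pow_succ]
  · rw [LinearMap.add_apply, map_add, LinearMap.smul_apply, map_smul, hp, add_zero, hr]
end
end HE
end
noncomputable section
open TensorProduct Coalgebra WithConv HopfAlgebra
set_option linter.all false
namespace HE
section
variable {R : Type*} [CommRing R] [IsDomain R] {k : Type*} [Field k] [Algebra R k] {p : R}
variable {A H : Type*} [Ring A] [Algebra R A] [Ring H] [HopfAlgebra k H] [FiniteDimensional k H] [Algebra R H] [IsScalarTower R k H]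
variable {L : H} {lam : H →ₗ[k] k}
lemma redR (k : Type*) [Field k] [Algebra R k] : Red k (Algebra.ofId R k).toLinearMap :=
  Red.mk (Module.Basis.singleton Unit R) (Module.Basis.singleton Unit k) (fun i => by simp)
theorem coLift (hb : Bs k p) (I : Ints k L lam) {π : A →ₐ[R] H} (hπ : Red k π.toLinearMap) :
    ∃ Δ : A →ₐ[R] A ⊗[R] A, Cb Δ.toLinearMap Δ.toLinearMap = 0 ∧ ∀ a, tmA k π π (Δ a) = comul (R := k) (π a) := by
  have := hπ.free
  have := hπ.fin
  have hs := sep_of_int I.l I.e (ℛ k L)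
  have r2 : Red k (tmA k π π).toLinearMap := hπ.tens hπ
  have r3 : Red k (tmA k π (tmA k π π)).toLinearMap := hπ.tens r2
  obtain ⟨Δ0, hΔ0⟩ := homLift hb hs hπ r2 (Bialgebra.comulAlgHom k H)
  have lim := hb.limit (M := A →ₗ[R] A ⊗[R] A) (fun n f => IsM f ∧ (∃ D, Cb f f = p ^ n • D) ∧
    ∀ a, tmA k π π (f a) = comul (R := k) (π a)) ?_ ?_
  · obtain ⟨X, hX⟩ := lim
    have hr : ∀ a, tmA k π π (X a) = comul (R := k) (π a) := by
      intro a
      obtain ⟨f, h, ⟨-, -, h3⟩, rfl⟩ := hX 1 le_rfl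
      rw [LinearMap.add_apply, map_add, h3, LinearMap.smul_apply, map_smul, pow_one, Red.p_smul hb, add_zero]
    have hm : ∀ a b, X (a * b) = X a * X b := by
      intro a b
      rw [← sub_eq_zero]
      refine hb.haus fun n hn => ?_
      obtain ⟨f, h, ⟨h1, -, h3⟩, rfl⟩ := hX n hn
      refine ⟨h (a * b) - f a * h b - h a * f b - p ^ n • (h a * h b), ?_⟩
      simp only [LinearMap.add_apply, h1 a b, LinearMap.smul_apply, add_mul, mul_add, smul_mul_assoc, mul_smul_comm, smul_sub, smul_add]
      abel
    have ho : X 1 = 1 := by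
      obtain ⟨y, hy⟩ := r2.div1 hb (x := X 1 - 1) (by
        have := hr 1
        rw [map_one π, Bialgebra.comul_one] at this
        rw [map_sub, sub_eq_zero]; exact this.trans (map_one (tmA k π π)).symm)
      refine hb.idem (x := y) ?_ ?_
      · rw [← hy]; abel
      · rw [← hm, mul_one]
    refine ⟨AlgHom.ofLinearMap X ho hm, ?_, hr⟩
    show Cb X X = 0
    refine LinearMap.ext fun a => ?_
    refine hb.haus (M := A ⊗[R] (A ⊗[R] A)) fun n hn => ?_
    obtain ⟨f, h, ⟨h1, ⟨D, hD⟩, h3⟩, rfl⟩ := hX n hn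
    exact ⟨(D + (Cb f h + Cb h f + p ^ n • Cb h h)) a, by rw [Cb_exp, hD, ← smul_add]; rfl⟩
  · refine ⟨Δ0.toLinearMap, IsM.alg Δ0, ?_, hΔ0⟩
    obtain ⟨D, hD⟩ := r3.div hb (Cb Δ0.toLinearMap Δ0.toLinearMap) (fun a => by
      refine (tm_Cb (π := π.toLinearMap) (f' := comul (R := k)) (g' := comul (R := k)) hΔ0 hΔ0 a).trans ?_
      rw [Cb_ap, co1, sub_self])
    exact ⟨D, by rw [hD, pow_one]⟩
  · rintro n f hn ⟨h1, ⟨D, hD⟩, h3⟩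
    exact coStep hb I hπ n hn f h1 D hD h3
lemma epsUniq (hb : Bs k p) (I : Ints k L lam) {π : A →ₐ[R] H} (hπ : Red k π.toLinearMap) (f g : A →ₐ[R] R)
    (hf : ∀ a, algebraMap R k (f a) = counit (R := k) (π a)) (hg : ∀ a, algebraMap R k (g a) = counit (R := k) (π a)) :
    f = g := by
  have := hπ.free
  have hs := sep_of_int I.l I.e (ℛ k L)
  have key : ∀ n : ℕ, ∃ D : A →ₗ[R] R, f.toLinearMap - g.toLinearMap = p ^ n • D := by
    intro n
    induction n with
    | zero => exact ⟨f.toLinearMap - g.toLinearMap, by rw [pow_zero, one_smul]⟩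
    | succ n ih =>
      obtain ⟨D, hD⟩ := ih
      have hD' : ∀ a, f a - g a = p ^ n • D a := fun a => congrArg (fun f => f a) hD
      have der : ∀ a b, D (a * b) = f a * D b + D a * g b := by
        intro a b
        refine smul_canc (hb.pn n) ?_
        rw [smul_add, ← mul_smul_comm, ← smul_mul_assoc, ← hD', ← hD', ← hD', map_mul, map_mul]
        exact brd _ _ _ _
      obtain ⟨E, hE⟩ := hπ.ind (ρ := (Algebra.ofId R k).toLinearMap) D
      have hE' : ∀ a, algebraMap R k (D a) = E (π a) := hE
      obtain ⟨φ, hφ⟩ := hs.K1 (Bialgebra.counitAlgHom k H) E (by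
        intro a b
        obtain ⟨a, rfl⟩ := hπ.surj hb a
        obtain ⟨b, rfl⟩ := hπ.surj hb b
        have := congrArg (algebraMap R k) (der a b)
        simp only [map_add, map_mul, hE', hf, hg] at this
        exact this)
      obtain ⟨D', hD''⟩ := (redR (R := R) k).div hb D (fun a => by
        refine (hE a).trans ?_
        rw [hφ, mul_comm, sub_self])
      exact ⟨D', by rw [hD, hD'', smul_smul, pow_succ]⟩
  ext a
  rw [← sub_eq_zero]
  refine hb.haus (M := R) fun n hn => ?_
  obtain ⟨D, hD⟩ := key n
  exact ⟨D a, congrArg (fun f => f a) hD⟩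
end
end HE
end
noncomputable section
open TensorProduct Coalgebra WithConv HopfAlgebra
set_option linter.all false
namespace HE
universe u
section
variable {R : Type*} [CommRing R] {A : Type*} [Ring A] [Algebra R A]
def el (e : A →ₗ[R] R) : A ⊗[R] A →ₗ[R] A := (TensorProduct.lid R A).toLinearMap ∘ₗ TensorProduct.map e LinearMap.id
def er (e : A →ₗ[R] R) : A ⊗[R] A →ₗ[R] A := (TensorProduct.rid R A).toLinearMap ∘ₗ TensorProduct.map LinearMap.id e
@[simp] lemma el_tmul (e : A →ₗ[R] R) (x y : A) : el e (x ⊗ₜ y) = e x • y := by simp [el]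
@[simp] lemma er_tmul (e : A →ₗ[R] R) (x y : A) : er e (x ⊗ₜ y) = e y • x := by simp [er]
lemma el_idem (e : A →ₗ[R] R) (Δ : A →ₗ[R] A ⊗[R] A) (hc : Cb Δ Δ = 0) (he : ∀ a, e (el e (Δ a)) = e a) (a : A) :
    el e (Δ (el e (Δ a))) = el e (Δ a) := by
  let F : A ⊗[R] (A ⊗[R] A) →ₗ[R] A := (TensorProduct.lid R A).toLinearMap ∘ₗ TensorProduct.map e (el e)
  have h1 : ∀ t : A ⊗[R] A, F (q0 Δ t) = el e (Δ (el e t)) := by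
    intro t
    induction t with
    | zero => simp
    | add x y hx hy => simp only [map_add, hx, hy]
    | tmul x y => simp [F]
  have h0 : ∀ (t : A ⊗[R] A) (y : A), F (TensorProduct.assoc R A A A (t ⊗ₜ y)) = e (el e t) • y := by
    intro t z
    induction t with
    | zero => simp [zero_tmul]
    | add x y hx hy => simp only [map_add, hx, hy, add_tmul, add_smul]
    | tmul x y => simp [F, smul_smul, mul_comm]
  have h2 : ∀ t : A ⊗[R] A, F (q1 A Δ t) = el e t := by
    intro t
    induction t with
    | zero => simp
    | add x y hx hy => simp only [map_add, hx, hy]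
    | tmul x y => rw [el_tmul, ← he x]; exact h0 (Δ x) y
  rw [← h1, ← h2]
  exact congrArg F (sub_eq_zero.1 (LinearMap.congr_fun hc a))
lemma er_idem (e : A →ₗ[R] R) (Δ : A →ₗ[R] A ⊗[R] A) (hc : Cb Δ Δ = 0) (he : ∀ a, e (el e (Δ a)) = e a) (a : A) :
    er e (Δ (er e (Δ a))) = er e (Δ a) := by
  let F : A ⊗[R] (A ⊗[R] A) →ₗ[R] A := (TensorProduct.rid R A).toLinearMap ∘ₗ TensorProduct.map LinearMap.id (e ∘ₗ el e)
  have h1 : ∀ t : A ⊗[R] A, F (q0 Δ t) = er e t := by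
    intro t
    induction t with
    | zero => simp
    | add x y hx hy => simp only [map_add, hx, hy]
    | tmul x y => simp [F, he]
  have h0 : ∀ (t : A ⊗[R] A) (y : A), F (TensorProduct.assoc R A A A (t ⊗ₜ y)) = e y • er e t := by
    intro t z
    induction t with
    | zero => simp [zero_tmul]
    | add x y hx hy => simp only [map_add, hx, hy, add_tmul, smul_add]
    | tmul x y => simp [F, smul_smul, mul_comm]
  have h2 : ∀ t : A ⊗[R] A, F (q1 A Δ t) = er e (Δ (er e t)) := by
    intro t
    induction t with
    | zero => simp
    | add x y hx hy => simp only [map_add, hx, hy]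
    | tmul x y => rw [er_tmul, map_smul, map_smul]; exact h0 (Δ x) y
  rw [← h2]
  refine Eq.trans ?_ (h1 _)
  exact congrArg F (sub_eq_zero.1 (LinearMap.congr_fun hc a)).symm
end
section
variable {R : Type u} [CommRing R] [IsDomain R] {k : Type*} [Field k] [Algebra R k] {p : R}
variable {H : Type*} [Ring H] [HopfAlgebra k H] [FiniteDimensional k H] [Algebra R H] [IsScalarTower R k H]
variable {L : H} {lam : H →ₗ[k] k}
lemma idc_of (hb : Bs k p) {A : Type*} [Ring A] [Algebra R A] {π : A →ₐ[R] H} (hπ : Red k π.toLinearMap)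
    (θ : A →ₗ[R] A) (h : ∀ a, π (θ a) = π a) : ∃ g, θ = LinearMap.id + p • g := by
  have := hπ.free
  obtain ⟨g, hg⟩ := hπ.div hb (θ - LinearMap.id) (fun a => by
    rw [LinearMap.sub_apply, map_sub, sub_eq_zero]; exact h a)
  exact ⟨g, by rw [← hg]; abel⟩
theorem bialgLift (hb : Bs k p) (I : Ints k L lam) : ∃ (A : Type u) (_ : Ring A) (_ : Bialgebra R A) (π : A →ₐ[R] H),
    Red k π.toLinearMap ∧ (∀ a, tmA k π π (comul (R := R) a) = comul (R := k) (π a)) ∧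
      ∀ a, algebraMap R k (counit (R := R) a) = counit (R := k) (π a) := by
  have hs := sep_of_int I.l I.e (ℛ k L)
  obtain ⟨A, _, _, π, hπ⟩ := algLift hb hs
  have := hπ.free
  have := hπ.fin
  obtain ⟨Δ, hc, hΔ⟩ := coLift hb I hπ
  obtain ⟨e, he⟩ := homLift hb hs hπ (redR (R := R) k) (Bialgebra.counitAlgHom k H)
  replace he : ∀ a, algebraMap R k (e a) = counit (R := k) (π a) := he
  have hl : ∀ x : A ⊗[R] A, π (el e.toLinearMap x) = TensorProduct.lid k H ((counit (R := k) (A := H)).rTensor H (tmA k π π x)) := by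
    intro t
    induction t with
    | zero => simp
    | add x y hx hy => simp only [map_add, hx, hy]
    | tmul x y =>
      rw [el_tmul, map_smul]
      show _ = TensorProduct.lid k H ((counit (R := k) (A := H)).rTensor H (π x ⊗ₜ π y))
      simp [← he]
  have hr : ∀ x : A ⊗[R] A, π (er e.toLinearMap x) = TensorProduct.rid k H ((counit (R := k) (A := H)).lTensor H (tmA k π π x)) := by
    intro t
    induction t with
    | zero => simp
    | add x y hx hy => simp only [map_add, hx, hy]
    | tmul x y =>
      rw [er_tmul, map_smul]
      show _ = TensorProduct.rid k H ((counit (R := k) (A := H)).lTensor H (π x ⊗ₜ π y))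
      simp [← he]
  have hl' : ∀ a, π (el e.toLinearMap (Δ a)) = π a := fun a => by rw [hl, hΔ]; simp
  have hr' : ∀ a, π (er e.toLinearMap (Δ a)) = π a := fun a => by rw [hr, hΔ]; simp
  have hee : ∀ a, e (el e.toLinearMap (Δ a)) = e a := by
    intro a
    have h1 : ∀ x, ((Algebra.TensorProduct.lmul' R (S := R)).comp (Algebra.TensorProduct.map e e)) x = e (el e.toLinearMap x) := by
      intro t
      induction t with
      | zero => simp
      | add x y hx hy => simp only [map_add, hx, hy]
      | tmul x y => simp
    have := epsUniq hb I hπ (((Algebra.TensorProduct.lmul' R (S := R)).comp (Algebra.TensorProduct.map e e)).comp Δ) e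
      (fun a => by
        refine (congrArg _ (h1 (Δ a))).trans ?_
        rw [he, hl']) he
    exact (h1 (Δ a)).symm.trans (DFunLike.congr_fun this a)
  have el1 : ∀ a, el e.toLinearMap (Δ a) = a := by
    obtain ⟨g, hg⟩ := idc_of hb hπ (el e.toLinearMap ∘ₗ Δ.toLinearMap) hl'
    have := hb.idem (C := Module.End R A) hg (LinearMap.ext fun a => el_idem e.toLinearMap Δ.toLinearMap hc hee a)
    exact fun a => LinearMap.congr_fun this a
  have er1 : ∀ a, er e.toLinearMap (Δ a) = a := by
    obtain ⟨g, hg⟩ := idc_of hb hπ (er e.toLinearMap ∘ₗ Δ.toLinearMap) hr'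
    have := hb.idem (C := Module.End R A) hg (LinearMap.ext fun a => er_idem e.toLinearMap Δ.toLinearMap hc hee a)
    exact fun a => LinearMap.congr_fun this a
  refine ⟨A, _, Bialgebra.ofAlgHom Δ e ?_ ?_ ?_, π, hπ, hΔ, he⟩
  · exact AlgHom.ext fun a => (sub_eq_zero.1 (LinearMap.congr_fun hc a)).symm
  · refine AlgHom.ext fun a => ?_
    have h1 := el1 a
    apply (TensorProduct.lid R A).injective
    refine h1.trans ?_
    simp
  · refine AlgHom.ext fun a => ?_
    have h1 := er1 a
    apply (TensorProduct.rid R A).injective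
    refine h1.trans ?_
    simp
end
end HE
end
noncomputable section
open TensorProduct Coalgebra WithConv HopfAlgebra
set_option linter.all false
namespace HE
universe u
section
variable {K A : Type*} [CommRing K] [Ring A] [HopfAlgebra K A]
lemma fun_lr (g lam : A →ₗ[K] K) (x : A) : g ((idc K A * iot A lam) x) = (toConv g * toConv lam) x := by
  rw [rc_repr (ℛ K x), (ℛ K x).convMul_apply]; simp [mul_comm]
lemma fun_ll (g lam : A →ₗ[K] K) (x : A) : g ((iot A lam * idc K A) x) = (toConv lam * toConv g) x := by
  rw [lc_repr (ℛ K x), (ℛ K x).convMul_apply]; simp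
end
section
variable {R : Type*} [CommRing R] [IsDomain R] {k : Type*} [Field k] [Algebra R k] {p : R}
lemma intLift (hb : Bs k p) {D : Type*} [Ring D] [Algebra R D] [Module.Free R D] [Module.Finite R D] (ε : D →ₐ[R] R)
    (Λ : D) (s : R) (h0 : ε Λ = 1 + p * s) (hl : ∀ a, ∃ y, a * Λ = ε a • Λ + p • y) (hr : ∀ a, ∃ y, Λ * a = ε a • Λ + p • y) :
    ∃ X : D, ε X = 1 ∧ (∀ a, a * X = ε a • X) ∧ ∀ a, X * a = ε a • X := by
  have lim := hb.limit (M := D) (fun n Λ => ε Λ = 1 ∧ (∀ a, ∃ y, a * Λ = ε a • Λ + p ^ n • y) ∧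
    ∀ a, ∃ y, Λ * a = ε a • Λ + p ^ n • y) ?_ ?_
  · obtain ⟨X, hX⟩ := lim
    refine ⟨X, ?_, fun a => ?_, fun a => ?_⟩
    · rw [← sub_eq_zero]
      refine hb.haus (M := R) fun n hn => ?_
      obtain ⟨x, h, ⟨h1, -⟩, rfl⟩ := hX n hn
      exact ⟨ε h, by rw [map_add, h1, map_smul]; ring⟩
    · rw [← sub_eq_zero]
      refine hb.haus fun n hn => ?_
      obtain ⟨x, h, ⟨-, h1, -⟩, rfl⟩ := hX n hn
      obtain ⟨y, hy⟩ := h1 a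
      exact ⟨y + a * h - ε a • h, by rw [mul_add, hy, mul_smul_comm]; module⟩
    · rw [← sub_eq_zero]
      refine hb.haus fun n hn => ?_
      obtain ⟨x, h, ⟨-, -, h1⟩, rfl⟩ := hX n hn
      obtain ⟨y, hy⟩ := h1 a
      exact ⟨y + h * a - ε a • h, by rw [add_mul, hy, smul_mul_assoc]; module⟩
  · obtain ⟨v, hv⟩ := hb.unit (C := R) (x := s) h0
    refine ⟨(↑v⁻¹ : R) • Λ, ?_, fun a => ?_, fun a => ?_⟩
    · rw [map_smul, ← hv, smul_eq_mul, Units.inv_mul]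
    · obtain ⟨y, hy⟩ := hl a
      exact ⟨(↑v⁻¹ : R) • y, by rw [mul_smul_comm, hy]; module⟩
    · obtain ⟨y, hy⟩ := hr a
      exact ⟨(↑v⁻¹ : R) • y, by rw [smul_mul_assoc, hy]; module⟩
  · rintro n Λ hn ⟨h1, h2, h3⟩
    choose c hc using h2
    choose d hd using h3
    have e1 : ∀ a, ε (c a) = 0 := by
      intro a
      have := congrArg ε (hc a)
      rw [map_mul, map_add, map_smul, map_smul, h1, smul_eq_mul, left_eq_add, smul_eq_mul] at this
      exact (mul_eq_zero.1 this).resolve_left (hb.pn n)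
    have e2 : ∀ a, ε (d a) = 0 := by
      intro a
      have := congrArg ε (hd a)
      rw [map_mul, map_add, map_smul, map_smul, h1, one_mul, smul_eq_mul, mul_one, left_eq_add, smul_eq_mul] at this
      exact (mul_eq_zero.1 this).resolve_left (hb.pn n)
    have hn' : p ^ n * p ^ n = p ^ (n + 1) * p ^ (n - 1) := by
      rw [← pow_add, ← pow_add]; congr 1; omega
    have e3 : Λ + p ^ n • c Λ = Λ * Λ := by rw [hc Λ, h1, one_smul]
    refine ⟨c Λ, ?_⟩
    rw [e3]
    refine ⟨by rw [map_mul, h1, one_mul], fun a => ⟨p ^ (n - 1) • c (c a), ?_⟩, fun a => ⟨p ^ (n - 1) • d (d a), ?_⟩⟩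
    · rw [← mul_assoc, hc a, add_mul, smul_mul_assoc, smul_mul_assoc, hc (c a), e1, zero_smul, zero_add, smul_smul, hn', mul_smul]
    · rw [mul_assoc, hd a, mul_add, mul_smul_comm, mul_smul_comm, hd (d a), e2, zero_smul, zero_add, smul_smul, hn', mul_smul]
end
section
variable {R : Type u} [CommRing R] [IsDomain R] {k : Type*} [Field k] [Algebra R k] {p : R}
variable {H : Type*} [Ring H] [HopfAlgebra k H] [FiniteDimensional k H] [Algebra R H] [IsScalarTower R k H]
variable {L : H} {lam : H →ₗ[k] k}
lemma cvr {A : Type*} [Ring A] [Bialgebra R A] {π : A →ₐ[R] H} (hΔ : ∀ a, tmA k π π (comul (R := R) a) = comul (R := k) (π a))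
    {C C' : Type*} [Ring C] [Algebra R C] [Ring C'] [Algebra k C'] [Algebra R C'] [IsScalarTower R k C'] (ρ : C →ₐ[R] C')
    {f g : A →ₗ[R] C} {f' g' : H →ₗ[k] C'} (hf : ∀ a, ρ (f a) = f' (π a)) (hg : ∀ a, ρ (g a) = g' (π a)) (a : A) :
    ρ ((toConv f * toConv g) a) = (toConv f' * toConv g') (π a) := by
  have h1 : ∀ t : A ⊗[R] A, ρ (LinearMap.mul' R C (TensorProduct.map f g t)) = LinearMap.mul' k C' (TensorProduct.map f' g' (tmA k π π t)) := by
    intro t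
    induction t with
    | zero => simp
    | add x y hx hy => simp only [map_add, hx, hy]
    | tmul x y =>
      show _ = LinearMap.mul' k C' (TensorProduct.map f' g' (π x ⊗ₜ π y))
      simp [hf, hg]
  refine (h1 _).trans ?_
  rw [hΔ]; rfl
theorem hopfLift (hb : Bs k p) (I : Ints k L lam) : ∃ (A : Type u) (_ : Ring A) (_ : HopfAlgebra R A) (π : A →ₐ[R] H),
    Red k π.toLinearMap ∧ (∀ a, tmA k π π (comul (R := R) a) = comul (R := k) (π a)) ∧
      ∀ a, algebraMap R k (counit (R := R) a) = counit (R := k) (π a) := by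
  obtain ⟨A, _, _, π, hπ, hΔ, he⟩ := bialgLift hb I
  have := hπ.free
  have := hπ.fin
  obtain ⟨S, hS⟩ := hπ.lift hb hπ (antipode k)
  have : Module.Finite R (WithConv (A →ₗ[R] A)) := Module.Finite.equiv (WithConv.linearEquiv R (A →ₗ[R] A)).symm
  have key : ∀ X : WithConv (A →ₗ[R] A), (∀ a, π (X a) = (1 : WithConv (H →ₗ[k] H)) (π a)) → IsUnit X := by
    intro X hX
    obtain ⟨g, hg⟩ := hπ.div hb (X - 1 : WithConv (A →ₗ[R] A)).ofConv (fun a => by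
      show π (X a - algebraMap R A (counit (R := R) a)) = 0
      rw [map_sub, hX, sub_eq_zero, AlgHom.commutes, IsScalarTower.algebraMap_apply R k H, he]
      rfl)
    refine hb.unit (x := toConv g) ?_
    rw [← sub_eq_iff_eq_add']
    exact congrArg toConv hg
  have h1 := key (toConv S * toConv LinearMap.id) (fun a => by
    rw [cvr hΔ π (f' := antipode k) (g' := LinearMap.id) hS (fun a => rfl)]
    exact congrArg (fun f => f (π a)) (Sc_idc (K := k) (H := H)))
  have h2 := key (toConv LinearMap.id * toConv S) (fun a => by
    rw [cvr hΔ π (g' := antipode k) (f' := LinearMap.id) (fun a => rfl) hS]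
    exact congrArg (fun f => f (π a)) (idc_Sc (K := k) (H := H)))
  obtain ⟨v, hv⟩ := h1
  obtain ⟨w, hw⟩ := h2
  have e1 : (v⁻¹.val * toConv S) * toConv LinearMap.id = (1 : WithConv (A →ₗ[R] A)) := by rw [mul_assoc, ← hv, Units.inv_mul]
  have e2 : toConv LinearMap.id * (toConv S * w⁻¹.val) = (1 : WithConv (A →ₗ[R] A)) := by rw [← mul_assoc, ← hw, Units.mul_inv]
  have e3 := left_inv_eq_right_inv e1 e2
  rw [← e3] at e2
  generalize (v⁻¹.val * toConv S : WithConv (A →ₗ[R] A)) = T at e1 e2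
  exact ⟨A, _, { (inferInstance : Bialgebra R A) with
    antipode := T.ofConv
    mul_antipode_rTensor_comul := congrArg ofConv e1
    mul_antipode_lTensor_comul := congrArg ofConv e2 }, π, hπ, hΔ, he⟩
theorem intsLift (hb : Bs k p) (I : Ints k L lam) {A : Type*} [Ring A] [HopfAlgebra R A] {π : A →ₐ[R] H}
    (hπ : Red k π.toLinearMap) (hΔ : ∀ a, tmA k π π (comul (R := R) a) = comul (R := k) (π a))
    (he : ∀ a, algebraMap R k (counit (R := R) a) = counit (R := k) (π a)) :
    ∃ (L' : A) (lam' : A →ₗ[R] R), Ints R L' lam' := by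
  have := hπ.free
  have := hπ.fin
  obtain ⟨Λ, hΛ⟩ := hπ.surj hb L
  replace hΛ : π Λ = L := hΛ
  obtain ⟨s, hs⟩ := hb.ker (counit (R := R) Λ - 1) (by rw [map_sub, he, hΛ, I.e, map_one, sub_self])
  have hε : ∀ a, π (counit (R := R) a • Λ) = counit (R := k) (π a) • L := by
    intro a
    rw [map_smul, hΛ, ← he, algebraMap_smul]
  obtain ⟨X, hX1, hX2, hX3⟩ := intLift hb (Bialgebra.counitAlgHom R A) Λ s (by rw [← hs]; simp)
    (fun a => by
      obtain ⟨y, hy⟩ := hπ.div1 hb (x := a * Λ - counit (R := R) a • Λ) (by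
        show π _ = 0
        rw [map_sub, hε, map_mul, hΛ, I.l, sub_self])
      exact ⟨y, by rw [← hy]; exact (add_sub_cancel _ _).symm⟩)
    (fun a => by
      obtain ⟨y, hy⟩ := hπ.div1 hb (x := Λ * a - counit (R := R) a • Λ) (by
        show π _ = 0
        rw [map_sub, hε, map_mul, hΛ, I.r, sub_self])
      exact ⟨y, by rw [← hy]; exact (add_sub_cancel _ _).symm⟩)
  let rk := redR (R := R) k
  obtain ⟨l0, hl0⟩ := hπ.lift hb rk lam
  replace hl0 : ∀ a, algebraMap R k (l0 a) = lam (π a) := hl0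
  let D := WithConv (A →ₗ[R] R)
  have : Module.Finite R D := Module.Finite.equiv (WithConv.linearEquiv R (A →ₗ[R] R)).symm
  have : Module.Free R D := Module.Free.of_equiv (WithConv.linearEquiv R (A →ₗ[R] R)).symm
  let ε : D →ₐ[R] R := AlgHom.ofLinearMap
    ({ toFun := fun g => g 1, map_add' := fun _ _ => rfl, map_smul' := fun _ _ => rfl } : D →ₗ[R] R)
    (by show counit (R := R) (1 : A) = 1; simp) (by
      intro f g
      show LinearMap.mul' R R (TensorProduct.map f.ofConv g.ofConv (comul (R := R) (1 : A))) = f 1 * g 1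
      rw [Bialgebra.comul_one]; rfl)
  have hεd : ∀ g : D, ε g = g 1 := fun _ => rfl
  have dv : ∀ f g : D, (∀ a, algebraMap R k (f a) = algebraMap R k (g a)) → ∃ y, f = g + p • y := by
    intro f g h
    obtain ⟨y, hy⟩ := rk.div hb (f - g).ofConv (fun a => by
      show algebraMap R k (f a - g a) = 0
      rw [map_sub, h, sub_self])
    exact ⟨toConv y, by rw [← sub_eq_iff_eq_add']; exact congrArg toConv hy⟩
  obtain ⟨s', hs'⟩ := hb.ker (l0 1 - 1) (by rw [map_sub, hl0, map_one π, I.l1, map_one, sub_self])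
  obtain ⟨Y, hY1, hY2, hY3⟩ := intLift hb ε (toConv l0) s' (by rw [← hs', hεd]; simp)
    (fun g => by
      obtain ⟨g', hg'⟩ := hπ.ind (ρ := (Algebra.ofId R k).toLinearMap) g.ofConv
      refine dv _ _ fun a => ?_
      refine (cvr hΔ (Algebra.ofId R k) hg' hl0 a).trans ?_
      rw [← fun_lr, I.lr, iot_apply, Algebra.algebraMap_eq_smul_one, map_smul, ← map_one π]
      refine Eq.trans ?_ (map_mul (algebraMap R k) (g 1) (l0 a)).symm
      rw [hl0, mul_comm]
      exact congrArg _ (hg' 1).symm)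
    (fun g => by
      obtain ⟨g', hg'⟩ := hπ.ind (ρ := (Algebra.ofId R k).toLinearMap) g.ofConv
      refine dv _ _ fun a => ?_
      refine (cvr hΔ (Algebra.ofId R k) hl0 hg' a).trans ?_
      rw [← fun_ll, I.ll, iot_apply, Algebra.algebraMap_eq_smul_one, map_smul, ← map_one π]
      refine Eq.trans ?_ (map_mul (algebraMap R k) (g 1) (l0 a)).symm
      rw [hl0, mul_comm]
      exact congrArg _ (hg' 1).symm)
  let b := Module.Free.chooseBasis R A
  have sep : ∀ x y : A, (∀ g : A →ₗ[R] R, g x = g y) → x = y := fun x y h => b.ext_elem fun i => h (b.coord i)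
  refine ⟨X, Y.ofConv, hX2, hX3, hX1, ?_, ?_, hY1⟩
  · ext x
    refine sep _ _ fun g => ?_
    refine (fun_ll g _ x).trans ?_
    refine (congrArg (fun f => f x) (hY3 (toConv g))).trans ?_
    show g 1 * Y x = g (algebraMap R A (Y x))
    rw [Algebra.algebraMap_eq_smul_one, map_smul, mul_comm]; rfl
  · ext x
    refine sep _ _ fun g => ?_
    refine (fun_lr g _ x).trans ?_
    refine (congrArg (fun f => f x) (hY2 (toConv g))).trans ?_
    show g 1 * Y x = g (algebraMap R A (Y x))
    rw [Algebra.algebraMap_eq_smul_one, map_smul, mul_comm]; rfl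
end
end HE
end
noncomputable section
open TensorProduct Coalgebra WithConv HopfAlgebra
set_option linter.all false
namespace HE
/-- the conclusion to be transferred -/
def Good (K H : Type*) [CommRing K] [Ring H] [HopfAlgebra K H] : Prop :=
  idc K H ^ (Module.finrank K H ^ 3) = 1 ∧ ∀ h : H, antipode K (antipode K h) = h
section
variable {R : Type*} [CommRing R] [IsDomain R] {k : Type*} [Field k] [Algebra R k]
variable {H : Type*} [Ring H] [HopfAlgebra k H] [Algebra R H] [IsScalarTower R k H]
variable {A : Type*} [Ring A] [HopfAlgebra R A]
structure Cm (k : Type*) [Field k] [Algebra R k] [HopfAlgebra k H] [IsScalarTower R k H] (π : A →ₐ[R] H) : Prop where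
  r : Red k π.toLinearMap
  d : ∀ a, tmA k π π (comul (R := R) a) = comul (R := k) (π a)
  e : ∀ a, algebraMap R k (counit (R := R) a) = counit (R := k) (π a)
variable {π : A →ₐ[R] H}
lemma Red.dim (h : Red k π.toLinearMap) : FiniteDimensional k H := by
  obtain ⟨n, b, b', hb⟩ := h
  exact Module.Finite.of_basis b'
lemma Cm.pow (h : Cm k π) (n : ℕ) (a : A) : π ((idc R A ^ n) a) = (idc k H ^ n) (π a) := by
  have := h.r.dim
  induction n generalizing a with
  | zero =>
    rw [pow_zero, pow_zero]
    show π (algebraMap R A (counit (R := R) a)) = algebraMap k H (counit (R := k) (π a))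
    rw [AlgHom.commutes, IsScalarTower.algebraMap_apply R k H, h.e]
  | succ n ih =>
    rw [pow_succ, pow_succ]
    exact cvr h.d π (f := (idc R A ^ n).ofConv) (f' := (idc k H ^ n).ofConv) (g := LinearMap.id) (g' := LinearMap.id) ih (fun _ => rfl) a
lemma Cm.S (h : Cm k π) (a : A) : π (antipode R a) = antipode k (π a) := by
  let P : WithConv (A →ₗ[R] H) := toConv π.toLinearMap
  let Q : WithConv (A →ₗ[R] H) := toConv ((antipode k (A := H)).restrictScalars R ∘ₗ π.toLinearMap)
  have e1 : post π (Sc R A) * P = 1 := by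
    have := congrArg (post π) (Sc_idc (K := R) (H := A))
    rw [map_mul, map_one] at this
    exact this
  have e2 : P * Q = 1 := by
    ext x
    let r := ℛ R x
    let r' : Coalgebra.Repr k (π x) _ := ⟨r.index, fun i => π (r.left i), fun i => π (r.right i), by
      rw [← h.d, ← r.eq, map_sum]; rfl⟩
    rw [r.convMul_apply]
    refine (HopfAlgebra.sum_mul_antipode_eq_smul r').trans ?_
    show _ = algebraMap R H (counit (R := R) x)
    rw [IsScalarTower.algebraMap_apply R k H, h.e, Algebra.algebraMap_eq_smul_one]
  exact congrArg (fun f => f a) (left_inv_eq_right_inv e1 e2)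
lemma Cm.up (h : Cm k π) (hs : Function.Surjective π) (g : Good R A) : Good k H := by
  refine ⟨?_, fun x => ?_⟩
  · ext x
    obtain ⟨a, rfl⟩ := hs x
    rw [← h.r.rank, ← h.pow, g.1, ← pow_zero (idc R A), ← pow_zero (idc k H), h.pow]
  · obtain ⟨a, rfl⟩ := hs x
    rw [← h.S, ← h.S, g.2]
lemma Cm.down (h : Cm k π) (hs : Function.Injective π) (g : Good k H) : Good R A := by
  refine ⟨?_, fun x => hs ?_⟩
  · ext x
    apply hs
    have h1 := h.pow (Module.finrank R A ^ 3) x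
    refine h1.trans ?_
    rw [h.r.rank, g.1, ← pow_zero (idc k H), ← h.pow, pow_zero]
  · rw [h.S, h.S, g.2]
lemma Red.inj (h : Red k π.toLinearMap) (hi : Function.Injective (algebraMap R k)) : Function.Injective π := by
  obtain ⟨n, b, b', hbb⟩ := h
  rw [injective_iff_map_eq_zero]
  intro a ha
  have ha' : π.toLinearMap a = 0 := ha
  rw [red_ap hbb] at ha'
  have h0 := Fintype.linearIndependent_iff.1 b'.linearIndependent _ ha'
  refine b.ext_elem fun i => ?_
  rw [map_zero]
  exact hi (by rw [h0, Finsupp.zero_apply, map_zero])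
lemma Cm.ints (h : Cm k π) {L : A} {lam : A →ₗ[R] R} (I : Ints R L lam) : ∃ (L' : H) (lam' : H →ₗ[k] k), Ints k L' lam' := by
  have := h.r.dim
  obtain ⟨lam', hl⟩ := h.r.ind (ρ := (Algebra.ofId R k).toLinearMap) lam
  replace hl : ∀ x, algebraMap R k (lam x) = lam' (π x) := hl
  obtain ⟨n, b, b', hbb⟩ := h.r
  have ext : ∀ f g : H →ₗ[k] H, (∀ a, f (π a) = g (π a)) → f = g := fun f g hfg => b'.ext fun i => by
    rw [← hbb]; exact hfg _
  have hi : ∀ a, π (iot A lam a) = iot H lam' (π a) := fun a => by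
    rw [iot_apply, iot_apply, AlgHom.commutes, IsScalarTower.algebraMap_apply R k H, hl]
  have hε : ∀ a, π (counit (R := R) a • L) = counit (R := k) (π a) • π L := fun a => by
    rw [map_smul, ← h.e, algebraMap_smul]
  refine ⟨π L, lam', fun x => ?_, fun x => ?_, ?_, ?_, ?_, ?_⟩
  · refine LinearMap.congr_fun (ext (LinearMap.mulRight k (π L)) ((counit (R := k) (A := H)).smulRight (π L)) fun a => ?_) x
    show π a * π L = counit (R := k) (π a) • π L
    rw [← map_mul, I.l, hε]
  · refine LinearMap.congr_fun (ext (LinearMap.mulLeft k (π L)) ((counit (R := k) (A := H)).smulRight (π L)) fun a => ?_) x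
    show π L * π a = counit (R := k) (π a) • π L
    rw [← map_mul, I.r, hε]
  · rw [← h.e, I.e, map_one]
  · refine congrArg toConv (ext _ (iot H lam').ofConv fun a => ?_)
    refine (cvr h.d π (f := (iot A lam).ofConv) (f' := (iot H lam').ofConv) (g := LinearMap.id) (g' := LinearMap.id) hi (fun _ => rfl) a).symm.trans ?_
    rw [← hi]; exact congrArg (fun f => π (f a)) I.ll
  · refine congrArg toConv (ext _ (iot H lam').ofConv fun a => ?_)
    refine (cvr h.d π (g := (iot A lam).ofConv) (g' := (iot H lam').ofConv) (f := LinearMap.id) (f' := LinearMap.id) (fun _ => rfl) hi a).symm.trans ?_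
    rw [← hi]; exact congrArg (fun f => π (f a)) I.lr
  · rw [← map_one π, ← hl, I.l1, map_one]
lemma Cm.bc (k : Type*) [Field k] [Algebra R k] [Module.Free R A] [Module.Finite R A] :
    Cm k (Algebra.TensorProduct.includeRight : A →ₐ[R] k ⊗[R] A) := by
  refine ⟨?_, fun a => ?_, fun a => ?_⟩
  · exact Red.mk (Module.Free.chooseBasis R A) ((Module.Free.chooseBasis R A).baseChange k) fun i => by simp
  · show _ = comul (R := k) ((1 : k) ⊗ₜ[R] a)
    rw [TensorProduct.comul_tmul, CommSemiring.comul_apply]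
    generalize comul (R := R) a = t
    induction t with
    | zero => simp
    | add x y hx hy => simp only [map_add, hx, hy, tmul_add]
    | tmul x y => rfl
  · show _ = counit (R := k) ((1 : k) ⊗ₜ[R] a)
    rw [TensorProduct.counit_tmul, CommSemiring.counit_apply, Algebra.smul_def, mul_one]
end
lemma good0 {k H : Type*} [CommRing k] [IsDomain k] [CharZero k] [Ring H] [HopfAlgebra k H] [Module.Free k H] [Module.Finite k H]
    {L : H} {lam : H →ₗ[k] k} (I : Ints k L lam) : Good k H := by
  let K := AlgebraicClosure (FractionRing k)
  have hi : Function.Injective (algebraMap k K) := by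
    rw [IsScalarTower.algebraMap_eq k (FractionRing k) K, RingHom.coe_comp]
    exact (algebraMap (FractionRing k) K).injective.comp (IsFractionRing.injective k (FractionRing k))
  have : CharZero K := charZero_of_injective_algebraMap hi
  have h := Cm.bc (A := H) (R := k) K
  obtain ⟨L', lam', I'⟩ := h.ints I
  exact h.down (h.r.inj hi) ⟨I'.exp_char0, I'.S2⟩
lemma goodp {k H : Type*} [Field k] [IsAlgClosed k] (p : ℕ) [hp : Fact p.Prime] [CharP k p] [Ring H] [HopfAlgebra k H] [FiniteDimensional k H]
    {L : H} {lam : H →ₗ[k] k} (I : Ints k L lam) : Good k H := by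
  let W := WittVector p k
  letI : Algebra W k := WittVector.constantCoeff.toAlgebra
  letI : Algebra W H := Algebra.compHom H (algebraMap W k)
  haveI : IsScalarTower W k H := IsScalarTower.of_algebraMap_eq fun _ => rfl
  have hp0 : (p : W) ≠ 0 := WittVector.p_nonzero p k
  haveI : CharZero W := by
    obtain ⟨q, hq⟩ := CharP.exists W
    rcases CharP.char_is_prime_or_zero W q with h | h
    · exfalso
      have h1 : (q : k) = 0 := by rw [← map_natCast (algebraMap W k), CharP.cast_eq_zero, map_zero]
      rw [CharP.cast_eq_zero_iff k p, Nat.prime_dvd_prime_iff_eq hp.out h] at h1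
      subst h1
      exact hp0 (CharP.cast_eq_zero W p)
    · subst h
      exact CharP.charP_to_charZero W
  have hb : Bs k (p : W) := by
    refine ⟨hp0, WittVector.constantCoeff_surjective p, fun r hr => ?_, ?_, inferInstance⟩
    · have : r ∈ Ideal.span {(p : W)} := (WittVector.mem_span_p_iff_coeff_zero_eq_zero r).2 hr
      obtain ⟨s, hs⟩ := Ideal.mem_span_singleton'.1 this
      exact ⟨s, by rw [← hs, mul_comm]⟩
    · rw [map_natCast, CharP.cast_eq_zero]
  obtain ⟨A, _, _, π, hπ, hd, he⟩ := hopfLift hb I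
  have := hπ.free
  have := hπ.fin
  obtain ⟨L', lam', I'⟩ := intsLift hb I hπ hd he
  exact Cm.up ⟨hπ, hd, he⟩ (hπ.surj hb) (good0 I')
theorem good {k H : Type*} [Field k] [Ring H] [HopfAlgebra k H] [FiniteDimensional k H]
    {L : H} {lam : H →ₗ[k] k} (I : Ints k L lam) : Good k H := by
  obtain ⟨p, hp⟩ := CharP.exists k
  rcases CharP.char_is_prime_or_zero k p with h | h
  · haveI : Fact p.Prime := ⟨h⟩
    let K := AlgebraicClosure k
    have hi : Function.Injective (algebraMap k K) := FaithfulSMul.algebraMap_injective k K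
    haveI : CharP K p := charP_of_injective_algebraMap hi p
    have h := Cm.bc (A := H) (R := k) K
    obtain ⟨L', lam', I'⟩ := h.ints I
    exact h.down (h.r.inj hi) (goodp p I')
  · subst h
    haveI := CharP.charP_to_charZero k
    exact good0 I
end HE
end
noncomputable section
open TensorProduct Coalgebra WithConv HopfAlgebra
set_option linter.all false
namespace HE
lemma leftInt {D k : Type*} [Ring D] [Field k] [IsSemisimpleRing D] (ε : D →+* k) :
    ∃ Λ : D, ε Λ = 1 ∧ ∀ a, ε a = 0 → a * Λ = 0 := by
  obtain ⟨J, hJ⟩ := exists_isCompl (RingHom.ker ε : Ideal D)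
  obtain ⟨i, hi, Λ, hΛ, h⟩ := Submodule.mem_sup.1 (hJ.sup_eq_top ▸ Submodule.mem_top : (1 : D) ∈ RingHom.ker ε ⊔ J)
  have hi' : ε i = 0 := hi
  refine ⟨Λ, ?_, fun a ha => ?_⟩
  · have := congrArg ε h
    rwa [map_add, hi', zero_add, map_one] at this
  · refine Submodule.disjoint_def.1 hJ.disjoint _ ?_ (J.smul_mem a hΛ)
    show ε (a * Λ) = 0
    rw [map_mul, ha, zero_mul]
lemma twoInt {D k : Type*} [Ring D] [Field k] [IsSemisimpleRing D] (ε : D →+* k) :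
    ∃ Λ : D, ε Λ = 1 ∧ (∀ a, ε a = 0 → a * Λ = 0) ∧ ∀ a, ε a = 0 → Λ * a = 0 := by
  obtain ⟨Λ, h1, h2⟩ := leftInt ε
  obtain ⟨Λ', h3, h4⟩ := leftInt (D := Dᵐᵒᵖ) (ε.fromOpposite fun x y => Commute.all _ _)
  replace h3 : ε Λ'.unop = 1 := h3
  replace h4 : ∀ a, ε a = 0 → Λ'.unop * a = 0 := fun a ha => congrArg MulOpposite.unop (h4 (MulOpposite.op a) ha)
  have e1 := h2 (Λ'.unop - 1) (by rw [map_sub, h3, map_one, sub_self])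
  have e2 := h4 (Λ - 1) (by rw [map_sub, h1, map_one, sub_self])
  rw [sub_mul, one_mul, sub_eq_zero] at e1
  rw [mul_sub, mul_one, sub_eq_zero] at e2
  exact ⟨Λ, h1, h2, by rw [← e1, e2]; exact h4⟩
section
variable {k H : Type*} [Field k] [Ring H] [HopfAlgebra k H] [FiniteDimensional k H] [IsSemisimpleRing H] [IsSemisimpleRing (H →ₗ[k] k)]
lemma exInts (k H : Type*) [Field k] [Ring H] [HopfAlgebra k H] [FiniteDimensional k H] [IsSemisimpleRing H] [IsSemisimpleRing (H →ₗ[k] k)] :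
    ∃ (L : H) (lam : H →ₗ[k] k), Ints k L lam := by
  obtain ⟨L, h1, h2, h3⟩ := twoInt (Bialgebra.counitAlgHom k H).toRingHom
  replace h1 : counit (R := k) L = 1 := h1
  have hc : ∀ h : H, counit (R := k) (h - algebraMap k H (counit (R := k) h)) = 0 := fun h => by simp
  let ev : (H →ₗ[k] k) →+* k :=
    { toFun := fun f => f 1
      map_one' := by show counit (R := k) (1 : H) = 1; simp
      map_zero' := rfl
      map_add' := fun _ _ => rfl
      map_mul' := fun f g => by
        show LinearMap.mul' k k (TensorProduct.map f g (comul (R := k) (1 : H))) = f 1 * g 1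
        rw [Bialgebra.comul_one]; rfl }
  obtain ⟨lam, g1, g2, g3⟩ := twoInt ev
  replace g1 : lam 1 = 1 := g1
  have hc' : ∀ g : H →ₗ[k] k, ev (g - (g 1) • (counit (R := k) (A := H))) = 0 := fun g => by
    show g 1 - g 1 * counit (R := k) (1 : H) = 0
    simp
  have g2' : ∀ g : H →ₗ[k] k, toConv g * toConv lam = g 1 • toConv lam := by
    intro g
    have h := g2 _ (hc' g)
    have h' : (toConv g - g 1 • (1 : WithConv (H →ₗ[k] k))) * toConv lam = 0 := congrArg toConv h
    rwa [sub_mul, smul_mul_assoc, one_mul, sub_eq_zero] at h'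
  have g3' : ∀ g : H →ₗ[k] k, toConv lam * toConv g = g 1 • toConv lam := by
    intro g
    have h := g3 _ (hc' g)
    have h' : toConv lam * (toConv g - g 1 • (1 : WithConv (H →ₗ[k] k))) = 0 := congrArg toConv h
    rwa [mul_sub, mul_smul_comm, mul_one, sub_eq_zero] at h'
  let b := Module.Free.chooseBasis k H
  have sep : ∀ x y : H, (∀ g : H →ₗ[k] k, g x = g y) → x = y := fun x y h => b.ext_elem fun i => h (b.coord i)
  refine ⟨L, lam, fun h => ?_, fun h => ?_, h1, ?_, ?_, g1⟩
  · have := h2 _ (hc h)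
    rwa [sub_mul, sub_eq_zero, ← Algebra.smul_def] at this
  · have := h3 _ (hc h)
    rwa [mul_sub, sub_eq_zero, ← Algebra.commutes, ← Algebra.smul_def] at this
  · ext x
    refine sep _ _ fun g => ?_
    refine (fun_ll g lam x).trans ?_
    rw [g3']
    show g 1 * lam x = g (algebraMap k H (lam x))
    rw [Algebra.algebraMap_eq_smul_one, map_smul, mul_comm]; rfl
  · ext x
    refine sep _ _ fun g => ?_
    refine (fun_lr g lam x).trans ?_
    rw [g2']
    show g 1 * lam x = g (algebraMap k H (lam x))
    rw [Algebra.algebraMap_eq_smul_one, map_smul, mul_comm]; rfl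
end
lemma expMap_eq {k H : Type*} [Field k] [Ring H] [HopfAlgebra k H] (T : H →ₗ[k] H) (hT : T ∘ₗ T = LinearMap.id) (n : ℕ) :
    expMap k H T (n + 1) = (idc k H ^ (n + 1)).ofConv := by
  induction n with
  | zero => rw [zero_add, pow_one]; rfl
  | succ n ih =>
    have h1 : ((T ∘ₗ T) ^ (n + 1) : H →ₗ[k] H) = LinearMap.id := by
      rw [hT]; exact one_pow (M := Module.End k H) (n + 1)
    show conv k H (expMap k H T (n + 1)) ((T ∘ₗ T) ^ (n + 1)) = _
    rw [ih, h1, pow_succ _ (n + 1)]; rfl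
end HE
variable (k H : Type*) [CommSemiring k] [Semiring H] [Bialgebra k H]

/-- If the finite-dimensional Hopf algebra `H` is semisimple and cosemisimple (i.e. its
convolution dual algebra `H* = Hom_k(H,k)` is a semisimple ring), then `exp(H)` is finite
and divides `(dim H)³`. -/
theorem hopfExponent_dvd_dim_cube {k H : Type*} [Field k] [Ring H] [HopfAlgebra k H]
    [FiniteDimensional k H] [IsSemisimpleRing H] [IsSemisimpleRing (H →ₗ[k] k)]
    (Sinv : H →ₗ[k] H)
    (hS1 : Sinv ∘ₗ HopfAlgebra.antipode (R := k) (A := H) = LinearMap.id)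
    (hS2 : HopfAlgebra.antipode (R := k) (A := H) ∘ₗ Sinv = LinearMap.id) :
    hopfExponent k H Sinv ≠ 0 ∧ hopfExponent k H Sinv ∣ (Module.finrank k H) ^ 3 := by
  obtain ⟨L, lam, I⟩ := HE.exInts k H
  obtain ⟨h1, h2⟩ := HE.good I
  have hT : Sinv ∘ₗ Sinv = LinearMap.id := by
    have e : ∀ x, Sinv x = HopfAlgebra.antipode k x := fun x => by
      conv_lhs => rw [← h2 x]
      exact LinearMap.congr_fun hS1 _
    refine LinearMap.ext fun x => ?_
    rw [LinearMap.comp_apply, e, e, h2]; rfl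
  have : Nontrivial H := ⟨1, 0, fun h => by
    have := congrArg (Coalgebra.counit (R := k)) h
    rw [Bialgebra.counit_one, map_zero] at this
    exact one_ne_zero this⟩
  have hd : 0 < Module.finrank k H ^ 3 := pow_pos Module.finrank_pos 3
  have hs : ∀ n, (0 < n ∧ expMap k H Sinv n = counitUnit k H) ↔ (0 < n ∧ HE.idc k H ^ n = 1) := by
    intro n
    refine and_congr_right fun hn => ?_
    obtain ⟨m, rfl⟩ : ∃ m, n = m + 1 := ⟨n - 1, by omega⟩
    rw [HE.expMap_eq Sinv hT]
    exact ⟨fun h => congrArg WithConv.toConv h, fun h => congrArg WithConv.ofConv h⟩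
  have ho : 0 < orderOf (HE.idc k H) := Nat.pos_of_ne_zero fun h => by
    have := orderOf_dvd_of_pow_eq_one h1
    rw [h, zero_dvd_iff] at this
    omega
  have e : hopfExponent k H Sinv = orderOf (HE.idc k H) := by
    have hm : orderOf (HE.idc k H) ∈ {n : ℕ | 0 < n ∧ expMap k H Sinv n = counitUnit k H} :=
      (hs _).2 ⟨ho, pow_orderOf_eq_one _⟩
    have hi := (hs _).1 (Nat.sInf_mem ⟨_, hm⟩)
    exact le_antisymm (Nat.sInf_le hm) (Nat.le_of_dvd hi.1 (orderOf_dvd_of_pow_eq_one hi.2))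
  rw [e]
  exact ⟨ho.ne', orderOf_dvd_of_pow_eq_one h1⟩
end
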